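/- arXiv:1810.09646 — 7 statements merged into one kernel-verified Lean document; each statement's English description precedes it below -/
import Mathlib

section
/- For every p ≥ 1, the Gromov–Monge p-distance d_{GM,p} defines an extended quasi-metric on the collection of isomorphism classes of metric measure spaces: for all mm-spaces X, Y, Z one has d_{GM,p}(X,Y) ≥ 0; d_{GM,p}(X,Y) = 0 if and only if X and Y are isomorphic; and d_{GM,p}(X,Z) ≤ d_{GM,p}(X,Y) + d_{GM,p}(Y,Z), where the values are taken in [0,∞] and the triangle inequality holds also when some distances are infinite. -/
open MeasureTheory Metric ENNReal

/-- The Gromov–Monge `p`-distance between (pseudo-)metric measure spaces: the infimum,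
over Borel measurable measure-preserving maps `φ : X → Y`, of the
`L^p(μX ⊗ μX)`-norm of `(x,x') ↦ |d_X(x,x') - d_Y(φ x, φ x')|`.
The infimum of the empty set in `ℝ≥0∞` is `⊤`, realizing the convention that the
distance is `∞` when no measure-preserving map exists. -/
noncomputable def dGM {X Y : Type*} [PseudoMetricSpace X] [MeasurableSpace X]
    [PseudoMetricSpace Y] [MeasurableSpace Y]
    (p : ℝ) (μX : Measure X) (μY : Measure Y) : ℝ≥0∞ :=
  sInf {c | ∃ φ : X → Y, Measurable φ ∧ Measure.map φ μX = μY ∧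
    c = eLpNorm (fun z : X × X => dist z.1 z.2 - dist (φ z.1) (φ z.2))
        (ENNReal.ofReal p) (μX.prod μX)}

/-- Two metric measure spaces are isomorphic if there is a measure-preserving isometry
from one onto the other. -/
def MMIsomorphic {X Y : Type*} [PseudoMetricSpace X] [MeasurableSpace X]
    [PseudoMetricSpace Y] [MeasurableSpace Y] (μX : Measure X) (μY : Measure Y) : Prop :=
  ∃ φ : X → Y, Isometry φ ∧ Measure.map φ μX = μY

open Filter Topology BoundedContinuousFunction

/-- An almost everywhere limit of measure-preserving maps is measure-preserving. -/
theorem map_eq_of_tendsto_ae {X Y : Type*} [MeasurableSpace X]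
    [PseudoMetricSpace Y] [MeasurableSpace Y] [BorelSpace Y]
    {μ : Measure X} [IsFiniteMeasure μ] {ν : Measure Y} [IsFiniteMeasure ν]
    {φ : ℕ → X → Y} {f : X → Y} (hφ : ∀ n, Measurable (φ n)) (hmap : ∀ n, μ.map (φ n) = ν)
    (hf : Measurable f) (hlim : ∀ᵐ x ∂μ, Tendsto (fun n => φ n x) atTop (𝓝 (f x))) :
    μ.map f = ν := by
  refine ext_of_forall_integral_eq_of_IsFiniteMeasure fun g => ?_
  rw [integral_map hf.aemeasurable g.continuous.stronglyMeasurable.aestronglyMeasurable]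
  have hconst (n : ℕ) : ∫ x, g (φ n x) ∂μ = ∫ y, g y ∂ν := by
    rw [← hmap n, integral_map (hφ n).aemeasurable
      g.continuous.stronglyMeasurable.aestronglyMeasurable]
  have hconv : Tendsto (fun n => ∫ x, g (φ n x) ∂μ) atTop (𝓝 (∫ x, g (f x) ∂μ)) := by
    refine tendsto_integral_of_dominated_convergence (fun _ => ‖g‖)
      (fun n => (g.continuous.measurable.comp (hφ n)).aestronglyMeasurable)
      (integrable_const _) (fun n => .of_forall fun x => g.norm_coe_le_norm _) ?_
    filter_upwards [hlim] with x hx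
    exact (g.continuous.tendsto _).comp hx
  simp only [hconst] at hconv
  exact tendsto_nhds_unique hconv tendsto_const_nhds

/-- A distance-preserving map on a dense set extends to an isometry. -/
theorem exists_isometry_eqOn_of_dense {X Y : Type*} [PseudoMetricSpace X] [MetricSpace Y]
    [CompleteSpace Y] {G : Set X} (hG : Dense G) {f : X → Y}
    (hf : ∀ x ∈ G, ∀ x' ∈ G, dist (f x) (f x') = dist x x') :
    ∃ ψ : X → Y, Isometry ψ ∧ Set.EqOn ψ f G := by
  have hiso : Isometry (fun x : G => f x) := .of_dist_eq fun x x' => hf x x.2 x' x'.2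
  have hcont : Continuous (hG.extend fun x : G => f x) :=
    (hG.uniformContinuous_extend hiso.uniformContinuous).continuous
  have heq (x : G) : hG.extend (fun x : G => f x) x = f x :=
    hG.extend_of_ind hiso.uniformContinuous x
  refine ⟨hG.extend fun x : G => f x, .of_dist_eq fun x x' => ?_, fun x hx => heq ⟨x, hx⟩⟩
  refine isClosed_property2 hG.denseRange_val
    (p := fun x x' => dist (hG.extend (fun x : G => f x) x) (hG.extend (fun x : G => f x) x')
      = dist x x') ?_ (fun a b => ?_) x x'
  · exact isClosed_eq (by fun_prop) (by fun_prop)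
  · rw [heq, heq, hf a a.2 b b.2]

/-- Two pairs of points whose distances to a dense set agree are at the same distance. -/
theorem dist_eq_of_dist_eq_on_dense {X Y : Type*} [PseudoMetricSpace X] [PseudoMetricSpace Y]
    {S : Set X} (hS : Dense S) {y : X → Y} {x x' : X} {a a' : Y}
    (ha : ∀ s ∈ S, dist (y s) a = dist s x) (ha' : ∀ s ∈ S, dist (y s) a' = dist s x') :
    dist a a' = dist x x' := by
  refine eq_of_forall_dist_le fun ε hε => ?_
  obtain ⟨s, hs, hxs⟩ := hS.exists_dist_lt x (half_pos hε)
  have h1 := ha s hs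
  have h2 := ha' s hs
  rw [dist_comm] at hxs
  rw [Real.dist_eq, abs_le]
  constructor
  · linarith [dist_triangle (y s) a a', dist_triangle_left x x' s]
  · linarith [dist_triangle_left a a' (y s), dist_triangle s x x']

/-- A sequence whose distances to convergent sequences tend to the distances of a fixed point to
a dense set is Cauchy. -/
theorem cauchySeq_of_tendsto_dist_on_dense {X Y : Type*} [PseudoMetricSpace X]
    [PseudoMetricSpace Y] {S : Set X} (hS : Dense S) {φ : ℕ → X → Y} {y : X → Y} {x : X}
    (hy : ∀ s ∈ S, Tendsto (fun n => φ n s) atTop (𝓝 (y s)))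
    (hx : ∀ s ∈ S, Tendsto (fun n => dist (φ n s) (φ n x)) atTop (𝓝 (dist s x))) :
    CauchySeq fun n => φ n x := by
  rw [Metric.cauchySeq_iff']
  intro ε hε
  obtain ⟨s, hs, hxs⟩ := hS.exists_dist_lt x (show 0 < ε / 4 by linarith)
  rw [dist_comm] at hxs
  have h1 : ∀ᶠ n in atTop, dist (φ n s) (φ n x) < ε / 4 := (hx s hs).eventually_lt_const hxs
  have h2 : ∀ᶠ n in atTop, dist (φ n s) (y s) < ε / 4 :=
    Metric.tendsto_nhds.1 (hy s hs) _ (by linarith)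
  obtain ⟨N, hN⟩ := eventually_atTop.1 (h1.and h2)
  refine ⟨N, fun n hn => ?_⟩
  have hn' := hN n hn
  have hN' := hN N le_rfl
  linarith [dist_triangle (φ n x) (y s) (φ N x), dist_triangle_left (φ n x) (y s) (φ n s),
    dist_triangle_left (y s) (φ N x) (φ N s)]

/-- Measure-preserving maps whose distortion tends to zero almost everywhere yield an
isomorphism of metric measure spaces. -/
theorem mmIsomorphic_of_tendsto_distortion_ae {X Y : Type*}
    [MetricSpace X] [CompactSpace X] [MeasurableSpace X]
    [MetricSpace Y] [CompactSpace Y] [MeasurableSpace Y] [BorelSpace Y]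
    {μX : Measure X} {μY : Measure Y} [IsFiniteMeasure μX] [IsFiniteMeasure μY]
    [μX.IsOpenPosMeasure] {φ : ℕ → X → Y} (hφ : ∀ n, Measurable (φ n))
    (hmap : ∀ n, μX.map (φ n) = μY)
    (hlim : ∀ᵐ z ∂μX.prod μX,
      Tendsto (fun n => dist z.1 z.2 - dist (φ n z.1) (φ n z.2)) atTop (𝓝 0)) :
    MMIsomorphic μX μY := by
  have hgood := Measure.ae_ae_of_ae_prod hlim
  obtain ⟨S, hSgood, hScount, hSdense⟩ :=
    Dense.exists_countable_dense_subset (Measure.dense_of_ae hgood)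
  have : Countable S := hScount.to_subtype
  obtain ⟨y, k, hk, hy⟩ := CompactSpace.tendsto_subseq fun n (s : S) => φ n s
  rw [tendsto_pi_nhds] at hy
  obtain ⟨y', rfl⟩ : ∃ y' : X → Y, (fun s : S => y' s) = y := by
    rcases isEmpty_or_nonempty Y with hY | hY
    · exact ⟨φ 0, funext fun s => hY.elim (φ 0 s)⟩
    · exact ⟨Function.extend Subtype.val y fun _ => hY.some,
        funext fun s => Subtype.val_injective.extend_apply _ _ _⟩
  have hS (s : X) (hs : s ∈ S) : Tendsto (fun n => φ (k n) s) atTop (𝓝 (y' s)) := hy ⟨s, hs⟩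
  have hdist : ∀ᵐ x ∂μX, ∀ s ∈ S,
      Tendsto (fun n => dist (φ (k n) s) (φ (k n) x)) atTop (𝓝 (dist s x)) := by
    refine (ae_ball_iff hScount).2 fun s hs => ?_
    filter_upwards [hSgood hs] with x hx
    simpa using (hx.comp hk.tendsto_atTop).const_sub (dist s x)
  obtain ⟨f, hf, hflim⟩ := measurable_limit_of_tendsto_metrizable_ae (μ := μX)
    (fun n => (hφ (k n)).aemeasurable)
    (hdist.mono fun x hx => cauchySeq_tendsto_of_complete
      (cauchySeq_of_tendsto_dist_on_dense hSdense hS hx))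
  have hfdist : ∀ᵐ x ∂μX, ∀ s ∈ S, dist (y' s) (f x) = dist s x := by
    filter_upwards [hdist, hflim] with x hx hfx s hs
    exact tendsto_nhds_unique ((hS s hs).dist hfx) (hx s hs)
  obtain ⟨ψ, hψ, hψf⟩ := exists_isometry_eqOn_of_dense (Measure.dense_of_ae hfdist)
    fun x hx x' hx' => dist_eq_of_dist_eq_on_dense hSdense hx hx'
  refine ⟨ψ, hψ, ?_⟩
  rw [Measure.map_congr (hfdist.mono fun x hx => hψf hx)]
  exact map_eq_of_tendsto_ae (fun n => hφ (k n)) (fun n => hmap (k n)) hf hflim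

theorem measurable_distortion {X Y : Type*}
    [MetricSpace X] [CompactSpace X] [MeasurableSpace X] [BorelSpace X]
    [MetricSpace Y] [CompactSpace Y] [MeasurableSpace Y] [BorelSpace Y]
    {φ : X → Y} (hφ : Measurable φ) :
    Measurable fun z : X × X => dist z.1 z.2 - dist (φ z.1) (φ z.2) := by
  fun_prop

theorem MMIsomorphic.of_dGM_eq_zero {X Y : Type*}
    [MetricSpace X] [CompactSpace X] [MeasurableSpace X] [BorelSpace X]
    [MetricSpace Y] [CompactSpace Y] [MeasurableSpace Y] [BorelSpace Y]
    {μX : Measure X} {μY : Measure Y} [IsFiniteMeasure μX] [IsFiniteMeasure μY]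
    [μX.IsOpenPosMeasure] {p : ℝ} (hp : 0 < p) (h : dGM p μX μY = 0) :
    MMIsomorphic μX μY := by
  have hex (n : ℕ) : ∃ φ : X → Y, Measurable φ ∧ μX.map φ = μY ∧
      eLpNorm (fun z : X × X => dist z.1 z.2 - dist (φ z.1) (φ z.2))
        (ENNReal.ofReal p) (μX.prod μX) < (n : ℝ≥0∞)⁻¹ := by
    have hlt : dGM p μX μY < (n : ℝ≥0∞)⁻¹ := by simp [h]
    obtain ⟨_, ⟨φ, hφ, hmap, rfl⟩, hc⟩ := sInf_lt_iff.1 hlt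
    exact ⟨φ, hφ, hmap, hc⟩
  choose φ hφ hmap hlt using hex
  have hmeas : TendstoInMeasure (μX.prod μX)
      (fun n (z : X × X) => dist z.1 z.2 - dist (φ n z.1) (φ n z.2)) atTop 0 := by
    refine tendstoInMeasure_of_tendsto_eLpNorm (ENNReal.ofReal_pos.2 hp).ne'
      (fun n => (measurable_distortion (hφ n)).aestronglyMeasurable)
      aestronglyMeasurable_zero ?_
    simp only [sub_zero]
    exact tendsto_of_tendsto_of_tendsto_of_le_of_le tendsto_const_nhds
      ENNReal.tendsto_inv_nat_nhds_zero (fun _ => zero_le) fun n => (hlt n).le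
  obtain ⟨k, -, hk⟩ := hmeas.exists_seq_tendsto_ae
  exact mmIsomorphic_of_tendsto_distortion_ae (fun n => hφ (k n)) (fun n => hmap (k n)) hk

theorem MMIsomorphic.dGM_eq_zero {X Y : Type*}
    [PseudoMetricSpace X] [MeasurableSpace X] [BorelSpace X]
    [PseudoMetricSpace Y] [MeasurableSpace Y] [BorelSpace Y]
    {μX : Measure X} {μY : Measure Y} {p : ℝ} (h : MMIsomorphic μX μY) :
    dGM p μX μY = 0 := by
  obtain ⟨φ, hφ, hmap⟩ := h
  refine le_antisymm (sInf_le ⟨φ, hφ.continuous.measurable, hmap, ?_⟩) zero_le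
  simp [hφ.dist_eq]

theorem dGM_triangle {X Y Z : Type*}
    [MetricSpace X] [CompactSpace X] [MeasurableSpace X] [BorelSpace X]
    [MetricSpace Y] [CompactSpace Y] [MeasurableSpace Y] [BorelSpace Y]
    [MetricSpace Z] [CompactSpace Z] [MeasurableSpace Z] [BorelSpace Z]
    (μX : Measure X) (μY : Measure Y) (μZ : Measure Z)
    [SFinite μX] [SFinite μY] {p : ℝ} (hp : 1 ≤ p) :
    dGM p μX μZ ≤ dGM p μX μY + dGM p μY μZ := by
  rw [dGM.eq_def p μX μY, ENNReal.sInf_add]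
  refine le_iInf₂ ?_
  rintro _ ⟨φ, hφ, hφmap, rfl⟩
  rw [dGM.eq_def p μY μZ, add_comm, ENNReal.sInf_add]
  refine le_iInf₂ ?_
  rintro _ ⟨ψ, hψ, hψmap, rfl⟩
  have hpres : MeasurePreserving φ μX μY := ⟨hφ, hφmap⟩
  have hcomp := eLpNorm_comp_measurePreserving (p := ENNReal.ofReal p)
    (measurable_distortion hψ).aestronglyMeasurable (hpres.prod hpres)
  rw [← hcomp, add_comm]
  calc dGM p μX μZ
      ≤ eLpNorm (fun z : X × X => dist z.1 z.2 - dist ((ψ ∘ φ) z.1) ((ψ ∘ φ) z.2))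
          (ENNReal.ofReal p) (μX.prod μX) :=
        sInf_le ⟨ψ ∘ φ, hψ.comp hφ, by rw [← Measure.map_map hψ hφ, hφmap, hψmap], rfl⟩
    _ ≤ _ := by
        refine le_of_eq_of_le (congrArg (eLpNorm · _ _) ?_)
          (eLpNorm_add_le (measurable_distortion hφ).aestronglyMeasurable
            ((measurable_distortion hψ).comp (hpres.prod hpres).measurable).aestronglyMeasurable
            (by simpa using hp))
        ext z
        simp

/-- **Theorem (Gromov–Monge distance is an extended quasi-metric).**
For every `p ≥ 1` and all metric measure spaces `X, Y, Z` (compact metric spaces with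
fully supported Borel probability measures): `d_{GM,p}(X,Y) ≥ 0`; `d_{GM,p}(X,Y) = 0`
iff `X` and `Y` are isomorphic; and the triangle inequality
`d_{GM,p}(X,Z) ≤ d_{GM,p}(X,Y) + d_{GM,p}(Y,Z)` holds (also with infinite values,
the distances taking values in `[0,∞]`). -/
theorem gromovMonge_extended_quasiMetric
    {X Y Z : Type*}
    [MetricSpace X] [CompactSpace X] [MeasurableSpace X] [BorelSpace X]
    [MetricSpace Y] [CompactSpace Y] [MeasurableSpace Y] [BorelSpace Y]
    [MetricSpace Z] [CompactSpace Z] [MeasurableSpace Z] [BorelSpace Z]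
    (μX : Measure X) (μY : Measure Y) (μZ : Measure Z)
    [IsProbabilityMeasure μX] [IsProbabilityMeasure μY] [IsProbabilityMeasure μZ]
    [μX.IsOpenPosMeasure] [μY.IsOpenPosMeasure] [μZ.IsOpenPosMeasure]
    (p : ℝ) (hp : 1 ≤ p) :
    0 ≤ dGM p μX μY ∧
    (dGM p μX μY = 0 ↔ MMIsomorphic μX μY) ∧
    dGM p μX μZ ≤ dGM p μX μY + dGM p μY μZ := by
  exact ⟨zero_le, ⟨.of_dGM_eq_zero (by linarith), MMIsomorphic.dGM_eq_zero⟩,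
    dGM_triangle μX μY μZ hp⟩
end

section
/- Let X and Y be mm-spaces whose underlying sets are finite, and let p ≥ 1. If |X| = |Y| then d_{GM,p}(X,Y) = d_{GM,p}(Y,X). If |X| ≠ |Y| then at least one of d_{GM,p}(X,Y), d_{GM,p}(Y,X) equals ∞, and symmetry d_{GM,p}(X,Y) = d_{GM,p}(Y,X) holds only when both values are ∞. -/
open MeasureTheory Metric ENNReal

/-- A measure-preserving map into a finite space with a fully supported measure is surjective. -/
theorem surjective_of_map_eq {X Y : Type*} [Finite Y] [MeasurableSpace X]
    [MetricSpace Y] [MeasurableSpace Y] [BorelSpace Y]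
    {μX : Measure X} {μY : Measure Y} [μY.IsOpenPosMeasure]
    {φ : X → Y} (hφ : Measurable φ) (h : Measure.map φ μX = μY) :
    Function.Surjective φ := by
  intro y
  have hpos : μY {y} ≠ 0 := (isOpen_discrete {y}).measure_ne_zero μY (Set.singleton_nonempty y)
  rw [← h, Measure.map_apply hφ (measurableSet_singleton y)] at hpos
  exact nonempty_of_measure_ne_zero hpos

/-- A finite Gromov–Monge distance forces the target to have at most as many points. -/
theorem card_le_of_dGM_ne_top {X Y : Type*} [Finite X] [Finite Y]
    [MetricSpace X] [MeasurableSpace X]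
    [MetricSpace Y] [MeasurableSpace Y] [BorelSpace Y]
    {μX : Measure X} {μY : Measure Y} [μY.IsOpenPosMeasure]
    {p : ℝ} (h : dGM p μX μY ≠ ⊤) : Nat.card Y ≤ Nat.card X := by
  contrapose! h
  refine sInf_eq_top.2 ?_
  rintro _ ⟨φ, hφ, hmap, -⟩
  exact absurd (Nat.card_le_card_of_surjective φ (surjective_of_map_eq hφ hmap)) h.not_ge

/-- Between finite spaces of equal cardinality, inverting measure-preserving maps bounds the
reversed Gromov–Monge distance. -/
theorem dGM_le_dGM_swap_of_card_eq {X Y : Type*} [Finite X] [Finite Y]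
    [MetricSpace X] [MeasurableSpace X] [BorelSpace X]
    [MetricSpace Y] [MeasurableSpace Y] [BorelSpace Y]
    (μX : Measure X) (μY : Measure Y)
    [IsProbabilityMeasure μX] [IsProbabilityMeasure μY] [μY.IsOpenPosMeasure]
    (p : ℝ) (hcard : Nat.card X = Nat.card Y) : dGM p μY μX ≤ dGM p μX μY := by
  refine le_sInf ?_
  rintro _ ⟨φ, hφ, hmap, rfl⟩
  have hbij : Function.Bijective φ :=
    (Nat.bijective_iff_surjective_and_card φ).2 ⟨surjective_of_map_eq hφ hmap, hcard⟩
  obtain ⟨ψ, hleft, -⟩ := Function.bijective_iff_has_inverse.1 hbij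
  have hψ : Measurable ψ := Measurable.of_discrete
  refine sInf_le ⟨ψ, hψ, ?_, ?_⟩
  · rw [← hmap, Measure.map_map hψ hφ, hleft.comp_eq_id, Measure.map_id]
  · have hmp : MeasurePreserving φ μX μY := ⟨hφ, hmap⟩
    have hg : Measurable fun z : Y × Y => dist z.1 z.2 - dist (ψ z.1) (ψ z.2) :=
      Measurable.of_discrete
    rw [← eLpNorm_comp_measurePreserving hg.aestronglyMeasurable (hmp.prod hmp), ← eLpNorm_neg]
    congr 1
    ext z
    simp [hleft z.1, hleft z.2]

/-- **Proposition (symmetry of Gromov–Monge distance for finite mm-spaces).**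
Let `X`, `Y` be mm-spaces with finite underlying sets and `p ≥ 1`.
If `|X| = |Y|` then `d_{GM,p}(X,Y) = d_{GM,p}(Y,X)`.  If `|X| ≠ |Y|` then at least one
of the two distances is `∞`, and symmetry holds only when both are `∞`. -/
theorem gromovMonge_symmetry_finite
    {X Y : Type*} [Finite X] [Finite Y]
    [MetricSpace X] [CompactSpace X] [MeasurableSpace X] [BorelSpace X]
    [MetricSpace Y] [CompactSpace Y] [MeasurableSpace Y] [BorelSpace Y]
    (μX : Measure X) (μY : Measure Y)
    [IsProbabilityMeasure μX] [IsProbabilityMeasure μY]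
    [μX.IsOpenPosMeasure] [μY.IsOpenPosMeasure]
    (p : ℝ) (hp : 1 ≤ p) :
    (Nat.card X = Nat.card Y → dGM p μX μY = dGM p μY μX) ∧
    (Nat.card X ≠ Nat.card Y →
      (dGM p μX μY = ⊤ ∨ dGM p μY μX = ⊤) ∧
      (dGM p μX μY = dGM p μY μX → dGM p μX μY = ⊤ ∧ dGM p μY μX = ⊤)) := by
  refine ⟨fun h => le_antisymm (dGM_le_dGM_swap_of_card_eq μY μX p h.symm)
    (dGM_le_dGM_swap_of_card_eq μX μY p h), fun hne => ?_⟩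
  have htop : dGM p μX μY = ⊤ ∨ dGM p μY μX = ⊤ := by
    by_contra! h
    exact hne (le_antisymm (card_le_of_dGM_ne_top h.2) (card_le_of_dGM_ne_top h.1))
  refine ⟨htop, fun heq => ?_⟩
  rcases htop with h | h
  · exact ⟨h, heq ▸ h⟩
  · exact ⟨heq.trans h, h⟩
end

section
/- For each n ≥ 1 let Δ_n denote the mm-space with underlying set {1,…,n}, metric d_n(i,j) = 1 if i ≠ j and 0 if i = j, and uniform measure assigning mass 1/n to each point. Then for every p ∈ [1,∞), d_{GM,p}(Δ_{2n}, Δ_n) = (1/(2n))^{1/p}. -/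
open MeasureTheory Metric ENNReal

/-- A map between finite types pushes uniform measure to uniform measure when the total masses
are in ratio `2` exactly when all its fibers have two points. -/
lemma map_uniform_eq_iff_card_fiber_eq_two
    {A B : Type*} [Fintype A] [Fintype B] [DecidableEq B]
    [MeasurableSpace A] [DiscreteMeasurableSpace A]
    [MeasurableSpace B] [DiscreteMeasurableSpace B]
    {n : ℕ} (hn : 1 ≤ n) (φ : A → B) :
    Measure.map φ ((2 * n : ℝ≥0∞)⁻¹ • (Measure.count : Measure A))
        = (n : ℝ≥0∞)⁻¹ • (Measure.count : Measure B) ↔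
      ∀ b, (Finset.univ.filter fun a => φ a = b).card = 2 := by
  have hn0 : (n : ℝ≥0∞) ≠ 0 := by exact_mod_cast (by omega : n ≠ 0)
  have hnt : (n : ℝ≥0∞) ≠ ∞ := natCast_ne_top n
  have hpre : ∀ b, φ ⁻¹' {b} = ((Finset.univ.filter fun a => φ a = b : Finset A) : Set A) := by
    intro b; ext a; simp
  rw [Measure.ext_iff_singleton]
  refine forall_congr' fun b => ?_
  rw [Measure.map_apply .of_discrete (.of_discrete), hpre, Measure.smul_apply, Measure.smul_apply,
    Measure.count_apply_finset, Measure.count_singleton, smul_eq_mul, smul_eq_mul, mul_one,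
    ENNReal.mul_inv (by simp) (by simp)]
  constructor
  · intro h
    have h' := congrArg (fun t : ℝ≥0∞ => 2 * n * t) h
    have e : ∀ k : ℝ≥0∞, 2 * n * (2⁻¹ * (n : ℝ≥0∞)⁻¹ * k) = k := fun k => by
      calc 2 * n * (2⁻¹ * (n : ℝ≥0∞)⁻¹ * k)
          = (2 * 2⁻¹) * (n * (n : ℝ≥0∞)⁻¹) * k := by ring
        _ = k := by
          rw [ENNReal.mul_inv_cancel hn0 hnt, ENNReal.mul_inv_cancel (by simp) (by simp)]; simp
    simp only [e] at h'
    rw [mul_assoc, ENNReal.mul_inv_cancel hn0 hnt, mul_one] at h'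
    exact_mod_cast h'
  · intro h
    rw [h, mul_right_comm, Nat.cast_two, ENNReal.inv_mul_cancel (by simp) (by simp), one_mul]

/-- If all fibers of `φ` have two points, there are `|A|` ordered pairs of distinct points with
the same image. -/
lemma sum_sum_ite_ne_and_eq {A B : Type*} [Fintype A] [DecidableEq A] [DecidableEq B]
    {φ : A → B} (h : ∀ b, (Finset.univ.filter fun a => φ a = b).card = 2) :
    ∑ x : A, ∑ y : A, (if x ≠ y ∧ φ x = φ y then (1 : ℝ≥0∞) else 0) = Fintype.card A := by
  have hx : ∀ x : A, ∑ y : A, (if x ≠ y ∧ φ x = φ y then (1 : ℝ≥0∞) else 0) = 1 := by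
    intro x
    have hs : (Finset.univ.filter fun y => x ≠ y ∧ φ x = φ y)
        = (Finset.univ.filter fun y => φ y = φ x).erase x := by
      ext y; simp [eq_comm]
    rw [Finset.sum_boole, hs, Finset.card_erase_of_mem (by simp), h]
    simp
  simp [hx]

/-- The distortion of a two-to-one map between simplices with unit edges. -/
lemma eLpNorm_dist_sub_dist_of_card_fiber_eq_two
    {A B : Type*} [Fintype A] [DecidableEq A] [DecidableEq B]
    [MetricSpace A] [MeasurableSpace A] [DiscreteMeasurableSpace A] [MetricSpace B]
    {n : ℕ} (hn : 1 ≤ n) (hcardA : Fintype.card A = 2 * n)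
    (hdA : ∀ i j : A, dist i j = if i = j then 0 else 1)
    (hdB : ∀ i j : B, dist i j = if i = j then 0 else 1)
    {p : ℝ} (hp : 0 < p) {φ : A → B}
    (h : ∀ b, (Finset.univ.filter fun a => φ a = b).card = 2) :
    eLpNorm (fun z : A × A => dist z.1 z.2 - dist (φ z.1) (φ z.2)) (ENNReal.ofReal p)
        (((2 * n : ℝ≥0∞)⁻¹ • (Measure.count : Measure A)).prod
          ((2 * n : ℝ≥0∞)⁻¹ • (Measure.count : Measure A)))
      = (2 * n : ℝ≥0∞)⁻¹ ^ (1 / p) := by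
  have hn0 : (2 * n : ℝ≥0∞) ≠ 0 := by exact_mod_cast (by omega : 2 * n ≠ 0)
  have hnt : (2 * n : ℝ≥0∞) ≠ ∞ := mul_ne_top (by simp) (natCast_ne_top n)
  have hval : ∀ x y : A, ‖dist x y - dist (φ x) (φ y)‖ₑ ^ p
      = if x ≠ y ∧ φ x = φ y then (1 : ℝ≥0∞) else 0 := by
    intro x y
    rw [hdA, hdB]
    by_cases hxy : x = y
    · simp [hxy, hp]
    · by_cases hφ : φ x = φ y <;> simp [hxy, hφ, hp]
  have : IsFiniteMeasure ((2 * n : ℝ≥0∞)⁻¹ • (Measure.count : Measure A)) :=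
    Measure.smul_finite _ (by simpa using hn0)
  rw [eLpNorm_eq_lintegral_rpow_enorm_toReal (by simpa using hp) ofReal_ne_top,
    toReal_ofReal hp.le, lintegral_prod _ (Measurable.of_discrete.aemeasurable)]
  simp only [hval, lintegral_smul_measure, lintegral_count, tsum_fintype, smul_eq_mul]
  rw [← Finset.mul_sum, sum_sum_ite_ne_and_eq h, hcardA]
  push_cast
  rw [ENNReal.inv_mul_cancel hn0 hnt, mul_one]

/-- **Example (the spaces `Δ_{2n}` and `Δ_n`).**  Let `A` be a `2n`-point space and `B`
an `n`-point space (`n ≥ 1`), each with the metric `d(i,j) = 1` for `i ≠ j` (and `0` for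
`i = j`) and the uniform measure giving each point mass `1/|·|`.  Then for every
`p ∈ [1,∞)`, `d_{GM,p}(Δ_{2n}, Δ_n) = (1/(2n))^{1/p}`. -/
theorem gromovMonge_delta2n_deltan
    {A B : Type*} [Fintype A] [Fintype B] [DecidableEq A] [DecidableEq B]
    [MetricSpace A] [MeasurableSpace A] [BorelSpace A]
    [MetricSpace B] [MeasurableSpace B] [BorelSpace B]
    (n : ℕ) (hn : 1 ≤ n)
    (hcardA : Fintype.card A = 2 * n) (hcardB : Fintype.card B = n)
    (hdA : ∀ i j : A, dist i j = if i = j then 0 else 1)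
    (hdB : ∀ i j : B, dist i j = if i = j then 0 else 1)
    (p : ℝ) (hp : 1 ≤ p) :
    dGM p (((2 * n : ℝ≥0∞))⁻¹ • (Measure.count : Measure A)) (((n : ℝ≥0∞))⁻¹ • (Measure.count : Measure B))
      = ((2 * n : ℝ≥0∞))⁻¹ ^ (1 / p) := by
  have hp0 : 0 < p := by linarith
  let e : A ≃ B × Fin 2 := Fintype.equivOfCardEq (by simp [hcardA, hcardB, mul_comm])
  have he : ∀ b, (Finset.univ.filter fun a => (e a).1 = b).card = 2 := by
    intro b
    have hs : (Finset.univ.filter fun a => (e a).1 = b)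
        = ({b} ×ˢ (Finset.univ : Finset (Fin 2))).map e.symm.toEmbedding := by
      ext a
      rw [Finset.mem_map_equiv, Equiv.symm_symm, Finset.mem_product]
      simp
    rw [hs, Finset.card_map, Finset.card_product, Finset.card_singleton, Finset.card_univ,
      Fintype.card_fin]
  refine le_antisymm (sInf_le ⟨fun a => (e a).1, .of_discrete,
    (map_uniform_eq_iff_card_fiber_eq_two hn _).2 he,
    (eLpNorm_dist_sub_dist_of_card_fiber_eq_two hn hcardA hdA hdB hp0 he).symm⟩) (le_sInf ?_)
  rintro c ⟨φ, -, hφ, rfl⟩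
  exact (eLpNorm_dist_sub_dist_of_card_fiber_eq_two hn hcardA hdA hdB hp0
    ((map_uniform_eq_iff_card_fiber_eq_two hn φ).1 hφ)).ge
end

section
/- Let X and Y be mm-spaces and p ∈ [1,∞). Then d_{GM,p}(X,Y) ≥ inf over measure-preserving maps φ: X → Y of ∫_X (∫_0^1 |h_X^{-1}(x,u) − h_Y^{-1}(φ(x),u)|^p du)^{1/p} μ_X(dx). In particular, for p = 1, d_{GM,1}(X,Y) ≥ inf over measure-preserving φ of ∫_X c_{X,Y}(x,φ(x)) μ_X(dx), where c_{X,Y}(x,y) = ∫_0^∞ |h_X(x,t) − h_Y(y,t)| dt. -/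
open MeasureTheory Metric ENNReal

/-- The local distance distribution `h_X(x,t) = μX(closed ball of radius t about x)`. -/
noncomputable def localDistrib {X : Type*} [PseudoMetricSpace X] [MeasurableSpace X]
    (μX : Measure X) (x : X) (t : ℝ) : ℝ :=
  (μX (Metric.closedBall x t)).toReal

/-- The generalized inverse `h_X^{-1}(x,u) = inf{r ≥ 0 : h_X(x,r) > u}`. -/
noncomputable def localDistribInv {X : Type*} [PseudoMetricSpace X] [MeasurableSpace X]
    (μX : Measure X) (x : X) (u : ℝ) : ℝ :=
  sInf {r : ℝ | 0 ≤ r ∧ u < localDistrib μX x r}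

/-- The cost function `c_{X,Y}(x,y) = ∫_0^∞ |h_X(x,t) − h_Y(y,t)| dt`
(as an extended nonnegative real). -/
noncomputable def localCost {X Y : Type*} [PseudoMetricSpace X] [MeasurableSpace X]
    [PseudoMetricSpace Y] [MeasurableSpace Y]
    (μX : Measure X) (μY : Measure Y) (x : X) (y : Y) : ℝ≥0∞ :=
  ∫⁻ t in Set.Ioi (0 : ℝ), ENNReal.ofReal |localDistrib μX x t - localDistrib μY y t|

theorem ofReal_abs_sub_eq_add {r : ℝ} (hr : 0 ≤ r) (z : ℝ) :
    ENNReal.ofReal (|z| - r) = ENNReal.ofReal (z - r) + ENNReal.ofReal (-z - r) := by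
  rcases le_total 0 z with hz | hz
  · rw [abs_of_nonneg hz, ENNReal.ofReal_of_nonpos (p := -z - r) (by linarith), add_zero]
  · rw [abs_of_nonpos hz, ENNReal.ofReal_of_nonpos (p := z - r) (by linarith), zero_add]

/-- The mass that lies between two levels of two random variables dominates the difference of
their distribution functions. -/
theorem lintegral_ofReal_cdf_sub_le {Ω : Type*} [MeasurableSpace Ω] {μ : Measure Ω}
    [IsProbabilityMeasure μ] {A B : Ω → ℝ} (hA : Measurable A) (hB : Measurable B) (r : ℝ) :
    ∫⁻ t, ENNReal.ofReal (μ.real {ω | B ω ≤ t - r} - μ.real {ω | A ω ≤ t})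
      ≤ ∫⁻ ω, ENNReal.ofReal (A ω - B ω - r) ∂μ := by
  have hS : MeasurableSet {z : ℝ × Ω | B z.2 ≤ z.1 - r ∧ z.1 < A z.2} :=
    (measurableSet_le (hB.comp measurable_snd) (measurable_fst.sub_const r)).inter
      (measurableSet_lt measurable_fst (hA.comp measurable_snd))
  calc ∫⁻ t, ENNReal.ofReal (μ.real {ω | B ω ≤ t - r} - μ.real {ω | A ω ≤ t})
      ≤ ∫⁻ t, μ (Prod.mk t ⁻¹' {z : ℝ × Ω | B z.2 ≤ z.1 - r ∧ z.1 < A z.2}) := by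
        refine lintegral_mono fun t => ?_
        rw [ENNReal.ofReal_sub _ measureReal_nonneg, ofReal_measureReal, ofReal_measureReal]
        refine le_measure_sdiff.trans (measure_mono fun ω hω => ?_)
        exact ⟨hω.1, not_le.1 hω.2⟩
    _ = (volume.prod μ) {z : ℝ × Ω | B z.2 ≤ z.1 - r ∧ z.1 < A z.2} :=
        (Measure.prod_apply hS).symm
    _ = ∫⁻ ω, ENNReal.ofReal (A ω - B ω - r) ∂μ := by
        rw [Measure.prod_apply_symm hS]
        refine lintegral_congr fun ω => ?_
        have : (fun t => (t, ω)) ⁻¹' {z : ℝ × Ω | B z.2 ≤ z.1 - r ∧ z.1 < A z.2}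
            = Set.Ico (B ω + r) (A ω) := by
          ext t
          simp [le_sub_iff_add_le]
        rw [this, Real.volume_Ico, sub_sub]

/-- If `a` and `b` behave like quantile functions of `F` and `G` on `(0, 1)`, the truncated
excess of `a` over `b` is controlled by the difference of `G` and `F`. -/
theorem lintegral_ofReal_quantile_sub_le {F G a b : ℝ → ℝ}
    (ha : AEMeasurable a (volume.restrict (Set.Ioo 0 1)))
    (hb : AEMeasurable b (volume.restrict (Set.Ioo 0 1)))
    (haF : ∀ u ∈ Set.Ioo (0 : ℝ) 1, ∀ t, t < a u → F t ≤ u)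
    (hbG : ∀ u ∈ Set.Ioo (0 : ℝ) 1, ∀ t, b u < t → u ≤ G t) (r : ℝ) :
    ∫⁻ u in Set.Ioo (0 : ℝ) 1, ENNReal.ofReal (a u - b u - r)
      ≤ ∫⁻ t, ENNReal.ofReal (G (t - r) - F t) := by
  set ν : Measure ℝ := volume.restrict (Set.Ioo 0 1)
  set S : Set (ℝ × ℝ) := {z | hb.mk b z.1 < z.2 - r ∧ z.2 < ha.mk a z.1}
  have hS : MeasurableSet S :=
    (measurableSet_lt (hb.measurable_mk.comp measurable_fst) (measurable_snd.sub_const r)).inter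
      (measurableSet_lt measurable_snd (ha.measurable_mk.comp measurable_fst))
  calc ∫⁻ u, ENNReal.ofReal (a u - b u - r) ∂ν
      = ∫⁻ u, volume (Prod.mk u ⁻¹' S) ∂ν := by
        refine lintegral_congr_ae ?_
        filter_upwards [ha.ae_eq_mk, hb.ae_eq_mk] with u hau hbu
        have : Prod.mk u ⁻¹' S = Set.Ioo (b u + r) (a u) := by
          ext t
          simp [S, ← hau, ← hbu, lt_sub_iff_add_lt]
        rw [this, Real.volume_Ioo, sub_sub]
    _ = ∫⁻ t, ν ((fun u => (u, t)) ⁻¹' S) := by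
        rw [← Measure.prod_apply hS, Measure.prod_apply_symm hS]
    _ ≤ ∫⁻ t, ENNReal.ofReal (G (t - r) - F t) := by
        refine lintegral_mono fun t => ?_
        calc ν ((fun u => (u, t)) ⁻¹' S) ≤ ν (Set.Icc (F t) (G (t - r))) := by
              refine measure_mono_ae ?_
              filter_upwards [ha.ae_eq_mk, hb.ae_eq_mk, ae_restrict_mem measurableSet_Ioo]
                with u hau hbu hu hmem
              have h : hb.mk b u < t - r ∧ t < ha.mk a u := hmem
              rw [← hau, ← hbu] at h
              exact ⟨haF u hu t h.2, hbG u hu _ h.1⟩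
          _ ≤ volume (Set.Icc (F t) (G (t - r))) := Measure.restrict_apply_le _ _
          _ = _ := Real.volume_Icc

theorem lintegral_rpow_mul_ofReal_sub {p : ℝ} (hp : 1 < p) {z : ℝ} (hz : 0 ≤ z) :
    ∫⁻ r in Set.Ioi (0 : ℝ), ENNReal.ofReal (p * (p - 1) * r ^ (p - 2)) * ENNReal.ofReal (z - r)
      = ENNReal.ofReal (z ^ p) := by
  have hint1 : IntervalIntegrable (fun r : ℝ => r ^ (p - 2)) volume 0 z :=
    intervalIntegral.intervalIntegrable_rpow' (by linarith)
  have hint2 : IntervalIntegrable (fun r : ℝ => r ^ (p - 1)) volume 0 z :=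
    intervalIntegral.intervalIntegrable_rpow' (by linarith)
  have hint : IntervalIntegrable
      (fun r : ℝ => p * (p - 1) * (z * r ^ (p - 2) - r ^ (p - 1))) volume 0 z :=
    ((hint1.const_mul z).sub hint2).const_mul _
  have hval : ∫ r in (0 : ℝ)..z, p * (p - 1) * (z * r ^ (p - 2) - r ^ (p - 1)) = z ^ p := by
    rw [intervalIntegral.integral_const_mul, intervalIntegral.integral_sub (hint1.const_mul z) hint2,
      intervalIntegral.integral_const_mul, integral_rpow (Or.inl (by linarith)),
      integral_rpow (Or.inl (by linarith)), Real.zero_rpow (by linarith),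
      Real.zero_rpow (by linarith)]
    have h1 : z * z ^ (p - 2 + 1) = z ^ p := by
      rw [mul_comm, ← Real.rpow_add_one' hz (by linarith)]
      congr 1
      ring
    have h2 : z ^ (p - 1 + 1) = z ^ p := by
      congr 1
      ring
    rw [sub_zero, sub_zero, ← mul_div_assoc, h1, h2]
    have h3 : p - 1 ≠ 0 := by linarith
    have h4 : p ≠ 0 := by linarith
    have h5 : p - 2 + 1 = p - 1 := by ring
    have h6 : p - 1 + 1 = p := by ring
    rw [h5, h6]
    field_simp
    ring
  have hpt : ∀ r ∈ Set.Ioi (0 : ℝ),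
      ENNReal.ofReal (p * (p - 1) * r ^ (p - 2)) * ENNReal.ofReal (z - r)
        = (Set.Ioc 0 z).indicator
          (fun r => ENNReal.ofReal (p * (p - 1) * (z * r ^ (p - 2) - r ^ (p - 1)))) r := by
    intro r hr
    have hr0 : 0 < r := hr
    by_cases hrz : r ≤ z
    · rw [Set.indicator_of_mem (Set.mem_Ioc.2 ⟨hr0, hrz⟩), ← ENNReal.ofReal_mul
        (mul_nonneg (by nlinarith) (Real.rpow_nonneg hr0.le _))]
      have : r ^ (p - 1) = r ^ (p - 2) * r := by
        rw [← Real.rpow_add_one hr0.ne']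
        congr 1
        ring
      rw [this]
      congr 1
      ring
    · rw [Set.indicator_of_notMem (fun h => hrz h.2), ENNReal.ofReal_of_nonpos (p := z - r)
        (by linarith), mul_zero]
  rw [setLIntegral_congr_fun measurableSet_Ioi hpt, lintegral_indicator measurableSet_Ioc,
    Measure.restrict_restrict measurableSet_Ioc,
    Set.inter_eq_left.2 Set.Ioc_subset_Ioi_self, ← ofReal_integral_eq_lintegral_ofReal,
    ← intervalIntegral.integral_of_le hz, hval]
  · exact (intervalIntegrable_iff_integrableOn_Ioc_of_le hz).1 hint
  · filter_upwards [ae_restrict_mem measurableSet_Ioc] with r hr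
    have : r ^ (p - 1) = r ^ (p - 2) * r := by
      rw [← Real.rpow_add_one hr.1.ne']
      congr 1
      ring
    have h0 := Real.rpow_nonneg hr.1.le (p - 2)
    rw [this]
    have h1 : 0 ≤ r ^ (p - 2) * (z - r) := mul_nonneg h0 (by linarith [hr.2])
    exact mul_nonneg (by nlinarith) (by linarith)

theorem lintegral_ofReal_rpow_abs_eq {α : Type*} [MeasurableSpace α] {μ : Measure α} [SFinite μ]
    {f : α → ℝ} (hf : AEMeasurable f μ) {p : ℝ} (hp : 1 < p) :
    ∫⁻ x, ENNReal.ofReal (|f x| ^ p) ∂μ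
      = ∫⁻ r in Set.Ioi (0 : ℝ), ENNReal.ofReal (p * (p - 1) * r ^ (p - 2))
          * ∫⁻ x, ENNReal.ofReal (|f x| - r) ∂μ := by
  have hfst : AEMeasurable (fun z : α × ℝ => f z.1) (μ.prod (volume.restrict (Set.Ioi 0))) :=
    hf.comp_quasiMeasurePreserving Measure.quasiMeasurePreserving_fst
  have hweight : AEMeasurable (fun z : α × ℝ => ENNReal.ofReal (p * (p - 1) * z.2 ^ (p - 2)))
      (μ.prod (volume.restrict (Set.Ioi 0))) := by fun_prop
  have hexcess : AEMeasurable (fun z : α × ℝ => ENNReal.ofReal (|f z.1| - z.2))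
      (μ.prod (volume.restrict (Set.Ioi 0))) :=
    ((measurable_norm.comp_aemeasurable hfst).sub measurable_snd.aemeasurable).ennreal_ofReal
  calc ∫⁻ x, ENNReal.ofReal (|f x| ^ p) ∂μ
      = ∫⁻ x, (∫⁻ r in Set.Ioi (0 : ℝ),
          ENNReal.ofReal (p * (p - 1) * r ^ (p - 2)) * ENNReal.ofReal (|f x| - r)) ∂μ :=
        lintegral_congr fun x => (lintegral_rpow_mul_ofReal_sub hp (abs_nonneg _)).symm
    _ = ∫⁻ r in Set.Ioi (0 : ℝ), ∫⁻ x,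
          ENNReal.ofReal (p * (p - 1) * r ^ (p - 2)) * ENNReal.ofReal (|f x| - r) ∂μ := by
        exact lintegral_lintegral_swap (hweight.mul hexcess)
    _ = _ := lintegral_congr fun r => lintegral_const_mul' _ _ ENNReal.ofReal_ne_top

/-- Domination of all truncated first moments implies domination of all `p`-th moments. -/
theorem lintegral_rpow_abs_le_of_forall_truncation {α β : Type*} [MeasurableSpace α]
    [MeasurableSpace β] {ν : Measure α} {μ : Measure β} [SFinite ν] [SFinite μ]
    {f : α → ℝ} {g : β → ℝ} (hf : AEMeasurable f ν) (hg : AEMeasurable g μ)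
    (h : ∀ r, 0 ≤ r → ∫⁻ x, ENNReal.ofReal (|f x| - r) ∂ν ≤ ∫⁻ y, ENNReal.ofReal (|g y| - r) ∂μ)
    {p : ℝ} (hp : 1 ≤ p) :
    ∫⁻ x, ENNReal.ofReal (|f x| ^ p) ∂ν ≤ ∫⁻ y, ENNReal.ofReal (|g y| ^ p) ∂μ := by
  rcases hp.eq_or_lt with rfl | hp
  · simpa using h 0 le_rfl
  rw [lintegral_ofReal_rpow_abs_eq hf hp, lintegral_ofReal_rpow_abs_eq hg hp]
  exact setLIntegral_mono_ae' measurableSet_Ioi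
    (Filter.Eventually.of_forall fun r hr => mul_le_mul_right (h r (le_of_lt hr)) _)

/-- One-dimensional optimal transport: the quantile coupling of two real random variables
minimises the `p`-th moment of the difference. -/
theorem lintegral_rpow_abs_quantile_sub_le {Ω : Type*} [MeasurableSpace Ω] {μ : Measure Ω}
    [IsProbabilityMeasure μ] {A B : Ω → ℝ} (hA : Measurable A) (hB : Measurable B) {a b : ℝ → ℝ}
    (ha : AEMeasurable a (volume.restrict (Set.Ioo 0 1)))
    (hb : AEMeasurable b (volume.restrict (Set.Ioo 0 1)))
    (ha₁ : ∀ u ∈ Set.Ioo (0 : ℝ) 1, ∀ t, t < a u → μ.real {ω | A ω ≤ t} ≤ u)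
    (ha₂ : ∀ u ∈ Set.Ioo (0 : ℝ) 1, ∀ t, a u < t → u ≤ μ.real {ω | A ω ≤ t})
    (hb₁ : ∀ u ∈ Set.Ioo (0 : ℝ) 1, ∀ t, t < b u → μ.real {ω | B ω ≤ t} ≤ u)
    (hb₂ : ∀ u ∈ Set.Ioo (0 : ℝ) 1, ∀ t, b u < t → u ≤ μ.real {ω | B ω ≤ t})
    {p : ℝ} (hp : 1 ≤ p) :
    ∫⁻ u in Set.Ioo (0 : ℝ) 1, ENNReal.ofReal (|a u - b u| ^ p)
      ≤ ∫⁻ ω, ENNReal.ofReal (|A ω - B ω| ^ p) ∂μ := by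
  refine lintegral_rpow_abs_le_of_forall_truncation (ha.sub hb) (hA.sub hB).aemeasurable
    (fun r hr => ?_) hp
  simp only [ofReal_abs_sub_eq_add hr, Pi.sub_apply, neg_sub]
  rw [lintegral_add_left' (by fun_prop),
    lintegral_add_left (by fun_prop)]
  exact add_le_add
    ((lintegral_ofReal_quantile_sub_le ha hb ha₁ hb₂ r).trans (lintegral_ofReal_cdf_sub_le hA hB r))
    ((lintegral_ofReal_quantile_sub_le hb ha hb₁ ha₂ r).trans (lintegral_ofReal_cdf_sub_le hB hA r))

/-- The `L¹` distance of the distribution functions of two real random variables is at most the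
first moment of their difference. -/
theorem lintegral_abs_cdf_sub_le {Ω : Type*} [MeasurableSpace Ω] {μ : Measure Ω}
    [IsProbabilityMeasure μ] {A B : Ω → ℝ} (hA : Measurable A) (hB : Measurable B) :
    ∫⁻ t, ENNReal.ofReal |μ.real {ω | A ω ≤ t} - μ.real {ω | B ω ≤ t}|
      ≤ ∫⁻ ω, ENNReal.ofReal |A ω - B ω| ∂μ := by
  have hmeas : ∀ C : Ω → ℝ, Measurable fun t => μ.real {ω | C ω ≤ t} := fun C =>
    Monotone.measurable fun s t hst => measureReal_mono fun ω hω => le_trans hω hst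
  have hsplit : ∀ z : ℝ, ENNReal.ofReal |z| = ENNReal.ofReal z + ENNReal.ofReal (-z) := fun z => by
    simpa using ofReal_abs_sub_eq_add le_rfl z
  simp only [hsplit, neg_sub]
  have := hmeas A
  have := hmeas B
  rw [lintegral_add_left (by fun_prop), lintegral_add_left (by fun_prop)]
  refine (add_le_add ?_ ?_).trans_eq (add_comm _ _)
  · simpa using lintegral_ofReal_cdf_sub_le (μ := μ) hB hA 0
  · simpa using lintegral_ofReal_cdf_sub_le (μ := μ) hA hB 0

section LocalDistribution

variable {X : Type*} [PseudoMetricSpace X] [MeasurableSpace X] {μ : Measure X}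

theorem localDistrib_le_of_lt_localDistribInv {x : X} {u t : ℝ} (hu : 0 < u)
    (ht : t < localDistribInv μ x u) : localDistrib μ x t ≤ u := by
  by_contra! h
  have ht0 : 0 ≤ t := by
    by_contra! ht0
    rw [localDistrib, closedBall_eq_empty.2 ht0] at h
    simp at h
    linarith
  have : localDistribInv μ x u ≤ t := csInf_le ⟨0, fun _ hr => hr.1⟩ ⟨ht0, h⟩
  exact absurd ht (not_lt.2 this)

theorem exists_lt_localDistrib [BoundedSpace X] [IsProbabilityMeasure μ] (x : X) {u : ℝ}
    (hu : u < 1) : {r : ℝ | 0 ≤ r ∧ u < localDistrib μ x r}.Nonempty := by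
  refine ⟨diam (Set.univ : Set X), diam_nonneg, ?_⟩
  have : closedBall x (diam (Set.univ : Set X)) = Set.univ := Set.eq_univ_of_forall fun y =>
    dist_le_diam_of_mem (Bornology.IsBounded.all _) (Set.mem_univ y) (Set.mem_univ x)
  simpa [localDistrib, this] using hu

theorem le_localDistrib_of_localDistribInv_lt [BoundedSpace X] [IsProbabilityMeasure μ] {x : X}
    {u t : ℝ} (hu : u < 1) (ht : localDistribInv μ x u < t) : u ≤ localDistrib μ x t := by
  obtain ⟨r, hr, hrt⟩ := exists_lt_of_csInf_lt (exists_lt_localDistrib x hu) ht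
  exact hr.2.le.trans (measureReal_mono (closedBall_subset_closedBall hrt.le))

theorem aemeasurable_localDistribInv [BoundedSpace X] [IsProbabilityMeasure μ] (x : X) :
    AEMeasurable (localDistribInv μ x) (volume.restrict (Set.Ioo 0 1)) :=
  aemeasurable_restrict_of_monotoneOn measurableSet_Ioo fun _ _ _ hv huv =>
    csInf_le_csInf ⟨0, fun _ hr => hr.1⟩ (exists_lt_localDistrib x hv.2)
      fun _ hr => ⟨hr.1, huv.trans_lt hr.2⟩

theorem localDistrib_eq_real_dist (x : X) (t : ℝ) :
    localDistrib μ x t = μ.real {x' | dist x x' ≤ t} := by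
  simp only [localDistrib, measureReal_def, closedBall, dist_comm]

end LocalDistribution

section MeasurePreserving

variable {X Y : Type*} [MeasurableSpace X] [PseudoMetricSpace Y] [MeasurableSpace Y]
  [BorelSpace Y] {μX : Measure X} {μY : Measure Y}

theorem localDistrib_apply_eq_real_dist {φ : X → Y} (hφ : Measurable φ)
    (hmap : Measure.map φ μX = μY) (x : X) (t : ℝ) :
    localDistrib μY (φ x) t = μX.real {x' | dist (φ x) (φ x') ≤ t} := by
  rw [localDistrib, ← hmap, Measure.map_apply hφ measurableSet_closedBall]
  simp only [measureReal_def, closedBall, dist_comm, Set.preimage_ofPred_eq]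

variable [PseudoMetricSpace X]

theorem lintegral_rpow_localDistribInv_sub_le [OpensMeasurableSpace X] [BoundedSpace X]
    [BoundedSpace Y] [IsProbabilityMeasure μX] [IsProbabilityMeasure μY] {φ : X → Y} (hφ : Measurable φ)
    (hmap : Measure.map φ μX = μY) (x : X) {p : ℝ} (hp : 1 ≤ p) :
    ∫⁻ u in Set.Ioo (0 : ℝ) 1,
        ENNReal.ofReal (|localDistribInv μX x u - localDistribInv μY (φ x) u| ^ p)
      ≤ ∫⁻ x', ENNReal.ofReal (|dist x x' - dist (φ x) (φ x')| ^ p) ∂μX := by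
  refine lintegral_rpow_abs_quantile_sub_le (continuous_const.dist continuous_id).measurable
    ((continuous_const.dist continuous_id).measurable.comp hφ) (aemeasurable_localDistribInv x)
    (aemeasurable_localDistribInv (φ x)) (fun u hu t ht => ?_) (fun u hu t ht => ?_)
    (fun u hu t ht => ?_) (fun u hu t ht => ?_) hp
  · exact (localDistrib_eq_real_dist x t).symm.trans_le
      (localDistrib_le_of_lt_localDistribInv hu.1 ht)
  · exact (le_localDistrib_of_localDistribInv_lt hu.2 ht).trans_eq (localDistrib_eq_real_dist x t)
  · exact (localDistrib_apply_eq_real_dist hφ hmap x t).symm.trans_le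
      (localDistrib_le_of_lt_localDistribInv hu.1 ht)
  · exact (le_localDistrib_of_localDistribInv_lt hu.2 ht).trans_eq
      (localDistrib_apply_eq_real_dist hφ hmap x t)

theorem localCost_le [OpensMeasurableSpace X] [IsProbabilityMeasure μX] {φ : X → Y} (hφ : Measurable φ)
    (hmap : Measure.map φ μX = μY) (x : X) :
    localCost μX μY x (φ x) ≤ ∫⁻ x', ENNReal.ofReal |dist x x' - dist (φ x) (φ x')| ∂μX := by
  refine (setLIntegral_le_lintegral _ _).trans ?_
  simp only [localDistrib_apply_eq_real_dist hφ hmap x]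
  simp only [localDistrib_eq_real_dist]
  exact lintegral_abs_cdf_sub_le (continuous_const.dist continuous_id).measurable ((continuous_const.dist continuous_id).measurable.comp hφ)

end MeasurePreserving

/-- Jensen's inequality for the concave function `t ↦ t ^ (1 / p)`. -/
theorem lintegral_rpow_one_div_le {α : Type*} [MeasurableSpace α] {μ : Measure α}
    [IsProbabilityMeasure μ] {g : α → ℝ≥0∞} (hg : AEMeasurable g μ) {p : ℝ} (hp : 1 ≤ p) :
    ∫⁻ x, g x ^ (1 / p) ∂μ ≤ (∫⁻ x, g x ∂μ) ^ (1 / p) := by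
  have h := eLpNorm'_le_eLpNorm'_of_exponent_le (f := fun x => g x ^ (1 / p)) (μ := μ) one_pos hp
    (hg.pow_const _).aestronglyMeasurable
  have hp0 : p ≠ 0 := by linarith
  simpa [eLpNorm', ← ENNReal.rpow_mul, hp0] using h

theorem eLpNorm_ofReal_prod_eq {α : Type*} [MeasurableSpace α] {μ : Measure α} [SFinite μ]
    {f : α × α → ℝ} (hf : Measurable f) {p : ℝ} (hp : 1 ≤ p) :
    eLpNorm f (ENNReal.ofReal p) (μ.prod μ)
      = (∫⁻ x, ∫⁻ y, ENNReal.ofReal (|f (x, y)| ^ p) ∂μ ∂μ) ^ (1 / p) := by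
  have hp0 : 0 < p := by linarith
  rw [eLpNorm_eq_lintegral_rpow_enorm_toReal (by simpa using hp0) ENNReal.ofReal_ne_top,
    ENNReal.toReal_ofReal hp0.le, lintegral_prod _ (by fun_prop)]
  simp only [Real.enorm_eq_ofReal_abs, ENNReal.ofReal_rpow_of_nonneg (abs_nonneg _) hp0.le]

/-- **Proposition (local lower bound for Gromov–Monge distance).**
For mm-spaces `X`, `Y` and `p ∈ [1,∞)`,
`d_{GM,p}(X,Y) ≥ inf_φ ∫_X (∫_0^1 |h_X^{-1}(x,u) − h_Y^{-1}(φ(x),u)|^p du)^{1/p} μX(dx)`,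
the infimum being over measure-preserving maps `φ : X → Y`; for `p = 1` this simplifies
to `d_{GM,1}(X,Y) ≥ inf_φ ∫_X c_{X,Y}(x,φ(x)) μX(dx)`. -/
theorem gromovMonge_local_distribution_lowerBound
    {X Y : Type*}
    [MetricSpace X] [CompactSpace X] [MeasurableSpace X] [BorelSpace X]
    [MetricSpace Y] [CompactSpace Y] [MeasurableSpace Y] [BorelSpace Y]
    (μX : Measure X) (μY : Measure Y)
    [IsProbabilityMeasure μX] [IsProbabilityMeasure μY]
    [μX.IsOpenPosMeasure] [μY.IsOpenPosMeasure]
    (p : ℝ) (hp : 1 ≤ p) :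
    sInf {c | ∃ φ : X → Y, Measurable φ ∧ Measure.map φ μX = μY ∧
        c = ∫⁻ x, (∫⁻ u in Set.Ioo (0 : ℝ) 1,
              ENNReal.ofReal (|localDistribInv μX x u - localDistribInv μY (φ x) u| ^ p))
            ^ (1 / p) ∂μX}
      ≤ dGM p μX μY ∧
    sInf {c | ∃ φ : X → Y, Measurable φ ∧ Measure.map φ μX = μY ∧
        c = ∫⁻ x, localCost μX μY x (φ x) ∂μX}
      ≤ dGM 1 μX μY := by
  have hmeas : ∀ φ : X → Y, Measurable φ →
      Measurable fun z : X × X => dist z.1 z.2 - dist (φ z.1) (φ z.2) := fun φ hφ =>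
    measurable_dist.sub ((hφ.comp measurable_fst).dist (hφ.comp measurable_snd))
  constructor
  · refine le_sInf ?_
    rintro c ⟨φ, hφ, hmap, rfl⟩
    refine sInf_le_of_le ⟨φ, hφ, hmap, rfl⟩ ?_
    rw [eLpNorm_ofReal_prod_eq (hmeas φ hφ) hp]
    refine le_trans (lintegral_mono fun x => ?_) (lintegral_rpow_one_div_le ?_ hp)
    · exact ENNReal.rpow_le_rpow (lintegral_rpow_localDistribInv_sub_le hφ hmap x hp)
        (by positivity)
    · have := hmeas φ hφ
      exact (Measurable.lintegral_prod_right (by fun_prop)).aemeasurable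
  · refine le_sInf ?_
    rintro c ⟨φ, hφ, hmap, rfl⟩
    refine sInf_le_of_le ⟨φ, hφ, hmap, rfl⟩ ?_
    rw [eLpNorm_ofReal_prod_eq (hmeas φ hφ) le_rfl]
    simpa using lintegral_mono fun x => localCost_le hφ hmap x
end

section
/- Let X and Y be mm-spaces, p ∈ [1,∞), let φ: X → Y be measure-preserving, and fix x ∈ X, y ∈ Y. Then (∬_{X} |d_X(x,x') − d_Y(y,φ(x'))|^p μ_X(dx'))^{1/p} ≥ (∫_0^1 |h_X^{-1}(x,u) − h_Y^{-1}(y,u)|^p du)^{1/p}. When p = 1 the right-hand side equals c_{X,Y}(x,y) = ∫_0^∞ |h_X(x,t) − h_Y(y,t)| dt. -/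
open MeasureTheory Metric ENNReal

lemma localDistrib_eq_cdf {X : Type*} [PseudoMetricSpace X] [MeasurableSpace X]
    [OpensMeasurableSpace X] (μ : Measure X) [IsProbabilityMeasure μ] (x : X) (t : ℝ) :
    localDistrib μ x t = ProbabilityTheory.cdf (μ.map (dist x)) t := by
  have hd : Measurable (dist x) := (continuous_const.dist continuous_id).measurable
  have : IsProbabilityMeasure (μ.map (dist x)) := Measure.isProbabilityMeasure_map hd.aemeasurable
  rw [ProbabilityTheory.cdf_eq_real, measureReal_def, Measure.map_apply hd measurableSet_Iic,
    localDistrib]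
  congr 2
  ext z
  simp [dist_comm]

section LocalDistribInv

variable {X : Type*} [PseudoMetricSpace X] [MeasurableSpace X] (μ : Measure X) (x : X)

lemma localDistrib_nonneg (t : ℝ) : 0 ≤ localDistrib μ x t := ENNReal.toReal_nonneg

lemma bddBelow_nonneg_lt_localDistrib (u : ℝ) :
    BddBelow {r : ℝ | 0 ≤ r ∧ u < localDistrib μ x r} :=
  ⟨0, fun _ hr => hr.1⟩

lemma localDistribInv_nonneg (u : ℝ) : 0 ≤ localDistribInv μ x u :=
  Real.sInf_nonneg fun _ hr => hr.1

lemma localDistribInv_le {u s : ℝ} (hs : 0 ≤ s) (h : u < localDistrib μ x s) :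
    localDistribInv μ x u ≤ s :=
  csInf_le (bddBelow_nonneg_lt_localDistrib μ x u) ⟨hs, h⟩

variable [OpensMeasurableSpace X] [IsProbabilityMeasure μ]

lemma exists_nonneg_lt_localDistrib {u : ℝ} (hu : u < 1) :
    {r : ℝ | 0 ≤ r ∧ u < localDistrib μ x r}.Nonempty := by
  simp only [localDistrib_eq_cdf]
  obtain ⟨r, h0, h1⟩ := ((Filter.eventually_ge_atTop (0 : ℝ)).and
    ((ProbabilityTheory.tendsto_cdf_atTop (μ.map (dist x))).eventually
      (lt_mem_nhds hu))).exists
  exact ⟨r, h0, h1⟩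

lemma localDistrib_mono : Monotone (localDistrib μ x) := fun s t hst => by
  simpa only [localDistrib_eq_cdf] using ProbabilityTheory.monotone_cdf _ hst

lemma le_localDistrib_of_localDistribInv_le {u s : ℝ} (hu : u < 1)
    (h : localDistribInv μ x u ≤ s) : u ≤ localDistrib μ x s := by
  have hc : Filter.Tendsto (localDistrib μ x) (nhdsWithin s (Set.Ioi s))
      (nhds (localDistrib μ x s)) := by
    have := ((ProbabilityTheory.cdf (μ.map (dist x))).right_continuous s).mono
      Set.Ioi_subset_Ici_self
    rwa [ContinuousWithinAt, ← localDistrib_eq_cdf μ x s,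
      ← funext (localDistrib_eq_cdf μ x)] at this
  refine ge_of_tendsto hc ?_
  filter_upwards [self_mem_nhdsWithin] with t ht
  obtain ⟨r, hr, hrt⟩ := exists_lt_of_csInf_lt (exists_nonneg_lt_localDistrib μ x hu)
    (lt_of_le_of_lt h ht)
  exact hr.2.le.trans (localDistrib_mono μ x hrt.le)

lemma localDistrib_le_one (t : ℝ) : localDistrib μ x t ≤ 1 := by
  rw [localDistrib_eq_cdf]
  exact ProbabilityTheory.cdf_le_one _ t

lemma measurable_localDistribInv : Measurable (localDistribInv μ x) := by
  refine measurable_of_restrict_of_restrict_compl (measurableSet_Iio (a := (1 : ℝ))) ?_ ?_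
  · refine Monotone.measurable fun u v huv => ?_
    exact csInf_le_csInf (bddBelow_nonneg_lt_localDistrib μ x _)
      (exists_nonneg_lt_localDistrib μ x v.2)
      fun r hr => ⟨hr.1, lt_of_le_of_lt (show (u : ℝ) ≤ v from huv) hr.2⟩
  · have : (Set.Iio (1 : ℝ))ᶜ.domRestrict (localDistribInv μ x) = fun _ => 0 := by
      ext ⟨u, hu⟩
      have hu' : 1 ≤ u := by simpa using hu
      have : {r : ℝ | 0 ≤ r ∧ u < localDistrib μ x r} = ∅ := by
        ext r
        have := localDistrib_le_one μ x r
        simp only [Set.mem_ofPred_eq, Set.mem_empty_iff_false, iff_false, not_and, not_lt]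
        intro
        linarith
      simp [localDistribInv, this]
    rw [this]
    exact measurable_const

end LocalDistribInv

/-- The joint law of two generalized inverses under the uniform distribution, on quadrants. -/
lemma volume_localDistribInv_le_lt {X Y : Type*}
    [PseudoMetricSpace X] [MeasurableSpace X] [OpensMeasurableSpace X]
    [PseudoMetricSpace Y] [MeasurableSpace Y] [OpensMeasurableSpace Y]
    (μ : Measure X) (ν : Measure Y) [IsProbabilityMeasure μ] [IsProbabilityMeasure ν]
    (x : X) (y : Y) {s t : ℝ} (hs : 0 ≤ s) (ht : 0 ≤ t) :
    volume.restrict (Set.Ioo (0 : ℝ) 1)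
        {u | localDistribInv ν y u ≤ s ∧ t < localDistribInv μ x u}
      = ENNReal.ofReal (localDistrib ν y s - localDistrib μ x t) := by
  have hm : MeasurableSet {u | localDistribInv ν y u ≤ s ∧ t < localDistribInv μ x u} :=
    (measurableSet_le (measurable_localDistribInv ν y) measurable_const).inter
      (measurableSet_lt measurable_const (measurable_localDistribInv μ x))
  rw [Measure.restrict_apply hm]
  apply le_antisymm
  · rw [← Real.volume_Icc]
    refine measure_mono ?_
    rintro u ⟨⟨h1, h2⟩, h0, hu⟩
    refine ⟨?_, le_localDistrib_of_localDistribInv_le ν y hu h1⟩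
    by_contra! h
    exact absurd (localDistribInv_le μ x ht h) (not_le.2 h2)
  · rw [← Real.volume_Ioo]
    refine measure_mono ?_
    rintro u ⟨h1, h2⟩
    have hu : u < 1 := h2.trans_le (localDistrib_le_one ν y s)
    refine ⟨⟨localDistribInv_le ν y hs h2, ?_⟩, (localDistrib_nonneg μ x t).trans_lt h1, hu⟩
    by_contra! h
    exact absurd (le_localDistrib_of_localDistribInv_le μ x hu h) (not_le.2 h1)

lemma lintegral_ofReal_sub_sub {Ω : Type*} [MeasurableSpace Ω] (μ : Measure Ω) [SFinite μ]
    {f g : Ω → ℝ} (hf : Measurable f) (hg : Measurable g) (w : ℝ) :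
    ∫⁻ ω, ENNReal.ofReal (f ω - g ω - w) ∂μ = ∫⁻ s, μ {ω | g ω ≤ s ∧ s + w < f ω} := by
  have hS : MeasurableSet {z : Ω × ℝ | g z.1 ≤ z.2 ∧ z.2 + w < f z.1} :=
    (measurableSet_le (hg.comp measurable_fst) measurable_snd).inter
      (measurableSet_lt (measurable_snd.add_const w) (hf.comp measurable_fst))
  have h1 := Measure.prod_apply (μ := μ) (ν := (volume : Measure ℝ)) hS
  rw [Measure.prod_apply_symm hS] at h1
  refine Eq.trans (lintegral_congr fun ω => ?_) h1.symm
  have : Prod.mk ω ⁻¹' {z : Ω × ℝ | g z.1 ≤ z.2 ∧ z.2 + w < f z.1}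
      = Set.Ico (g ω) (f ω - w) := by
    ext s
    simp [lt_sub_iff_add_lt]
  rw [this, Real.volume_Ico]
  congr 1
  ring

lemma ofReal_rpow_eq_lintegral {p : ℝ} (hp : 1 < p) (a : ℝ) :
    ENNReal.ofReal a ^ p
      = ∫⁻ w in Set.Ioi (0 : ℝ),
          ENNReal.ofReal (p * (p - 1) * w ^ (p - 2)) * ENNReal.ofReal (a - w) := by
  rcases le_or_gt a 0 with ha | ha
  · rw [ENNReal.ofReal_of_nonpos ha, ENNReal.zero_rpow_of_pos (by linarith), eq_comm]
    refine (setLIntegral_congr_fun measurableSet_Ioi fun w hw => ?_).trans lintegral_zero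
    have : (0 : ℝ) < w := hw
    simp only [ENNReal.ofReal_of_nonpos (show a - w ≤ 0 by linarith), mul_zero]
  have hi1 : IntervalIntegrable (fun w : ℝ => w ^ (p - 2)) volume 0 a :=
    intervalIntegral.intervalIntegrable_rpow' (by linarith)
  have hi2 : IntervalIntegrable (fun w : ℝ => w ^ (p - 1)) volume 0 a :=
    intervalIntegral.intervalIntegrable_rpow' (by linarith)
  have hi : IntervalIntegrable
      (fun w : ℝ => p * (p - 1) * (a * w ^ (p - 2) - w ^ (p - 1))) volume 0 a :=
    ((hi1.const_mul a).sub hi2).const_mul _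
  have hint : ∫ w in (0 : ℝ)..a, p * (p - 1) * (a * w ^ (p - 2) - w ^ (p - 1)) = a ^ p := by
    rw [intervalIntegral.integral_const_mul, intervalIntegral.integral_sub (hi1.const_mul a) hi2,
      intervalIntegral.integral_const_mul, integral_rpow (Or.inl (by linarith)),
      integral_rpow (Or.inl (by linarith))]
    have e1 : p - 2 + 1 = p - 1 := by ring
    have e2 : p - 1 + 1 = p := by ring
    rw [e1, e2, Real.zero_rpow (by linarith), Real.zero_rpow (by linarith)]
    have e3 : a * a ^ (p - 1) = a ^ p := by
      rw [mul_comm, ← Real.rpow_add_one ha.ne', e2]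
    have h1 : p - 1 ≠ 0 := by linarith
    have h2 : p ≠ 0 := by linarith
    field_simp
    linear_combination p * e3
  have hpt : ∀ w ∈ Set.Ioi (0 : ℝ), p * (p - 1) * w ^ (p - 2) * (a - w)
      = p * (p - 1) * (a * w ^ (p - 2) - w ^ (p - 1)) := fun w hw => by
    have : w ^ (p - 1) = w ^ (p - 2) * w := by
      rw [← Real.rpow_add_one (ne_of_gt hw)]
      congr 1
      ring
    rw [this]
    ring
  have hw0 : ∀ w ∈ Set.Ioi (0 : ℝ), 0 ≤ p * (p - 1) * w ^ (p - 2) := fun w hw =>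
    mul_nonneg (mul_nonneg (by linarith) (by linarith)) (Real.rpow_nonneg (le_of_lt hw) _)
  rw [ENNReal.ofReal_rpow_of_pos ha, ← hint, intervalIntegral.integral_of_le ha.le,
    ofReal_integral_eq_lintegral_ofReal ((intervalIntegrable_iff_integrableOn_Ioc_of_le ha.le).1 hi)]
  · rw [← Set.Ioc_union_Ioi_eq_Ioi ha.le, lintegral_union measurableSet_Ioi
      (Set.Ioc_disjoint_Ioi le_rfl)]
    have : ∫⁻ w in Set.Ioi a,
        ENNReal.ofReal (p * (p - 1) * w ^ (p - 2)) * ENNReal.ofReal (a - w) = 0 := by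
      refine (setLIntegral_congr_fun measurableSet_Ioi fun w hw => ?_).trans lintegral_zero
      have : a < w := hw
      simp only [ENNReal.ofReal_of_nonpos (show a - w ≤ 0 by linarith), mul_zero]
    rw [this, add_zero]
    refine setLIntegral_congr_fun measurableSet_Ioc fun w hw => ?_
    rw [← hpt w hw.1, ENNReal.ofReal_mul (hw0 w hw.1)]
  · filter_upwards [ae_restrict_mem measurableSet_Ioc] with w hw
    rw [Pi.zero_apply, ← hpt w hw.1]
    exact mul_nonneg (hw0 w hw.1) (by linarith [hw.2])

/-- If `(f', g')` charges every upper-left quadrant less than `(f, g)`, then the `p`-th moment of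
the positive part of `f' - g'` is at most that of `f - g`. -/
lemma lintegral_ofReal_sub_rpow_le {Ω Ω' : Type*} [MeasurableSpace Ω] [MeasurableSpace Ω']
    (μ : Measure Ω) (μ' : Measure Ω') [SFinite μ] [SFinite μ'] {f g : Ω → ℝ} {f' g' : Ω' → ℝ}
    (hf : Measurable f) (hg : Measurable g) (hf' : Measurable f') (hg' : Measurable g')
    (h : ∀ s w : ℝ, 0 ≤ w →
      μ' {ω | g' ω ≤ s ∧ s + w < f' ω} ≤ μ {ω | g ω ≤ s ∧ s + w < f ω})
    {p : ℝ} (hp : 1 ≤ p) :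
    ∫⁻ ω, ENNReal.ofReal (f' ω - g' ω) ^ p ∂μ' ≤ ∫⁻ ω, ENNReal.ofReal (f ω - g ω) ^ p ∂μ := by
  have key : ∀ w : ℝ, 0 ≤ w → ∫⁻ ω, ENNReal.ofReal (f' ω - g' ω - w) ∂μ'
      ≤ ∫⁻ ω, ENNReal.ofReal (f ω - g ω - w) ∂μ := fun w hw => by
    rw [lintegral_ofReal_sub_sub μ hf hg, lintegral_ofReal_sub_sub μ' hf' hg']
    exact lintegral_mono fun s => h s w hw
  rcases hp.eq_or_lt with rfl | hp
  · simpa using key 0 le_rfl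
  simp only [ofReal_rpow_eq_lintegral hp]
  refine (lintegral_lintegral_swap (Measurable.aemeasurable (by fun_prop))).trans_le
    (le_trans ?_ (lintegral_lintegral_swap (Measurable.aemeasurable (by fun_prop))).ge)
  refine setLIntegral_mono' measurableSet_Ioi fun w hw => ?_
  rw [lintegral_const_mul _ (by fun_prop), lintegral_const_mul _ (by fun_prop)]
  gcongr
  exact key w (le_of_lt hw)

lemma ofReal_abs_sub_rpow {p : ℝ} (hp : 0 < p) (a b : ℝ) :
    ENNReal.ofReal (|a - b| ^ p) = ENNReal.ofReal (a - b) ^ p + ENNReal.ofReal (b - a) ^ p := by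
  rw [← ENNReal.ofReal_rpow_of_nonneg (abs_nonneg _) hp.le]
  rcases le_total a b with h | h
  · rw [abs_of_nonpos (by linarith), ENNReal.ofReal_of_nonpos (show a - b ≤ 0 by linarith),
      ENNReal.zero_rpow_of_pos hp, zero_add, neg_sub]
  · rw [abs_of_nonneg (by linarith), ENNReal.ofReal_of_nonpos (show b - a ≤ 0 by linarith),
      ENNReal.zero_rpow_of_pos hp, add_zero]

lemma lintegral_ofReal_abs_sub_rpow {Ω : Type*} [MeasurableSpace Ω] (μ : Measure Ω)
    {f g : Ω → ℝ} (hf : Measurable f) (hg : Measurable g) {p : ℝ} (hp : 0 < p) :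
    ∫⁻ ω, ENNReal.ofReal (|f ω - g ω| ^ p) ∂μ
      = ∫⁻ ω, ENNReal.ofReal (f ω - g ω) ^ p ∂μ + ∫⁻ ω, ENNReal.ofReal (g ω - f ω) ^ p ∂μ := by
  simp only [ofReal_abs_sub_rpow hp]
  exact lintegral_add_left (by fun_prop) _

/-- Every coupling charges an upper-left quadrant at least as much as the generalized inverses. -/
lemma volume_localDistribInv_le_lt_le_measure {X Y Ω : Type*}
    [PseudoMetricSpace X] [MeasurableSpace X] [OpensMeasurableSpace X]
    [PseudoMetricSpace Y] [MeasurableSpace Y] [OpensMeasurableSpace Y] [MeasurableSpace Ω]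
    (μ : Measure X) (ν : Measure Y) [IsProbabilityMeasure μ] [IsProbabilityMeasure ν]
    (x : X) (y : Y) {P : Measure Ω} {ξ : Ω → X} {η : Ω → Y}
    (hξ : MeasurePreserving ξ P μ) (hη : MeasurePreserving η P ν) (s w : ℝ) (hw : 0 ≤ w) :
    volume.restrict (Set.Ioo (0 : ℝ) 1)
        {u | localDistribInv ν y u ≤ s ∧ s + w < localDistribInv μ x u}
      ≤ P {ω | dist y (η ω) ≤ s ∧ s + w < dist x (ξ ω)} := by
  rcases lt_or_ge s 0 with hs | hs
  · have : {u | localDistribInv ν y u ≤ s ∧ s + w < localDistribInv μ x u} = ∅ := by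
      ext u
      have := localDistribInv_nonneg ν y u
      simp only [Set.mem_ofPred_eq, Set.mem_empty_iff_false, iff_false, not_and]
      intro
      linarith
    simp [this]
  rw [volume_localDistribInv_le_lt μ ν x y hs (by positivity),
    ENNReal.ofReal_sub _ (localDistrib_nonneg μ x _), localDistrib, localDistrib,
    ENNReal.ofReal_toReal (measure_ne_top _ _), ENNReal.ofReal_toReal (measure_ne_top _ _),
    ← hξ.measure_preimage measurableSet_closedBall.nullMeasurableSet,
    ← hη.measure_preimage measurableSet_closedBall.nullMeasurableSet]
  refine le_measure_sdiff.trans (measure_mono ?_)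
  rintro ω ⟨h1, h2⟩
  simpa [dist_comm] using And.intro h1 h2

lemma lintegral_ofReal_localDistribInv_sub {X Y : Type*}
    [PseudoMetricSpace X] [MeasurableSpace X] [OpensMeasurableSpace X]
    [PseudoMetricSpace Y] [MeasurableSpace Y] [OpensMeasurableSpace Y]
    (μ : Measure X) (ν : Measure Y) [IsProbabilityMeasure μ] [IsProbabilityMeasure ν]
    (x : X) (y : Y) :
    ∫⁻ u in Set.Ioo (0 : ℝ) 1,
        ENNReal.ofReal (localDistribInv μ x u - localDistribInv ν y u)
      = ∫⁻ t in Set.Ioi (0 : ℝ), ENNReal.ofReal (localDistrib ν y t - localDistrib μ x t) := by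
  have h := lintegral_ofReal_sub_sub (volume.restrict (Set.Ioo (0 : ℝ) 1))
    (measurable_localDistribInv μ x) (measurable_localDistribInv ν y) 0
  simp only [sub_zero, add_zero] at h
  rw [h, setLIntegral_congr Ioi_ae_eq_Ici, ← lintegral_indicator measurableSet_Ici]
  refine lintegral_congr fun s => ?_
  by_cases hs : 0 ≤ s
  · rw [Set.indicator_of_mem (Set.mem_Ici.2 hs), volume_localDistribInv_le_lt μ ν x y hs hs]
  · rw [Set.indicator_of_notMem (by simpa using hs)]
    have : {u | localDistribInv ν y u ≤ s ∧ s < localDistribInv μ x u} = ∅ := by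
      ext u
      have := localDistribInv_nonneg ν y u
      simp only [Set.mem_ofPred_eq, Set.mem_empty_iff_false, iff_false, not_and]
      intro
      linarith
    simp [this]

/-- **Corollary.**  Let `X`, `Y` be mm-spaces, `p ∈ [1,∞)`, let `φ : X → Y` be
measure-preserving and fix `x ∈ X`, `y ∈ Y`.  Then
`(∫_X |d_X(x,x') − d_Y(y,φ(x'))|^p μX(dx'))^{1/p}
   ≥ (∫_0^1 |h_X^{-1}(x,u) − h_Y^{-1}(y,u)|^p du)^{1/p}`,
and for `p = 1` the right-hand side equals
`c_{X,Y}(x,y) = ∫_0^∞ |h_X(x,t) − h_Y(y,t)| dt`. -/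
theorem pointwise_local_distribution_lowerBound
    {X Y : Type*}
    [MetricSpace X] [CompactSpace X] [MeasurableSpace X] [BorelSpace X]
    [MetricSpace Y] [CompactSpace Y] [MeasurableSpace Y] [BorelSpace Y]
    (μX : Measure X) (μY : Measure Y)
    [IsProbabilityMeasure μX] [IsProbabilityMeasure μY]
    [μX.IsOpenPosMeasure] [μY.IsOpenPosMeasure]
    (p : ℝ) (hp : 1 ≤ p)
    (φ : X → Y) (hφ : Measurable φ) (hmp : Measure.map φ μX = μY)
    (x : X) (y : Y) :
    (∫⁻ u in Set.Ioo (0 : ℝ) 1,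
        ENNReal.ofReal (|localDistribInv μX x u - localDistribInv μY y u| ^ p)) ^ (1 / p)
      ≤ (∫⁻ x', ENNReal.ofReal (|dist x x' - dist y (φ x')| ^ p) ∂μX) ^ (1 / p) ∧
    (∫⁻ u in Set.Ioo (0 : ℝ) 1,
        ENNReal.ofReal |localDistribInv μX x u - localDistribInv μY y u|)
      = ∫⁻ t in Set.Ioi (0 : ℝ),
          ENNReal.ofReal |localDistrib μX x t - localDistrib μY y t| := by
  have hid : MeasurePreserving (id : X → X) μX μX := .id μX
  have hφ' : MeasurePreserving φ μX μY := ⟨hφ, hmp⟩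
  have hf : Measurable fun x' : X => dist x x' := (continuous_const.dist continuous_id).measurable
  have hg : Measurable fun x' : X => dist y (φ x') :=
    (continuous_const.dist continuous_id).measurable.comp hφ
  have hqX := measurable_localDistribInv μX x
  have hqY := measurable_localDistribInv μY y
  constructor
  · refine ENNReal.rpow_le_rpow ?_ (by positivity)
    rw [lintegral_ofReal_abs_sub_rpow _ hqX hqY (by linarith),
      lintegral_ofReal_abs_sub_rpow _ hf hg (by linarith)]
    exact add_le_add
      (lintegral_ofReal_sub_rpow_le _ _ hf hg hqX hqY
        (volume_localDistribInv_le_lt_le_measure μX μY x y hid hφ') hp)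
      (lintegral_ofReal_sub_rpow_le _ _ hg hf hqY hqX
        (volume_localDistribInv_le_lt_le_measure μY μX y x hφ' hid) hp)
  · have h := lintegral_ofReal_abs_sub_rpow (volume.restrict (Set.Ioo (0 : ℝ) 1)) hqX hqY one_pos
    have h' := lintegral_ofReal_abs_sub_rpow (volume.restrict (Set.Ioi (0 : ℝ)))
      (localDistrib_mono μX x).measurable (localDistrib_mono μY y).measurable one_pos
    simp only [Real.rpow_one, ENNReal.rpow_one] at h h'
    rw [h, h', lintegral_ofReal_localDistribInv_sub, lintegral_ofReal_localDistribInv_sub,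
      add_comm]
end

section
/- There exist two simple closed polygonal curves X and Y in the plane ℝ², each regarded as an mm-space with the restriction of the Euclidean distance and the normalized one-dimensional Hausdorff (arclength) measure, such that X and Y are not related by any Euclidean isometry of ℝ², yet their global distance distributions agree: H_X(r) = H_Y(r) for all r ≥ 0. In particular the Curve Histogram Conjecture of Brinkman and Olver is false. -/
open MeasureTheory Metric ENNReal

/-- The Euclidean plane `ℝ²`. -/
noncomputable abbrev EucPlane : Type := EuclideanSpace ℝ (Fin 2)

/-- The normalized one-dimensional Hausdorff (arclength) measure on a subset `A` of the
plane: the restriction of the one-dimensional Hausdorff measure to `A`, normalized to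
total mass 1. -/
noncomputable def curveMeasure (A : Set EucPlane) : Measure EucPlane :=
  ((MeasureTheory.Measure.hausdorffMeasure 1 : Measure EucPlane) A)⁻¹ •
    ((MeasureTheory.Measure.hausdorffMeasure 1 : Measure EucPlane).restrict A)

/-- The global distance distribution of the curve `A` (with respect to the Euclidean
distance and the normalized arclength measure):
`H_A(r) = (μ_A ⊗ μ_A)({(x,x') : ‖x − x'‖ ≤ r})`. -/
noncomputable def curveGlobalDistrib (A : Set EucPlane) (r : ℝ) : ℝ≥0∞ :=
  ((curveMeasure A).prod (curveMeasure A)) {z : EucPlane × EucPlane | dist z.1 z.2 ≤ r}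

/-- `A` is a simple closed polygonal curve: a subset of the plane homeomorphic to the
circle which is a finite union of line segments. -/
def IsSimpleClosedPolygon (A : Set EucPlane) : Prop :=
  Nonempty (A ≃ₜ (Metric.sphere (0 : EucPlane) 1 : Set EucPlane)) ∧
  ∃ S : Finset (EucPlane × EucPlane), A = ⋃ e ∈ S, segment ℝ e.1 e.2

/-- The depth of the dent cut into the square `max |x| |y| = 3` along the ray through a point:
it vanishes exactly on the four mirror lines of the square. -/
noncomputable def dent (z : EucPlane) : ℝ :=
  min (min |z 0| |z 1|) (max |z 0| |z 1| - min |z 0| |z 1|)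

/-- The gauge of the square, raised by `dent` over the set `D`. -/
noncomputable def dentedGauge (D : Set EucPlane) (z : EucPlane) : ℝ :=
  max |z 0| |z 1| + D.indicator dent z

/-- The square of side `6`, dented over the set `D`. -/
def dentedSquare (D : Set EucPlane) : Set EucPlane := {z | dentedGauge D z = 3}

/-- Four of the eight sectors cut out by the mirror lines of the square. -/
def dentCone : Set EucPlane := {z | |z 1| < z 0 ∨ (z 0 < 0 ∧ 0 < z 1)}

theorem mem_segment_plane_iff (a b c d : ℝ) (h : 0 < (c - a) ^ 2 + (d - b) ^ 2) (z : EucPlane) :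
    z ∈ segment ℝ (!₂[a, b] : EucPlane) !₂[c, d] ↔
      (z 0 - a) * (d - b) = (z 1 - b) * (c - a) ∧
      0 ≤ (z 0 - a) * (c - a) + (z 1 - b) * (d - b) ∧
      (z 0 - a) * (c - a) + (z 1 - b) * (d - b) ≤ (c - a) ^ 2 + (d - b) ^ 2 := by
  rw [segment_eq_image']
  constructor
  · rintro ⟨t, ⟨h0, h1⟩, rfl⟩
    simp only [PiLp.add_apply, PiLp.smul_apply, PiLp.sub_apply, smul_eq_mul]
    simp
    refine ⟨by ring, ?_, ?_⟩ <;> nlinarith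
  · rintro ⟨h1, h2, h3⟩
    refine ⟨((z 0 - a) * (c - a) + (z 1 - b) * (d - b)) / ((c - a) ^ 2 + (d - b) ^ 2),
      ⟨by positivity, by rwa [div_le_one h]⟩, ?_⟩
    ext i
    fin_cases i
    · simp
      field_simp
      linear_combination -(d - b) * h1
    · simp
      field_simp
      linear_combination (c - a) * h1

/-- The linear conditions describing the segment from `(a, b)` to `(c, d)`. -/
def OnSegment (a b c d x y : ℝ) : Prop :=
  (x - a) * (d - b) = (y - b) * (c - a) ∧
    0 ≤ (x - a) * (c - a) + (y - b) * (d - b) ∧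
    (x - a) * (c - a) + (y - b) * (d - b) ≤ (c - a) ^ 2 + (d - b) ^ 2

theorem add_dent_eq_three_iff (x y : ℝ) : (max |x| |y| + if |y| < x ∨ x < 0 ∧ 0 < y then
      min (min |x| |y|) (max |x| |y| - min |x| |y|) else 0) = 3 ↔
    OnSegment 3 0 2 1 x y ∨
    OnSegment 2 1 3 3 x y ∨
    OnSegment 3 0 2 (-1) x y ∨
    OnSegment 2 (-1) 3 (-3) x y ∨
    OnSegment 0 3 (-1) 2 x y ∨
    OnSegment (-1) 2 (-3) 3 x y ∨
    OnSegment (-3) 0 (-2) 1 x y ∨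
    OnSegment (-2) 1 (-3) 3 x y ∨
    OnSegment 0 3 3 3 x y ∨
    OnSegment (-3) 0 (-3) (-3) x y ∨
    OnSegment (-3) (-3) 3 (-3) x y := by
  simp only [OnSegment]
  constructor
  · intro h
    rcases le_total 0 x with hx | hx <;> rcases le_total 0 y with hy | hy <;>
      rcases le_total |x| |y| with hxy | hxy <;>
      simp only [hxy, sup_of_le_left, sup_of_le_right, inf_of_le_left, inf_of_le_right] at h <;>
      simp only [abs_of_nonneg, abs_of_nonpos, hx, hy] at h hxy <;>
      split_ifs at h with hc <;> (try simp only [min_def] at h) <;>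
      (try split_ifs at h)
    all_goals first
      | (simp only [not_or, not_and_or, not_lt] at hc; rcases hc with ⟨_, hc | hc⟩)
      | rcases hc with hc | ⟨hc, _⟩
    all_goals
      repeat first | exact Or.inl ⟨by linarith, by linarith, by linarith⟩ | apply Or.inr
      try exact ⟨by linarith, by linarith, by linarith⟩
  · intro h
    rcases h with h | h | h | h | h | h | h | h | h | h | h <;>
      obtain ⟨h1, h2, h3⟩ := h <;>
      rcases le_total 0 x with hx | hx <;> rcases le_total 0 y with hy | hy <;>
      simp only [abs_of_nonneg, abs_of_nonpos, hx, hy] <;> grind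

theorem add_dent_compl_eq_three_iff (x y : ℝ) : (max |x| |y| + if |y| < x ∨ x < 0 ∧ 0 < y then
      0 else min (min |x| |y|) (max |x| |y| - min |x| |y|)) = 3 ↔
    OnSegment 0 3 1 2 x y ∨
    OnSegment 1 2 3 3 x y ∨
    OnSegment (-3) 0 (-2) (-1) x y ∨
    OnSegment (-2) (-1) (-3) (-3) x y ∨
    OnSegment 0 (-3) (-1) (-2) x y ∨
    OnSegment (-1) (-2) (-3) (-3) x y ∨
    OnSegment 0 (-3) 1 (-2) x y ∨
    OnSegment 1 (-2) 3 (-3) x y ∨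
    OnSegment 3 (-3) 3 3 x y ∨
    OnSegment 0 3 (-3) 3 x y ∨
    OnSegment (-3) 0 (-3) 3 x y := by
  simp only [OnSegment]
  constructor
  · intro h
    rcases le_total 0 x with hx | hx <;> rcases le_total 0 y with hy | hy <;>
      rcases le_total |x| |y| with hxy | hxy <;>
      simp only [hxy, sup_of_le_left, sup_of_le_right, inf_of_le_left, inf_of_le_right] at h <;>
      simp only [abs_of_nonneg, abs_of_nonpos, hx, hy] at h hxy <;>
      split_ifs at h with hc <;> (try simp only [min_def] at h) <;>
      (try split_ifs at h)
    all_goals first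
      | (simp only [not_or, not_and_or, not_lt] at hc; rcases hc with ⟨_, hc | hc⟩)
      | rcases hc with hc | ⟨hc, _⟩
    all_goals
      repeat first | exact Or.inl ⟨by linarith, by linarith, by linarith⟩ | apply Or.inr
      try exact ⟨by linarith, by linarith, by linarith⟩
  · intro h
    rcases h with h | h | h | h | h | h | h | h | h | h | h <;>
      obtain ⟨h1, h2, h3⟩ := h <;>
      rcases le_total 0 x with hx | hx <;> rcases le_total 0 y with hy | hy <;>
      simp only [abs_of_nonneg, abs_of_nonpos, hx, hy] <;> grind

theorem dentedSquare_dentCone_eq : dentedSquare dentCone =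
    ⋃ e ∈ ({(!₂[3, 0], !₂[2, 1]), (!₂[2, 1], !₂[3, 3]), (!₂[3, 0], !₂[2, -1]),
      (!₂[2, -1], !₂[3, -3]), (!₂[0, 3], !₂[-1, 2]), (!₂[-1, 2], !₂[-3, 3]),
      (!₂[-3, 0], !₂[-2, 1]), (!₂[-2, 1], !₂[-3, 3]), (!₂[0, 3], !₂[3, 3]),
      (!₂[-3, 0], !₂[-3, -3]), (!₂[-3, -3], !₂[3, -3])} :
      Set (EucPlane × EucPlane)), segment ℝ e.1 e.2 := by
  ext z
  simp only [Set.biUnion_insert, Set.biUnion_singleton, Set.mem_union]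
  repeat rw [mem_segment_plane_iff _ _ _ _ (by norm_num)]
  have h := add_dent_eq_three_iff (z 0) (z 1)
  simp only [OnSegment] at h
  rw [← h]
  change max |z 0| |z 1| + dentCone.indicator dent z = 3 ↔ _
  by_cases hz : |z 1| < z 0 ∨ z 0 < 0 ∧ 0 < z 1
  · rw [if_pos hz, Set.indicator_of_mem (show z ∈ dentCone from hz), dent]
  · rw [if_neg hz, Set.indicator_of_notMem (show z ∉ dentCone from hz), add_zero]

theorem dentedSquare_dentCone_compl_eq : dentedSquare dentConeᶜ =
    ⋃ e ∈ ({(!₂[0, 3], !₂[1, 2]), (!₂[1, 2], !₂[3, 3]), (!₂[-3, 0], !₂[-2, -1]),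
      (!₂[-2, -1], !₂[-3, -3]), (!₂[0, -3], !₂[-1, -2]), (!₂[-1, -2], !₂[-3, -3]),
      (!₂[0, -3], !₂[1, -2]), (!₂[1, -2], !₂[3, -3]), (!₂[3, -3], !₂[3, 3]),
      (!₂[0, 3], !₂[-3, 3]), (!₂[-3, 0], !₂[-3, 3])} :
      Set (EucPlane × EucPlane)), segment ℝ e.1 e.2 := by
  ext z
  simp only [Set.biUnion_insert, Set.biUnion_singleton, Set.mem_union]
  repeat rw [mem_segment_plane_iff _ _ _ _ (by norm_num)]
  have h := add_dent_compl_eq_three_iff (z 0) (z 1)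
  simp only [OnSegment] at h
  rw [← h]
  change max |z 0| |z 1| + dentConeᶜ.indicator dent z = 3 ↔ _
  by_cases hz : |z 1| < z 0 ∨ z 0 < 0 ∧ 0 < z 1
  · rw [if_pos hz, Set.indicator_of_notMem (not_not.mpr (show z ∈ dentCone from hz)), add_zero]
  · rw [if_neg hz, Set.indicator_of_mem (show z ∈ dentConeᶜ from hz), dent]

theorem nonempty_homeomorph_sphere_of_gauge {f : EucPlane → ℝ} {c : ℝ} (hc : 0 < c)
    (hpos : ∀ z, z ≠ 0 → 0 < f z) (hzero : f 0 = 0)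
    (hsmul : ∀ (t : ℝ) (z : EucPlane), 0 < t → f (t • z) = t * f z)
    (hcomp : IsCompact {z | f z = c}) :
    Nonempty ({z | f z = c} ≃ₜ (Metric.sphere (0 : EucPlane) 1 : Set EucPlane)) := by
  have hne : ∀ z : {z | f z = c}, (z : EucPlane) ≠ 0 := by
    rintro ⟨z, hz⟩ rfl
    exact hc.ne' (hz.symm.trans hzero)
  have hne' : ∀ u : Metric.sphere (0 : EucPlane) 1, (u : EucPlane) ≠ 0 :=
    fun u => ne_zero_of_mem_unit_sphere u
  have : CompactSpace {z | f z = c} := isCompact_iff_compactSpace.mp hcomp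
  let e : {z | f z = c} ≃ Metric.sphere (0 : EucPlane) 1 :=
    { toFun := fun z => ⟨‖(z : EucPlane)‖⁻¹ • (z : EucPlane), by
        have := norm_pos_iff.mpr (hne z)
        rw [mem_sphere_zero_iff_norm, norm_smul, norm_inv, norm_norm, inv_mul_cancel₀ this.ne']⟩
      invFun := fun u => ⟨(c / f u) • (u : EucPlane), by
        have := hpos _ (hne' u)
        change f _ = c
        rw [hsmul _ _ (div_pos hc this), div_mul_cancel₀ _ this.ne']⟩
      left_inv := by
        intro z
        have h1 := norm_pos_iff.mpr (hne z)
        have h2 : f z = c := z.2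
        ext1
        change (c / f (‖(z : EucPlane)‖⁻¹ • (z : EucPlane))) • _ = _
        rw [hsmul _ _ (inv_pos.mpr h1), h2, smul_smul]
        convert one_smul ℝ (z : EucPlane)
        field_simp
      right_inv := by
        intro u
        have h1 := hpos _ (hne' u)
        have h2 : ‖(u : EucPlane)‖ = 1 := norm_eq_of_mem_sphere u
        ext1
        change ‖(c / f u) • (u : EucPlane)‖⁻¹ • (c / f u) • (u : EucPlane) = u
        rw [norm_smul, h2, mul_one, Real.norm_of_nonneg (div_pos hc h1).le,
          inv_smul_smul₀ (div_pos hc h1).ne'] }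
  have hcont : Continuous e := by
    refine Continuous.subtype_mk ?_ _
    exact (continuous_subtype_val.norm.inv₀ fun z => norm_ne_zero_iff.mpr (hne z)).smul
      continuous_subtype_val
  exact ⟨hcont.homeoOfEquivCompactToT2⟩

theorem measurePreserving_restrict_add_restrict {α : Type*} [MeasurableSpace α] {μ : Measure α}
    {A B : Set α} (hA : MeasurableSet A) (hB : MeasurableSet B) {e : α → α}
    (he : MeasurePreserving e μ μ) (hunion : e ⁻¹' (A ∪ B) = A ∪ B)
    (hinter : e ⁻¹' (A ∩ B) = A ∩ B) :
    MeasurePreserving e (μ.restrict A + μ.restrict B) (μ.restrict A + μ.restrict B) := by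
  rw [← Measure.restrict_union_add_inter A hB]
  have h1 := he.restrict_preimage (hA.union hB)
  have h2 := he.restrict_preimage (hA.inter hB)
  rw [hunion] at h1
  rw [hinter] at h2
  exact ⟨he.measurable, by rw [Measure.map_add _ _ he.measurable, h1.map_eq, h2.map_eq]⟩

theorem setLIntegral_eq_of_piecewise {α : Type*} [MeasurableSpace α] {μ : Measure α}
    {A B E : Set α} (hE : MeasurableSet E) {σ τ : α ≃ᵐ α}
    (hσ : MeasurePreserving σ μ μ) (hτ : MeasurePreserving τ μ μ)
    (hσE : σ ⁻¹' (B ∩ E) = A ∩ E) (hτE : τ ⁻¹' (B \ E) = A \ E)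
    {F : α → ℝ≥0∞} (hFσ : ∀ x, F (σ x) = F x) (hFτ : ∀ x, F (τ x) = F x) :
    ∫⁻ x in A, F x ∂μ = ∫⁻ x in B, F x ∂μ := by
  have h1 := hσ.setLIntegral_comp_preimage_emb σ.measurableEmbedding F (B ∩ E)
  have h2 := hτ.setLIntegral_comp_preimage_emb τ.measurableEmbedding F (B \ E)
  simp only [hFσ, hσE] at h1
  simp only [hFτ, hτE] at h2
  rw [← lintegral_inter_add_sdiff F A hE, ← lintegral_inter_add_sdiff F B hE, h1, h2]

/-- If a plane set `A` can be cut into two parts which, moved by symmetries of the sum of the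
length measures of `A` and `B`, form `B`, then `A` and `B` have the same distance distribution. -/
theorem curveGlobalDistrib_eq_of_piecewise {A B E : Set EucPlane} (hA : MeasurableSet A)
    (hB : MeasurableSet B) (hE : MeasurableSet E)
    (hAfin : (Measure.hausdorffMeasure 1 : Measure EucPlane) A ≠ ∞)
    (hBfin : (Measure.hausdorffMeasure 1 : Measure EucPlane) B ≠ ∞)
    {σ τ : EucPlane ≃ᵢ EucPlane}
    (hσu : σ ⁻¹' (A ∪ B) = A ∪ B) (hσi : σ ⁻¹' (A ∩ B) = A ∩ B)
    (hτu : τ ⁻¹' (A ∪ B) = A ∪ B) (hτi : τ ⁻¹' (A ∩ B) = A ∩ B)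
    (hσE : σ ⁻¹' (B ∩ E) = A ∩ E) (hτE : τ ⁻¹' (B \ E) = A \ E) (r : ℝ) :
    curveGlobalDistrib A r = curveGlobalDistrib B r := by
  set μ : Measure EucPlane := Measure.hausdorffMeasure 1
  have hσ := σ.measurePreserving_hausdorffMeasure 1
  have hτ := τ.measurePreserving_hausdorffMeasure 1
  have key : ∀ F : EucPlane → ℝ≥0∞, (∀ x, F (σ x) = F x) → (∀ x, F (τ x) = F x) →
      ∫⁻ x in A, F x ∂μ = ∫⁻ x in B, F x ∂μ := fun F h1 h2 =>
    setLIntegral_eq_of_piecewise (σ := σ.toHomeomorph.toMeasurableEquiv)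
      (τ := τ.toHomeomorph.toMeasurableEquiv) hE hσ hτ hσE hτE h1 h2
  have hmass : μ A = μ B := by simpa using key (fun _ => 1) (by simp) (by simp)
  have : IsFiniteMeasure (μ.restrict A) := ⟨by simpa using hAfin.lt_top⟩
  have : IsFiniteMeasure (μ.restrict B) := ⟨by simpa using hBfin.lt_top⟩
  set D : Set (EucPlane × EucPlane) := {z | dist z.1 z.2 ≤ r}
  have hD : MeasurableSet D := (isClosed_le (by fun_prop) continuous_const).measurableSet
  have hslice : ∀ x, Prod.mk x ⁻¹' D = closedBall x r := fun x => by
    ext y; simp [D, dist_comm]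
  set ν := μ.restrict A + μ.restrict B
  have hball : ∀ e : EucPlane ≃ᵢ EucPlane, MeasurePreserving e ν ν →
      ∀ x, ν (closedBall (e x) r) = ν (closedBall x r) := fun e he x => by
    rw [← he.measure_preimage measurableSet_closedBall.nullMeasurableSet,
      e.isometry.preimage_closedBall]
  have hν := key (fun x => ν (closedBall x r))
    (hball σ (measurePreserving_restrict_add_restrict hA hB hσ hσu hσi))
    (hball τ (measurePreserving_restrict_add_restrict hA hB hτ hτu hτi))
  have hprod : ∀ S T : Set EucPlane, IsFiniteMeasure (μ.restrict T) →
      ((μ.restrict S).prod (μ.restrict T)) D = ∫⁻ x in S, μ.restrict T (closedBall x r) ∂μ :=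
    fun S T _ => by rw [Measure.prod_apply hD]; simp only [hslice]
  have hsplit : ∀ S, ∫⁻ x in S, ν (closedBall x r) ∂μ =
      ((μ.restrict S).prod (μ.restrict A)) D + ((μ.restrict S).prod (μ.restrict B)) D := by
    intro S
    rw [hprod S A inferInstance, hprod S B inferInstance, ← lintegral_add_left]
    · rfl
    · simp only [← hslice]
      exact measurable_measure_prodMk_left hD
  have hswap : ((μ.restrict A).prod (μ.restrict B)) D = ((μ.restrict B).prod (μ.restrict A)) D := by
    rw [← Measure.prod_swap, Measure.map_apply measurable_swap hD]
    congr 1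
    ext z
    simp [D, dist_comm]
  have hAB : ((μ.restrict A).prod (μ.restrict A)) D = ((μ.restrict B).prod (μ.restrict B)) D := by
    rw [hsplit, hsplit, hswap, add_comm] at hν
    exact (ENNReal.add_right_inj (measure_ne_top _ _)).mp hν
  simp only [curveGlobalDistrib, curveMeasure]
  rw [Measure.prod_smul_left, Measure.prod_smul_right, Measure.prod_smul_left,
    Measure.prod_smul_right]
  simp only [Measure.smul_apply]
  rw [hmass]
  exact congrArg _ (congrArg _ hAB)

theorem isCompact_of_eq_biUnion_segment {A : Set EucPlane} {S : Set (EucPlane × EucPlane)}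
    (hS : S.Finite) (hA : A = ⋃ e ∈ S, segment ℝ e.1 e.2) : IsCompact A := by
  rw [hA]
  refine hS.isCompact_biUnion fun e _ => ?_
  rw [segment_eq_image]
  exact isCompact_Icc.image (by fun_prop)

theorem hausdorffMeasure_ne_top_of_eq_biUnion_segment {A : Set EucPlane}
    {S : Set (EucPlane × EucPlane)} (hS : S.Finite) (hA : A = ⋃ e ∈ S, segment ℝ e.1 e.2) :
    (Measure.hausdorffMeasure 1 : Measure EucPlane) A ≠ ∞ := by
  rw [hA]
  refine (measure_biUnion_lt_top hS fun e _ => ?_).ne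
  rw [hausdorffMeasure_segment]
  exact edist_lt_top _ _

theorem dent_nonneg (z : EucPlane) : 0 ≤ dent z :=
  le_min (le_min (abs_nonneg _) (abs_nonneg _)) (sub_nonneg.mpr min_le_max)

theorem dent_smul {t : ℝ} (ht : 0 < t) (z : EucPlane) : dent (t • z) = t * dent z := by
  simp only [dent, PiLp.smul_apply, smul_eq_mul, abs_mul, abs_of_pos ht,
    ← mul_min_of_nonneg _ _ ht.le, ← mul_max_of_nonneg _ _ ht.le, ← mul_sub]

theorem smul_mem_dentCone_iff {t : ℝ} (ht : 0 < t) (z : EucPlane) :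
    t • z ∈ dentCone ↔ z ∈ dentCone := by
  simp [dentCone, abs_mul, abs_of_pos ht, ht, mul_pos_iff_of_pos_left, mul_neg_iff, ht.not_gt]

theorem dentedGauge_smul {D : Set EucPlane} (hD : ∀ t : ℝ, 0 < t → ∀ z, t • z ∈ D ↔ z ∈ D)
    {t : ℝ} (ht : 0 < t) (z : EucPlane) : dentedGauge D (t • z) = t * dentedGauge D z := by
  by_cases hz : z ∈ D <;>
    simp [dentedGauge, hD t ht, hz, dent_smul ht, abs_mul, abs_of_pos ht,
      ← mul_max_of_nonneg _ _ ht.le, mul_add]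

theorem dentedGauge_pos (D : Set EucPlane) {z : EucPlane} (hz : z ≠ 0) : 0 < dentedGauge D z := by
  have h1 : 0 ≤ D.indicator dent z := Set.indicator_nonneg (fun z _ => dent_nonneg z) z
  have h2 : 0 < max |z 0| |z 1| := by
    by_contra! h
    refine hz ?_
    ext i
    have h0 := abs_nonpos_iff.mp ((le_max_left _ _).trans h)
    have h1 := abs_nonpos_iff.mp ((le_max_right _ _).trans h)
    fin_cases i
    exacts [h0, h1]
  exact add_pos_of_pos_of_nonneg h2 h1

theorem dentedGauge_zero (D : Set EucPlane) : dentedGauge D 0 = 0 := by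
  have : dent 0 = 0 := by simp [dent]
  simp [dentedGauge, Set.indicator, this]

theorem isSimpleClosedPolygon_dentedSquare {D : Set EucPlane}
    (hD : ∀ t : ℝ, 0 < t → ∀ z, t • z ∈ D ↔ z ∈ D) {S : Set (EucPlane × EucPlane)}
    (hS : S.Finite) (h : dentedSquare D = ⋃ e ∈ S, segment ℝ e.1 e.2) :
    IsSimpleClosedPolygon (dentedSquare D) :=
  ⟨nonempty_homeomorph_sphere_of_gauge (by norm_num) (fun _ => dentedGauge_pos D)
    (dentedGauge_zero D) (fun _ z ht => dentedGauge_smul hD ht z)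
    (isCompact_of_eq_biUnion_segment hS h), hS.toFinset, by simpa using h⟩

/-- The rotation of the plane by a quarter turn. -/
noncomputable def quarterTurn : EucPlane ≃ᵢ EucPlane where
  toFun z := !₂[-z 1, z 0]
  invFun z := !₂[z 1, -z 0]
  left_inv z := by ext i; fin_cases i <;> simp
  right_inv z := by ext i; fin_cases i <;> simp
  isometry_toFun := Isometry.of_dist_eq fun z w => by
    simp only [EuclideanSpace.dist_eq, Fin.sum_univ_two, Real.dist_eq, sq_abs]
    congr 1
    simp
    ring

@[simp] theorem quarterTurn_apply_zero (z : EucPlane) : quarterTurn z 0 = -z 1 := rfl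

@[simp] theorem quarterTurn_apply_one (z : EucPlane) : quarterTurn z 1 = z 0 := rfl

theorem dent_neg (z : EucPlane) : dent (-z) = dent z := by simp [dent]

theorem dent_quarterTurn (z : EucPlane) : dent (quarterTurn z) = dent z := by
  simp [dent, max_comm, min_comm]

theorem mem_dentedSquare_or_iff (D : Set EucPlane) (z : EucPlane) :
    (z ∈ dentedSquare D ∨ z ∈ dentedSquare Dᶜ) ↔
      max |z 0| |z 1| = 3 ∨ max |z 0| |z 1| + dent z = 3 := by
  by_cases hz : z ∈ D <;> simp [dentedSquare, dentedGauge, hz, or_comm]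

theorem mem_dentedSquare_and_iff (D : Set EucPlane) (z : EucPlane) :
    (z ∈ dentedSquare D ∧ z ∈ dentedSquare Dᶜ) ↔
      max |z 0| |z 1| = 3 ∧ max |z 0| |z 1| + dent z = 3 := by
  by_cases hz : z ∈ D <;> simp [dentedSquare, dentedGauge, hz, and_comm]

theorem indicator_compl_dent_eq {D : Set EucPlane} {z w : EucPlane} (hd : dent w = dent z)
    (h : dent z = 0 ∨ (z ∈ D ↔ w ∉ D)) : Dᶜ.indicator dent w = D.indicator dent z := by
  rcases h with h | h
  · simp [Set.indicator, hd, h]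
  by_cases hz : z ∈ D
  · rw [Set.indicator_of_mem hz, Set.indicator_of_mem (show w ∈ Dᶜ from h.mp hz), hd]
  · rw [Set.indicator_of_notMem hz, Set.indicator_of_notMem fun hw => hz (h.mpr hw)]

theorem neg_mem_dentedSquare_compl_iff {D : Set EucPlane} {z : EucPlane}
    (h : dent z = 0 ∨ (z ∈ D ↔ -z ∉ D)) : -z ∈ dentedSquare Dᶜ ↔ z ∈ dentedSquare D := by
  simp [dentedSquare, dentedGauge, indicator_compl_dent_eq (dent_neg z) h]

theorem quarterTurn_mem_dentedSquare_compl_iff {D : Set EucPlane} {z : EucPlane}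
    (h : z ∈ D ↔ quarterTurn z ∉ D) : quarterTurn z ∈ dentedSquare Dᶜ ↔ z ∈ dentedSquare D := by
  simp [dentedSquare, dentedGauge, indicator_compl_dent_eq (dent_quarterTurn z) (.inr h),
    max_comm]

theorem dent_ne_zero_imp {z : EucPlane} (h : dent z ≠ 0) : z 0 ≠ 0 ∧ z 1 ≠ 0 ∧ |z 0| ≠ |z 1| := by
  refine ⟨fun h0 => h ?_, fun h0 => h ?_, fun h0 => h ?_⟩ <;> simp [dent, h0]

theorem neg_quarterTurn_mem_dentCone_iff {z : EucPlane} (h : dent z ≠ 0) :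
    (quarterTurn z ∈ dentCone ↔ -quarterTurn z ∉ dentCone) ↔ (z ∈ dentCone ↔ -z ∉ dentCone) := by
  obtain ⟨h0, h1, h2⟩ := dent_ne_zero_imp h
  simp only [dentCone, Set.mem_ofPred_eq, quarterTurn_apply_zero, quarterTurn_apply_one,
    PiLp.neg_apply, abs_neg]
  generalize (z 0 : ℝ) = x at *
  generalize (z 1 : ℝ) = y at *
  rcases lt_or_gt_of_ne h0 with hx | hx <;> rcases lt_or_gt_of_ne h1 with hy | hy <;>
    simp only [abs_of_pos, abs_of_neg, hx, hy] at h2 ⊢ <;> grind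

theorem quarterTurn_mem_dentCone_iff {z : EucPlane} (h : dent z ≠ 0)
    (hz : ¬(z ∈ dentCone ↔ -z ∉ dentCone)) : z ∈ dentCone ↔ quarterTurn z ∉ dentCone := by
  obtain ⟨h0, h1, h2⟩ := dent_ne_zero_imp h
  revert hz
  simp only [dentCone, Set.mem_ofPred_eq, quarterTurn_apply_zero, quarterTurn_apply_one,
    PiLp.neg_apply, abs_neg]
  generalize (z 0 : ℝ) = x at *
  generalize (z 1 : ℝ) = y at *
  rcases lt_or_gt_of_ne h0 with hx | hx <;> rcases lt_or_gt_of_ne h1 with hy | hy <;>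
    simp only [abs_of_pos, abs_of_neg, hx, hy] at h2 ⊢ <;> grind

theorem measurable_dent : Measurable dent := by
  unfold dent
  fun_prop

theorem measurableSet_dentCone : MeasurableSet dentCone := by
  have h0 : Measurable fun z : EucPlane => z 0 := by fun_prop
  have h1 : Measurable fun z : EucPlane => z 1 := by fun_prop
  exact (measurableSet_lt h1.abs h0).union
    ((measurableSet_lt h0 measurable_const).inter (measurableSet_lt measurable_const h1))

theorem curveGlobalDistrib_dentedSquare (r : ℝ) :
    curveGlobalDistrib (dentedSquare dentCone) r =
      curveGlobalDistrib (dentedSquare dentConeᶜ) r := by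
  have hX := isCompact_of_eq_biUnion_segment (Set.toFinite _) dentedSquare_dentCone_eq
  have hY := isCompact_of_eq_biUnion_segment (Set.toFinite _) dentedSquare_dentCone_compl_eq
  have hE : MeasurableSet {z | dent z = 0 ∨ (z ∈ dentCone ↔ -z ∉ dentCone)} := by
    have hneg : MeasurableSet {z | -z ∈ dentCone} := measurable_neg measurableSet_dentCone
    exact (measurable_dent (measurableSet_singleton 0)).union
      (measurableSet_dentCone.iff hneg.compl)
  refine curveGlobalDistrib_eq_of_piecewise (σ := IsometryEquiv.neg EucPlane) (τ := quarterTurn)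
    hX.measurableSet hY.measurableSet hE
    (hausdorffMeasure_ne_top_of_eq_biUnion_segment (Set.toFinite _) dentedSquare_dentCone_eq)
    (hausdorffMeasure_ne_top_of_eq_biUnion_segment (Set.toFinite _) dentedSquare_dentCone_compl_eq)
    ?_ ?_ ?_ ?_ ?_ ?_ r
  · ext z
    simp only [Set.mem_preimage, Set.mem_union, mem_dentedSquare_or_iff]
    simp [dent_neg]
  · ext z
    simp only [Set.mem_preimage, Set.mem_inter_iff, mem_dentedSquare_and_iff]
    simp [dent_neg]
  · ext z
    simp only [Set.mem_preimage, Set.mem_union, mem_dentedSquare_or_iff]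
    simp [dent_quarterTurn, max_comm]
  · ext z
    simp only [Set.mem_preimage, Set.mem_inter_iff, mem_dentedSquare_and_iff]
    simp [dent_quarterTurn, max_comm]
  · ext z
    have hs : (dent (-z) = 0 ∨ (-z ∈ dentCone ↔ - -z ∉ dentCone)) ↔
        (dent z = 0 ∨ (z ∈ dentCone ↔ -z ∉ dentCone)) := by
      rw [dent_neg, neg_neg, iff_not_comm]
    change (-z ∈ dentedSquare dentConeᶜ ∧
      (dent (-z) = 0 ∨ (-z ∈ dentCone ↔ - -z ∉ dentCone))) ↔
      (z ∈ dentedSquare dentCone ∧ (dent z = 0 ∨ (z ∈ dentCone ↔ -z ∉ dentCone)))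
    rw [hs]
    exact and_congr_left neg_mem_dentedSquare_compl_iff
  · ext z
    have hs : (dent (quarterTurn z) = 0 ∨
        (quarterTurn z ∈ dentCone ↔ -quarterTurn z ∉ dentCone)) ↔
        (dent z = 0 ∨ (z ∈ dentCone ↔ -z ∉ dentCone)) := by
      rw [dent_quarterTurn]
      by_cases h : dent z = 0
      · simp [h]
      · rw [neg_quarterTurn_mem_dentCone_iff h]
    change (quarterTurn z ∈ dentedSquare dentConeᶜ ∧ ¬(dent (quarterTurn z) = 0 ∨
      (quarterTurn z ∈ dentCone ↔ -quarterTurn z ∉ dentCone))) ↔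
      (z ∈ dentedSquare dentCone ∧ ¬(dent z = 0 ∨ (z ∈ dentCone ↔ -z ∉ dentCone)))
    rw [hs]
    refine and_congr_left fun h => ?_
    rw [not_or] at h
    exact quarterTurn_mem_dentedSquare_compl_iff (quarterTurn_mem_dentCone_iff h.1 h.2)

theorem dist_sq_plane (z w : EucPlane) :
    dist z w ^ 2 = (z 0 - w 0) ^ 2 + (z 1 - w 1) ^ 2 := by
  rw [EuclideanSpace.dist_eq, Real.sq_sqrt (by positivity)]
  simp [Fin.sum_univ_two, Real.dist_eq]

theorem abs_le_three_of_mem_dentedSquare {D : Set EucPlane} {z : EucPlane}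
    (hz : z ∈ dentedSquare D) : |z 0| ≤ 3 ∧ |z 1| ≤ 3 := by
  have h1 : 0 ≤ D.indicator dent z := Set.indicator_nonneg (fun z _ => dent_nonneg z) z
  have h2 : max |z 0| |z 1| + D.indicator dent z = 3 := hz
  exact max_le_iff.mp (by linarith)

/-- The points of the dented square closest to the origin are the tips of its dents. -/
theorem tip_of_mem_dentedSquare {z : EucPlane} (hz : z ∈ dentedSquare dentCone)
    (h : z 0 ^ 2 + z 1 ^ 2 = 5) :
    (z 0 = 2 ∧ z 1 = 1) ∨ (z 0 = 2 ∧ z 1 = -1) ∨ (z 0 = -2 ∧ z 1 = 1) ∨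
      (z 0 = -1 ∧ z 1 = 2) := by
  have hz' : max |z 0| |z 1| + dentCone.indicator dent z = 3 := hz
  by_cases hc : z ∈ dentCone
  · rw [Set.indicator_of_mem hc, dent] at hz'
    change |z 1| < z 0 ∨ (z 0 < 0 ∧ 0 < z 1) at hc
    generalize (z 0 : ℝ) = x at *
    generalize (z 1 : ℝ) = y at *
    have aux : ∀ a b : ℝ, 0 ≤ b → b ≤ a → a ^ 2 + b ^ 2 = 5 → a + min b (a - b) = 3 →
        a = 2 ∧ b = 1 := by
      intro a b hb hab h5 h3
      rcases min_cases b (a - b) with ⟨hm, hm'⟩ | ⟨hm, hm'⟩ <;> rw [hm] at h3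
      · obtain rfl : a = 3 - b := by linarith
        have : b = 1 := by nlinarith
        constructor <;> linarith
      · obtain rfl : b = 2 * a - 3 := by linarith
        have : a = 2 := by nlinarith
        constructor <;> linarith
    rcases le_total |x| |y| with hxy | hxy
    · simp only [hxy, sup_of_le_right, inf_of_le_left] at hz'
      obtain ⟨hy, hx⟩ := aux _ _ (abs_nonneg x) hxy (by simp only [sq_abs]; linarith) hz'
      rcases eq_or_eq_neg_of_abs_eq hx with hx | hx <;>
        rcases eq_or_eq_neg_of_abs_eq hy with hy | hy <;> subst hx <;> subst hy <;>
        revert hc <;> norm_num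
    · simp only [hxy, sup_of_le_left, inf_of_le_right] at hz'
      obtain ⟨hx, hy⟩ := aux _ _ (abs_nonneg y) hxy (by simp only [sq_abs]; linarith) hz'
      rcases eq_or_eq_neg_of_abs_eq hx with hx | hx <;>
        rcases eq_or_eq_neg_of_abs_eq hy with hy | hy <;> subst hx <;> subst hy <;>
        revert hc <;> norm_num
  · rw [Set.indicator_of_notMem hc, add_zero] at hz'
    rcases max_choice |z 0| |z 1| with hm | hm <;> rw [hm] at hz' <;>
      nlinarith [sq_abs (z 0), sq_abs (z 1), sq_nonneg (z 0), sq_nonneg (z 1)]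

theorem eq_zero_of_sq_dist_eq {a b c d u v : ℝ} (ha : |a| ≤ 3) (hb : |b| ≤ 3) (hc : |c| ≤ 3)
    (hd : |d| ≤ 3) (h : (a - c) ^ 2 + (b - d) ^ 2 = 72) (h₁ : (u - a) ^ 2 + (v - b) ^ 2 = 18)
    (h₂ : (u - c) ^ 2 + (v - d) ^ 2 = 18) : u = 0 ∧ v = 0 := by
  have sq_le : ∀ t : ℝ, |t| ≤ 3 → t ^ 2 ≤ 9 := fun t ht => by
    rw [← sq_abs]
    nlinarith [abs_nonneg t]
  replace ha := sq_le a ha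
  replace hb := sq_le b hb
  replace hc := sq_le c hc
  replace hd := sq_le d hd
  have hac : (a + c) ^ 2 = 0 :=
    le_antisymm (by linarith [sq_nonneg (b + d)]) (sq_nonneg _)
  have hbd : (b + d) ^ 2 = 0 :=
    le_antisymm (by linarith [sq_nonneg (a + c)]) (sq_nonneg _)
  obtain rfl : c = -a := by linarith [pow_eq_zero_iff two_ne_zero |>.mp hac]
  obtain rfl : d = -b := by linarith [pow_eq_zero_iff two_ne_zero |>.mp hbd]
  have hu : u ^ 2 = 0 := le_antisymm (by linarith [sq_nonneg v]) (sq_nonneg _)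
  have hv : v ^ 2 = 0 := le_antisymm (by linarith [sq_nonneg u]) (sq_nonneg _)
  exact ⟨pow_eq_zero_iff two_ne_zero |>.mp hu, pow_eq_zero_iff two_ne_zero |>.mp hv⟩

/-- An isometry carrying two opposite corners of a square into the square fixes the centre of the
square. -/
theorem isometry_apply_zero {T : EucPlane → EucPlane} (hT : Isometry T)
    (h₁ : |T !₂[3, 3] 0| ≤ 3 ∧ |T !₂[3, 3] 1| ≤ 3)
    (h₂ : |T !₂[-3, -3] 0| ≤ 3 ∧ |T !₂[-3, -3] 1| ≤ 3) : T 0 = 0 := by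
  have d1 := dist_sq_plane (T !₂[3, 3]) (T !₂[-3, -3])
  have d2 := dist_sq_plane (T 0) (T !₂[3, 3])
  have d3 := dist_sq_plane (T 0) (T !₂[-3, -3])
  rw [hT.dist_eq, dist_sq_plane] at d1 d2 d3
  obtain ⟨h0, h1⟩ := eq_zero_of_sq_dist_eq h₁.1 h₁.2 h₂.1 h₂.2
    (d1.symm.trans (by norm_num)) (d2.symm.trans (by norm_num)) (d3.symm.trans (by norm_num))
  ext i
  fin_cases i
  exacts [h0, h1]

theorem not_exists_isometryEquiv_dentedSquare :
    ¬ ∃ T : EucPlane ≃ᵢ EucPlane, T '' dentedSquare dentCone = dentedSquare dentConeᶜ := by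
  rintro ⟨T, hT⟩
  have hmem : ∀ z ∈ dentedSquare dentCone, T z ∈ dentedSquare dentConeᶜ := fun z hz =>
    hT ▸ Set.mem_image_of_mem T hz
  have h0 : T 0 = 0 := by
    refine isometry_apply_zero T.isometry ?_ ?_ <;>
      refine abs_le_three_of_mem_dentedSquare (hmem _ ?_) <;>
      simp [dentedSquare, dentedGauge, dent, Set.indicator]
  have htip : ∀ a b : ℝ, !₂[a, b] ∈ dentedSquare dentConeᶜ → a ^ 2 + b ^ 2 = 5 →
      ∃ z ∈ dentedSquare dentCone, z 0 ^ 2 + z 1 ^ 2 = 5 ∧ T z = !₂[a, b] := by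
    intro a b hab h5
    rw [← hT] at hab
    obtain ⟨z, hz, hTz⟩ := hab
    refine ⟨z, hz, ?_, hTz⟩
    have h1 := dist_sq_plane z 0
    rw [← T.dist_eq, h0, hTz, dist_sq_plane] at h1
    simp at h1
    linarith
  obtain ⟨p, hp, hp5, hTp⟩ := htip 1 (-2) (by
    norm_num [dentedSquare, dentedGauge, dent, dentCone, Set.indicator]) (by norm_num)
  obtain ⟨q, hq, hq5, hTq⟩ := htip (-1) (-2) (by
    norm_num [dentedSquare, dentedGauge, dent, dentCone, Set.indicator]) (by norm_num)
  obtain ⟨s, hs, hs5, hTs⟩ := htip (-2) (-1) (by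
    norm_num [dentedSquare, dentedGauge, dent, dentCone, Set.indicator]) (by norm_num)
  have hpq := dist_sq_plane p q
  have hqs := dist_sq_plane q s
  rw [← T.dist_eq, hTp, hTq, dist_sq_plane] at hpq
  rw [← T.dist_eq, hTq, hTs, dist_sq_plane] at hqs
  rcases tip_of_mem_dentedSquare hp hp5 with ⟨a, b⟩ | ⟨a, b⟩ | ⟨a, b⟩ | ⟨a, b⟩ <;>
    rcases tip_of_mem_dentedSquare hq hq5 with ⟨c, d⟩ | ⟨c, d⟩ | ⟨c, d⟩ | ⟨c, d⟩ <;>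
    rw [a, b, c, d] at hpq <;> norm_num at hpq <;>
    rcases tip_of_mem_dentedSquare hs hs5 with ⟨e, f⟩ | ⟨e, f⟩ | ⟨e, f⟩ | ⟨e, f⟩ <;>
    rw [c, d, e, f] at hqs <;> norm_num at hqs

/-- **Proposition (counterexample to the Curve Histogram Conjecture).**
There exist two simple closed polygonal plane curves, not related by any Euclidean
isometry of `ℝ²`, whose global distance distributions (for the Euclidean distance and
normalized arclength measure) agree for all `r ≥ 0`.  In particular the Curve Histogram
Conjecture of Brinkman and Olver is false. -/
theorem curve_histogram_conjecture_false :
    ∃ A B : Set EucPlane, IsSimpleClosedPolygon A ∧ IsSimpleClosedPolygon B ∧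
      (¬ ∃ T : EucPlane ≃ᵢ EucPlane, T '' A = B) ∧
      ∀ r : ℝ, 0 ≤ r → curveGlobalDistrib A r = curveGlobalDistrib B r := by
  have hcone : ∀ t : ℝ, 0 < t → ∀ z, t • z ∈ dentCone ↔ z ∈ dentCone := fun _ ht z =>
    smul_mem_dentCone_iff ht z
  exact ⟨dentedSquare dentCone, dentedSquare dentConeᶜ,
    isSimpleClosedPolygon_dentedSquare hcone (Set.toFinite _) dentedSquare_dentCone_eq,
    isSimpleClosedPolygon_dentedSquare (fun t ht z => not_congr (hcone t ht z)) (Set.toFinite _)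
      dentedSquare_dentCone_compl_eq,
    not_exists_isometryEquiv_dentedSquare, fun r _ => curveGlobalDistrib_dentedSquare r⟩
end

section
/- For every ε > 0 there exist simple closed planar curves X₁ and X₂, each regarded as an mm-space with Euclidean distance and normalized arclength (one-dimensional Hausdorff) measure, such that: (1) the Hausdorff distance between the unit circle S¹ ⊂ ℝ² and each X_j is less than ε; (2) X₁ is not isometric to X₂ (no Euclidean isometry of ℝ² maps one onto the other); and (3) H_{X₁}(r) = H_{X₂}(r) for all r ≥ 0. Moreover X₁ and X₂ can be chosen to be convex polygonal curves. -/
open MeasureTheory Metric ENNReal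

/-- `A` is convex in the sense of curves: the boundary of a compact convex body. -/
def IsConvexCurve (A : Set EucPlane) : Prop :=
  ∃ K : Set EucPlane, Convex ℝ K ∧ IsCompact K ∧ A = frontier K

open scoped RealInnerProductSpace

/-- The intersection of the half-planes `⟪u, z⟫ ≤ 1` with `u ∈ U`. -/
def polarBody (U : Set EucPlane) : Set EucPlane := {z | ∀ u ∈ U, ⟪u, z⟫ ≤ 1}

theorem isClosed_polarBody (U : Set EucPlane) : IsClosed (polarBody U) := by
  have : polarBody U = ⋂ u ∈ U, {z | ⟪u, z⟫ ≤ 1} := by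
    ext z; simp [polarBody]
  rw [this]
  exact isClosed_biInter fun u _ => isClosed_le (by fun_prop) continuous_const

theorem convex_polarBody (U : Set EucPlane) : Convex ℝ (polarBody U) := by
  intro x hx y hy a b ha hb hab u hu
  have h1 := mul_le_mul_of_nonneg_left (hx u hu) ha
  have h2 := mul_le_mul_of_nonneg_left (hy u hu) hb
  rw [inner_add_right, real_inner_smul_right, real_inner_smul_right]
  linarith

theorem ball_subset_polarBody {U : Set EucPlane} (hn : ∀ u ∈ U, ‖u‖ = 1) :
    ball 0 1 ⊆ polarBody U := by
  intro z hz u hu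
  have h := real_inner_le_norm u z
  rw [hn u hu] at h
  have : ‖z‖ < 1 := by simpa using hz
  linarith

theorem mem_frontier_polarBody {U : Set EucPlane} (hU : U.Finite) {z : EucPlane} :
    z ∈ frontier (polarBody U) ↔ z ∈ polarBody U ∧ ∃ u ∈ U, ⟪u, z⟫ = 1 := by
  rw [(isClosed_polarBody U).frontier_eq]
  refine ⟨fun ⟨hz, hi⟩ => ⟨hz, ?_⟩, fun ⟨hz, u, hu, h1⟩ => ⟨hz, fun hi => ?_⟩⟩
  · by_contra! h
    apply hi
    have ho : IsOpen (⋂ u ∈ U, {x : EucPlane | ⟪u, x⟫ < 1}) :=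
      hU.isOpen_biInter fun u _ => isOpen_lt (by fun_prop) continuous_const
    refine mem_interior.2 ⟨_, fun x hx u hu => ?_, ho, ?_⟩
    · simp only [Set.mem_iInter, Set.mem_ofPred_eq] at hx
      exact (hx u hu).le
    · simp only [Set.mem_iInter, Set.mem_ofPred_eq]
      exact fun u hu => lt_of_le_of_ne (hz u hu) (h u hu)
  · have hc : Continuous fun t : ℝ => t • z := by fun_prop
    have hev : ∀ᶠ t : ℝ in nhds 1, t • z ∈ interior (polarBody U) := by
      apply hc.continuousAt.eventually_mem
      simpa using isOpen_interior.mem_nhds hi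
    obtain ⟨t, ht, ht1⟩ := ((hev.filter_mono nhdsWithin_le_nhds).and
      (self_mem_nhdsWithin : Set.Ioi (1 : ℝ) ∈ nhdsWithin 1 (Set.Ioi 1))).exists
    have := interior_subset ht u hu
    rw [real_inner_smul_right, h1] at this
    have : 1 < t := ht1
    linarith

/-- A unit vector orthogonal to a given unit vector `u`, together with the resulting
coordinates on the plane. -/
theorem exists_orthogonal_unit {u : EucPlane} (hu : ‖u‖ = 1) :
    ∃ v : EucPlane, ∀ z : EucPlane, z = ⟪u, z⟫ • u + ⟪v, z⟫ • v := by
  have h : u 0 ^ 2 + u 1 ^ 2 = 1 := by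
    have := EuclideanSpace.norm_sq_eq u
    rw [hu] at this
    simpa using this.symm
  refine ⟨!₂[-u 1, u 0], fun z => ?_⟩
  ext i
  fin_cases i
  · simp [PiLp.inner_apply, Fin.sum_univ_two]
    linear_combination (-z 0) * h
  · simp [PiLp.inner_apply, Fin.sum_univ_two]
    linear_combination (-z 1) * h

theorem exists_segment_eq_of_subset_line {u : EucPlane} (hu : ‖u‖ = 1) {F : Set EucPlane}
    (hc : IsCompact F) (hconv : Convex ℝ F) (hne : F.Nonempty) (hF : ∀ z ∈ F, ⟪u, z⟫ = 1) :
    ∃ a b : EucPlane, F = segment ℝ a b := by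
  obtain ⟨v, hv⟩ := exists_orthogonal_unit hu
  have himg : IsCompact ((fun z : EucPlane => ⟪v, z⟫) '' F) := hc.image (by fun_prop)
  have hcon : IsConnected ((fun z : EucPlane => ⟪v, z⟫) '' F) :=
    (hconv.isConnected hne).image _ (by fun_prop)
  have hI := eq_Icc_of_connected_compact hcon himg
  have hle := hI ▸ hcon.nonempty
  rw [Set.nonempty_Icc] at hle
  rw [← segment_eq_Icc hle] at hI
  refine ⟨AffineMap.lineMap u (u + v) (sInf ((fun z : EucPlane => ⟪v, z⟫) '' F)),
    AffineMap.lineMap u (u + v) (sSup ((fun z : EucPlane => ⟪v, z⟫) '' F)), ?_⟩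
  rw [← image_segment, ← hI, Set.image_image]
  have : ∀ z ∈ F, AffineMap.lineMap u (u + v) ⟪v, z⟫ = z := by
    intro z hz
    have := hv z
    rw [hF z hz, one_smul] at this
    rw [AffineMap.lineMap_apply]
    simp only [vsub_eq_sub, add_sub_cancel_left, vadd_eq_add]
    rw [add_comm]; exact this.symm
  rw [Set.image_congr this, Set.image_id']

theorem exists_segments_eq_frontier_polarBody {U : Set EucPlane} (hU : U.Finite)
    (hn : ∀ u ∈ U, ‖u‖ = 1) {R : ℝ} (hR : polarBody U ⊆ closedBall 0 R) :
    ∃ S : Finset (EucPlane × EucPlane),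
      frontier (polarBody U) = ⋃ e ∈ S, segment ℝ e.1 e.2 := by
  classical
  have key : ∀ u ∈ U, ∃ e : EucPlane × EucPlane,
      polarBody U ∩ {z | ⟪u, z⟫ = 1} = segment ℝ e.1 e.2 := by
    intro u hu
    have hcl : IsClosed {z : EucPlane | ⟪u, z⟫ = 1} := isClosed_eq (by fun_prop) continuous_const
    have hcomp : IsCompact (polarBody U) :=
      (isCompact_closedBall 0 R).of_isClosed_subset (isClosed_polarBody U) hR
    have hcv : Convex ℝ {z : EucPlane | ⟪u, z⟫ = 1} := by
      intro x hx y hy a b ha hb hab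
      simp only [Set.mem_ofPred_eq] at hx hy ⊢
      rw [inner_add_right, real_inner_smul_right, real_inner_smul_right, hx, hy]
      linarith
    have hmem : u ∈ polarBody U := fun v hv => by
      have := real_inner_le_norm v u
      rwa [hn u hu, hn v hv, mul_one] at this
    obtain ⟨a, b, h⟩ := exists_segment_eq_of_subset_line (hn u hu) (hcomp.inter_right hcl)
      ((convex_polarBody U).inter hcv)
      ⟨u, hmem, by simp [hn u hu]⟩ (fun z hz => hz.2)
    exact ⟨(a, b), h⟩
  choose! f hf using key
  refine ⟨hU.toFinset.image f, ?_⟩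
  ext z
  rw [mem_frontier_polarBody hU]
  simp only [Finset.mem_image, Set.Finite.mem_toFinset, Set.iUnion_exists, Set.biUnion_and',
    Set.iUnion_iUnion_eq_right, Set.mem_iUnion, exists_prop]
  constructor
  · rintro ⟨hz, u, hu, h1⟩
    exact ⟨u, hu, hf u hu ▸ ⟨hz, h1⟩⟩
  · rintro ⟨u, hu, h⟩
    rw [← hf u hu] at h
    exact ⟨h.1, u, hu, h.2⟩

theorem isSimpleClosedPolygon_frontier_polarBody {U : Set EucPlane} (hU : U.Finite)
    (hn : ∀ u ∈ U, ‖u‖ = 1) {R : ℝ} (hR : polarBody U ⊆ closedBall 0 R) :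
    IsSimpleClosedPolygon (frontier (polarBody U)) := by
  refine ⟨?_, exists_segments_eq_frontier_polarBody hU hn hR⟩
  obtain ⟨h, -, -, hf⟩ := exists_homeomorph_image_interior_closure_frontier_eq_unitBall
    (convex_polarBody U)
    ⟨0, interior_maximal (ball_subset_polarBody hn) isOpen_ball (by simp)⟩
    (isBounded_closedBall.subset hR)
  exact ⟨(h.image _).trans (Homeomorph.setCongr hf)⟩

theorem isConvexCurve_frontier_polarBody {U : Set EucPlane} {R : ℝ}
    (hR : polarBody U ⊆ closedBall 0 R) : IsConvexCurve (frontier (polarBody U)) :=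
  ⟨_, convex_polarBody U,
    (isCompact_closedBall 0 R).of_isClosed_subset (isClosed_polarBody U) hR, rfl⟩

theorem hausdorffMeasure_frontier_polarBody_lt_top {U : Set EucPlane} (hU : U.Finite)
    (hn : ∀ u ∈ U, ‖u‖ = 1) {R : ℝ} (hR : polarBody U ⊆ closedBall 0 R) :
    (Measure.hausdorffMeasure 1 : Measure EucPlane) (frontier (polarBody U)) < ⊤ := by
  obtain ⟨S, hS⟩ := exists_segments_eq_frontier_polarBody hU hn hR
  rw [hS]
  refine (measure_biUnion_finset_le S _).trans_lt (ENNReal.sum_lt_top.2 fun e _ => ?_)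
  rw [hausdorffMeasure_segment]
  exact edist_lt_top _ _

theorem one_le_norm_of_mem_frontier_polarBody {U : Set EucPlane} (hU : U.Finite)
    (hn : ∀ u ∈ U, ‖u‖ = 1) {z : EucPlane} (hz : z ∈ frontier (polarBody U)) : 1 ≤ ‖z‖ := by
  obtain ⟨-, u, hu, h⟩ := (mem_frontier_polarBody hU).1 hz
  have := real_inner_le_norm u z
  rw [hn u hu, h, one_mul] at this
  exact this

theorem hausdorffDist_sphere_frontier_polarBody_le {U : Set EucPlane} (hU : U.Finite)
    (hn : ∀ u ∈ U, ‖u‖ = 1) {R : ℝ} (hR1 : 1 ≤ R) (hR : polarBody U ⊆ closedBall 0 R) :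
    hausdorffDist (sphere (0 : EucPlane) 1) (frontier (polarBody U)) ≤ R - 1 := by
  apply hausdorffDist_le_of_mem_dist (by linarith)
  · intro x hx
    have hx1 : ‖x‖ = 1 := by simpa using hx
    have hpos : ∃ u ∈ U, 0 < ⟪u, x⟫ := by
      by_contra! h
      have : (R + 1) • x ∈ polarBody U := fun u hu => by
        rw [real_inner_smul_right]
        nlinarith [h u hu]
      have := hR this
      rw [mem_closedBall_zero_iff, norm_smul, hx1, Real.norm_of_nonneg (by linarith)] at this
      linarith
    obtain ⟨w, hw, hwpos⟩ := hpos
    obtain ⟨u, hu, hmax⟩ := hU.exists_maximalFor (fun u => ⟪u, x⟫) U ⟨w, hw⟩ |>.imp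
      fun u h => (⟨h.1, fun v hv => (le_total ⟪v, x⟫ ⟪u, x⟫).elim id fun h' => h.2 hv h'⟩ :
        u ∈ U ∧ ∀ v ∈ U, ⟪v, x⟫ ≤ ⟪u, x⟫)
    have hupos : 0 < ⟪u, x⟫ := hwpos.trans_le (hmax w hw)
    have hmem : (⟪u, x⟫)⁻¹ • x ∈ frontier (polarBody U) := by
      rw [mem_frontier_polarBody hU]
      refine ⟨fun v hv => ?_, u, hu, ?_⟩
      · rw [real_inner_smul_right, inv_mul_le_iff₀ hupos, mul_one]
        exact hmax v hv
      · rw [real_inner_smul_right, inv_mul_cancel₀ hupos.ne']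
    refine ⟨_, hmem, ?_⟩
    have h1 := one_le_norm_of_mem_frontier_polarBody hU hn hmem
    have h2 := hR ((mem_frontier_polarBody hU).1 hmem).1
    rw [mem_closedBall_zero_iff] at h2
    rw [norm_smul, hx1, mul_one, Real.norm_of_nonneg (inv_nonneg.2 hupos.le)] at h1 h2
    rw [dist_comm, dist_eq_norm]
    have : (⟪u, x⟫)⁻¹ • x - x = ((⟪u, x⟫)⁻¹ - 1) • x := by rw [sub_smul, one_smul]
    rw [this, norm_smul, hx1, Real.norm_of_nonneg (by linarith)]
    linarith
  · intro x hx
    have h1 := one_le_norm_of_mem_frontier_polarBody hU hn hx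
    have h2 := hR ((mem_frontier_polarBody hU).1 hx).1
    rw [mem_closedBall_zero_iff] at h2
    have h0 : ‖x‖ ≠ 0 := by linarith
    refine ⟨‖x‖⁻¹ • x, ?_, ?_⟩
    · simp [norm_smul, h0]
    · have : x - ‖x‖⁻¹ • x = (1 - ‖x‖⁻¹) • x := by rw [sub_smul, one_smul]
      have h3 : ‖x‖⁻¹ ≤ 1 := inv_le_one_of_one_le₀ h1
      rw [dist_eq_norm, this, norm_smul, Real.norm_of_nonneg (by linarith), sub_mul,
        inv_mul_cancel₀ h0]
      linarith

theorem mem_frontier_polarBody_and_norm_eq_one {U : Set EucPlane} (hU : U.Finite)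
    (hn : ∀ u ∈ U, ‖u‖ = 1) {z : EucPlane} :
    z ∈ frontier (polarBody U) ∧ ‖z‖ = 1 ↔ z ∈ U := by
  rw [mem_frontier_polarBody hU]
  constructor
  · rintro ⟨⟨-, u, hu, h⟩, hz⟩
    rw [inner_eq_one_iff_of_norm_eq_one (hn u hu) hz] at h
    exact h ▸ hu
  · intro hz
    refine ⟨⟨fun v hv => ?_, z, hz, by simp [hn z hz]⟩, hn z hz⟩
    have := real_inner_le_norm v z
    rwa [hn v hv, hn z hz, mul_one] at this

/-- The point of the unit circle at angle `t`. -/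
noncomputable def circlePoint (t : ℝ) : EucPlane := !₂[Real.cos t, Real.sin t]

theorem inner_circlePoint (s t : ℝ) : ⟪circlePoint s, circlePoint t⟫ = Real.cos (s - t) := by
  simp [circlePoint, PiLp.inner_apply, Fin.sum_univ_two, Real.cos_sub]
  ring

theorem norm_circlePoint (t : ℝ) : ‖circlePoint t‖ = 1 := by
  have h := inner_circlePoint t t
  rw [real_inner_self_eq_norm_sq, sub_self, Real.cos_zero] at h
  exact (pow_eq_one_iff_of_nonneg (norm_nonneg _) two_ne_zero).1 h

theorem exists_eq_norm_smul_circlePoint (z : EucPlane) :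
    ∃ t : ℝ, z = ‖z‖ • circlePoint t := by
  have hn : ‖(⟨z 0, z 1⟩ : ℂ)‖ = ‖z‖ := by
    rw [EuclideanSpace.norm_eq, Complex.norm_def, Complex.normSq_apply]
    simp [Fin.sum_univ_two, sq]
  refine ⟨Complex.arg ⟨z 0, z 1⟩, ?_⟩
  rw [← hn]
  ext i
  fin_cases i
  · simp [circlePoint, Complex.norm_mul_cos_arg]
  · simp [circlePoint, Complex.norm_mul_sin_arg]

/-- Rotation of the plane by the angle `a`. -/
noncomputable def planeRotation (a : ℝ) : EucPlane ≃ᵢ EucPlane where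
  toFun z := !₂[Real.cos a * z 0 - Real.sin a * z 1, Real.sin a * z 0 + Real.cos a * z 1]
  invFun z := !₂[Real.cos a * z 0 + Real.sin a * z 1, -Real.sin a * z 0 + Real.cos a * z 1]
  left_inv z := by
    ext i
    fin_cases i
    · simp
      linear_combination z 0 * Real.sin_sq_add_cos_sq a
    · simp
      linear_combination z 1 * Real.sin_sq_add_cos_sq a
  right_inv z := by
    ext i
    fin_cases i
    · simp
      linear_combination z 0 * Real.sin_sq_add_cos_sq a
    · simp
      linear_combination z 1 * Real.sin_sq_add_cos_sq a
  isometry_toFun := by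
    refine Isometry.of_dist_eq fun x y => ?_
    rw [EuclideanSpace.dist_eq, EuclideanSpace.dist_eq]
    congr 1
    simp [Fin.sum_univ_two, Real.dist_eq, sq_abs]
    linear_combination ((x 0 - y 0) ^ 2 + (x 1 - y 1) ^ 2) * Real.sin_sq_add_cos_sq a

theorem inner_circlePoint_planeRotation (a t : ℝ) (z : EucPlane) :
    ⟪circlePoint (t + a), planeRotation a z⟫ = ⟪circlePoint t, z⟫ := by
  simp [circlePoint, planeRotation, PiLp.inner_apply, Fin.sum_univ_two, Real.cos_add,
    Real.sin_add]
  linear_combination (z 0 * Real.cos t + z 1 * Real.sin t) * Real.sin_sq_add_cos_sq a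

theorem cos_int_mul_pi_div_le {n : ℕ} (hn : 0 < n) {j : ℤ} (hj : ¬ (2 * n : ℤ) ∣ j) :
    Real.cos (Real.pi * j / n) ≤ Real.cos (Real.pi / n) := by
  have hn' : (0 : ℝ) < n := by exact_mod_cast hn
  have hpi := Real.pi_pos
  have hr0 : 0 < j % (2 * n) :=
    lt_of_le_of_ne (Int.emod_nonneg _ (by omega)) fun h => hj (Int.dvd_of_emod_eq_zero h.symm)
  have hr1 : j % (2 * n) < 2 * n := Int.emod_lt_of_pos _ (by omega)
  have key : Real.cos (Real.pi * j / n) = Real.cos (Real.pi * (j % (2 * n) : ℤ) / n) := by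
    have : (j : ℝ) = (j % (2 * n) : ℤ) + 2 * n * (j / (2 * n) : ℤ) := by
      exact_mod_cast (Int.emod_add_mul_ediv j (2 * n)).symm
    rw [← Real.cos_add_int_mul_two_pi (Real.pi * (j % (2 * n) : ℤ) / n) (j / (2 * n))]
    congr 1
    rw [this]
    field_simp
  rw [key]
  set r := j % (2 * n)
  have hr0' : (1 : ℝ) ≤ r := by exact_mod_cast hr0
  have hr1' : (r : ℝ) + 1 ≤ 2 * n := by exact_mod_cast hr1
  rcases le_total (r : ℝ) n with h | h
  · apply Real.cos_le_cos_of_nonneg_of_le_pi (by positivity)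
    · rw [div_le_iff₀ hn']; nlinarith
    · gcongr; nlinarith
  · rw [← Real.cos_two_pi_sub (Real.pi * r / n)]
    apply Real.cos_le_cos_of_nonneg_of_le_pi (by positivity)
    · rw [sub_le_iff_le_add, ← sub_le_iff_le_add', le_div_iff₀ hn']; nlinarith
    · rw [le_sub_iff_add_le, ← add_div, div_le_iff₀ hn']; nlinarith

/-- The point `exp (π i k / (8 M))`, in real coordinates. -/
noncomputable def rootPoint (M : ℕ) (k : ℤ) : EucPlane :=
  circlePoint (Real.pi * k / ((8 * M : ℕ) : ℝ))

theorem norm_rootPoint (M : ℕ) (k : ℤ) : ‖rootPoint M k‖ = 1 := norm_circlePoint _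

theorem inner_rootPoint (M : ℕ) (k l : ℤ) :
    ⟪rootPoint M k, rootPoint M l⟫ = Real.cos (Real.pi * (k - l : ℤ) / ((8 * M : ℕ) : ℝ)) := by
  rw [rootPoint, rootPoint, inner_circlePoint]
  congr 1
  push_cast
  ring

theorem rootPoint_eq_of_dvd {M : ℕ} (hM : 0 < M) {k l : ℤ} (h : (16 * M : ℤ) ∣ k - l) :
    rootPoint M k = rootPoint M l := by
  obtain ⟨c, hc⟩ := h
  have h8 : (M : ℝ) ≠ 0 := by positivity
  have : Real.pi * k / ((8 * M : ℕ) : ℝ) = Real.pi * l / ((8 * M : ℕ) : ℝ) + c * (2 * Real.pi) := by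
    have : (k : ℝ) = l + 16 * M * c := by
      have : k = l + 16 * M * c := by linarith
      exact_mod_cast this
    rw [this]
    push_cast
    field_simp
    ring
  rw [rootPoint, rootPoint, this, circlePoint, circlePoint, Real.cos_add_int_mul_two_pi,
    Real.sin_add_int_mul_two_pi]

theorem inner_rootPoint_eq_iff {M : ℕ} (hM : 0 < M) {k l a b : ℤ} :
    ⟪rootPoint M k, rootPoint M l⟫ = ⟪rootPoint M a, rootPoint M b⟫ ↔
      (16 * M : ℤ) ∣ (k - l) - (a - b) ∨ (16 * M : ℤ) ∣ (k - l) + (a - b) := by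
  have h8 : (M : ℝ) ≠ 0 := by positivity
  have hpi := Real.pi_ne_zero
  rw [inner_rootPoint, inner_rootPoint, Real.cos_eq_cos_iff]
  have e1 : ∀ c : ℤ, Real.pi * (a - b : ℤ) / ((8 * M : ℕ) : ℝ) =
      2 * c * Real.pi + Real.pi * (k - l : ℤ) / ((8 * M : ℕ) : ℝ) ↔
      (k - l) - (a - b) = 16 * M * (-c) := by
    intro c
    rw [← @Int.cast_inj ℝ]
    push_cast
    field_simp
    constructor <;> intro h <;> linarith
  have e2 : ∀ c : ℤ, Real.pi * (a - b : ℤ) / ((8 * M : ℕ) : ℝ) =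
      2 * c * Real.pi - Real.pi * (k - l : ℤ) / ((8 * M : ℕ) : ℝ) ↔
      (k - l) + (a - b) = 16 * M * c := by
    intro c
    rw [← @Int.cast_inj ℝ]
    push_cast
    field_simp
    constructor <;> intro h <;> linarith
  simp only [e1, e2, dvd_def]
  constructor
  · rintro ⟨c, h | h⟩
    exacts [Or.inl ⟨_, h⟩, Or.inr ⟨_, h⟩]
  · rintro (⟨c, h⟩ | ⟨c, h⟩)
    exacts [⟨-c, Or.inl (by simpa using h)⟩, ⟨c, Or.inr h⟩]

/-- The odd-numbered points `exp (π i k / (8 M))`. -/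
def oddPoints (M : ℕ) : Set EucPlane := {z | ∃ k : ℤ, Odd k ∧ z = rootPoint M k}

/-- The eighth root of unity `exp (π i m / 4)`. -/
noncomputable def octPoint (M : ℕ) (m : ZMod 8) : EucPlane := rootPoint M (2 * M * m.val)

theorem octPoint_intCast {M : ℕ} (hM : 0 < M) (m : ℤ) :
    octPoint M (m : ZMod 8) = rootPoint M (2 * M * m) := by
  apply rootPoint_eq_of_dvd hM
  have : ((8 : ℕ) : ℤ) ∣ (m : ZMod 8).val - m := by
    rw [← ZMod.intCast_eq_intCast_iff_dvd_sub]
    simp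
  obtain ⟨c, hc⟩ := this
  exact ⟨c, by push_cast at hc; linear_combination (2 * M) * hc⟩

theorem norm_octPoint (M : ℕ) (i : ZMod 8) : ‖octPoint M i‖ = 1 := norm_circlePoint _

theorem inner_rootPoint_planeRotation {M : ℕ} (hM : 0 < M) (k : ℤ) (z : EucPlane) :
    ⟪rootPoint M (k + 2 * M), planeRotation (Real.pi / 4) z⟫ = ⟪rootPoint M k, z⟫ := by
  rw [rootPoint, rootPoint,
    ← inner_circlePoint_planeRotation (Real.pi / 4) (Real.pi * k / ((8 * M : ℕ) : ℝ)) z]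
  congr 2
  have h8 : (M : ℝ) ≠ 0 := by positivity
  push_cast
  field_simp
  ring

theorem inner_octPoint_planeRotation {M : ℕ} (hM : 0 < M) (i : ZMod 8) (z : EucPlane) :
    ⟪octPoint M (i + 1), planeRotation (Real.pi / 4) z⟫ = ⟪octPoint M i, z⟫ := by
  have h : octPoint M (i + 1) = rootPoint M (2 * M * i.val + 2 * M) := by
    have := octPoint_intCast hM (i.val + 1)
    simpa [mul_add] using this
  rw [h, inner_rootPoint_planeRotation hM, octPoint]

theorem inner_octPoint_eq_iff {M : ℕ} (hM : 0 < M) {i j a b : ZMod 8} :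
    ⟪octPoint M i, octPoint M j⟫ = ⟪octPoint M a, octPoint M b⟫ ↔
      i - j = a - b ∨ i - j = -(a - b) := by
  rw [octPoint, octPoint, octPoint, octPoint, inner_rootPoint_eq_iff hM]
  have hz : (2 * M : ℤ) ≠ 0 := by positivity
  have e1 : (16 * M : ℤ) = 2 * M * (8 : ℕ) := by push_cast; ring
  have e2 : (2 * M * i.val - 2 * M * j.val : ℤ) - (2 * M * a.val - 2 * M * b.val) =
      2 * M * ((i.val - j.val) - (a.val - b.val)) := by ring
  have e3 : (2 * M * i.val - 2 * M * j.val : ℤ) + (2 * M * a.val - 2 * M * b.val) =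
      2 * M * ((i.val - j.val) + (a.val - b.val)) := by ring
  rw [e2, e3, e1, mul_dvd_mul_iff_left hz, mul_dvd_mul_iff_left hz,
    ← ZMod.intCast_zmod_eq_zero_iff_dvd, ← ZMod.intCast_zmod_eq_zero_iff_dvd]
  simp [sub_eq_zero, add_eq_zero_iff_eq_neg]

/-- The normals of the polygon obtained from a regular `8 M`-gon by cutting the corners in the
directions of the eighth roots of unity with index in `I`. -/
def normals (M : ℕ) (I : Finset (ZMod 8)) : Set EucPlane := oddPoints M ∪ octPoint M '' I

theorem exists_eq_rootPoint_of_mem_normals {M : ℕ} {I : Finset (ZMod 8)} {z : EucPlane}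
    (hz : z ∈ normals M I) : ∃ k, z = rootPoint M k := by
  rcases hz with ⟨k, -, h⟩ | ⟨i, -, h⟩
  exacts [⟨k, h⟩, ⟨_, h.symm⟩]

theorem norm_of_mem_normals {M : ℕ} {I : Finset (ZMod 8)} : ∀ z ∈ normals M I, ‖z‖ = 1 := by
  intro z hz
  obtain ⟨k, rfl⟩ := exists_eq_rootPoint_of_mem_normals hz
  exact norm_rootPoint M k

theorem finite_normals {M : ℕ} (hM : 0 < M) (I : Finset (ZMod 8)) : (normals M I).Finite := by
  apply ((Set.finite_Ico (0 : ℤ) (16 * M)).image (rootPoint M)).subset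
  intro z hz
  obtain ⟨k, rfl⟩ := exists_eq_rootPoint_of_mem_normals hz
  refine ⟨k % (16 * M), ⟨Int.emod_nonneg _ (by omega), Int.emod_lt_of_pos _ (by omega)⟩, ?_⟩
  apply rootPoint_eq_of_dvd hM
  exact ⟨-(k / (16 * M)), by rw [Int.emod_def]; ring⟩

theorem cos_pi_div_pos {M : ℕ} (hM : 0 < M) : 0 < Real.cos (Real.pi / ((8 * M : ℕ) : ℝ)) := by
  have h : (1 : ℝ) ≤ M := by exact_mod_cast hM
  apply Real.cos_pos_of_mem_Ioo
  have := Real.pi_pos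
  constructor
  · have : 0 < Real.pi / ((8 * M : ℕ) : ℝ) := by positivity
    linarith
  · push_cast
    rw [div_lt_div_iff₀ (by positivity) (by norm_num)]
    nlinarith

theorem polarBody_normals_subset {M : ℕ} (hM : 0 < M) (I : Finset (ZMod 8)) :
    polarBody (normals M I) ⊆ closedBall 0 (Real.cos (Real.pi / ((8 * M : ℕ) : ℝ)))⁻¹ := by
  intro z hz
  rw [mem_closedBall_zero_iff]
  have hpi := Real.pi_pos
  have hM' : (0 : ℝ) < M := by exact_mod_cast hM
  have hN : (0 : ℝ) < ((8 * M : ℕ) : ℝ) := by positivity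
  obtain ⟨t, ht⟩ := exists_eq_norm_smul_circlePoint z
  set N : ℝ := ((8 * M : ℕ) : ℝ) with hNdef
  set f := ⌊t * N / (2 * Real.pi)⌋
  have h1 : (f : ℝ) * (2 * Real.pi) ≤ t * N := by
    rw [← le_div_iff₀ (by positivity)]; exact Int.floor_le _
  have h2 : t * N < (f + 1) * (2 * Real.pi) := by
    rw [← div_lt_iff₀ (by positivity)]; exact Int.lt_floor_add_one _
  have h := hz (rootPoint M (2 * f + 1)) (Or.inl ⟨_, ⟨f, rfl⟩, rfl⟩)
  rw [ht, real_inner_smul_right, rootPoint, inner_circlePoint, ← hNdef] at h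
  have hc : Real.cos (Real.pi / N) ≤ Real.cos (Real.pi * (2 * f + 1 : ℤ) / N - t) := by
    rw [← Real.cos_abs (_ - t)]
    apply Real.cos_le_cos_of_nonneg_of_le_pi (abs_nonneg _)
    · rw [div_le_iff₀ hN]
      have : (1 : ℝ) ≤ M := by exact_mod_cast hM
      rw [hNdef]; push_cast; nlinarith
    · have : Real.pi * (2 * f + 1 : ℤ) / N - t = (Real.pi * (2 * f + 1) - t * N) / N := by
        push_cast; field_simp
      rw [this, abs_div, abs_of_pos hN]
      gcongr
      rw [abs_le]; constructor <;> linarith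
  rw [← one_div, le_div_iff₀ (cos_pi_div_pos hM)]
  exact (mul_le_mul_of_nonneg_left hc (norm_nonneg z)).trans h

/-- The boundary of the truncated regular polygon with normals `normals M I`. -/
def truncatedPolygon (M : ℕ) (I : Finset (ZMod 8)) : Set EucPlane :=
  frontier (polarBody (normals M I))

theorem mem_truncatedPolygon {M : ℕ} (hM : 0 < M) {I : Finset (ZMod 8)} {z : EucPlane} :
    z ∈ truncatedPolygon M I ↔
      ((∀ u ∈ oddPoints M, ⟪u, z⟫ ≤ 1) ∧ ∀ i ∈ I, ⟪octPoint M i, z⟫ ≤ 1) ∧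
        ((∃ u ∈ oddPoints M, ⟪u, z⟫ = 1) ∨ ∃ i ∈ I, ⟪octPoint M i, z⟫ = 1) := by
  rw [truncatedPolygon, mem_frontier_polarBody (finite_normals hM I)]
  simp [polarBody, normals, or_imp, forall_and, or_and_right, exists_or]

theorem inner_octPoint_le {M : ℕ} (hM : 0 < M) {i j : ZMod 8} (hij : i ≠ j) :
    ⟪octPoint M i, octPoint M j⟫ ≤ √2 / 2 := by
  have hd : ¬ (2 * (4 : ℕ) : ℤ) ∣ (i.val - j.val : ℤ) := by
    intro h
    have h' : (((8 : ℕ) : ℤ)) ∣ (i.val - j.val : ℤ) := by simpa using h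
    rw [← ZMod.intCast_zmod_eq_zero_iff_dvd] at h'
    simp [sub_eq_zero] at h'
    exact hij h'
  have h := cos_int_mul_pi_div_le (n := 4) (by norm_num) hd
  rw [octPoint, octPoint, inner_rootPoint]
  have h8 : (M : ℝ) ≠ 0 := by positivity
  have e : Real.pi * (2 * M * i.val - 2 * M * j.val : ℤ) / ((8 * M : ℕ) : ℝ) =
      Real.pi * (i.val - j.val : ℤ) / (4 : ℕ) := by
    push_cast
    field_simp
    ring
  rw [e]
  refine h.trans_eq ?_
  norm_num

theorem inner_octPoint_lt_one {M : ℕ} (hM : 0 < M)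
    (hc : 20 / 21 ≤ Real.cos (Real.pi / ((8 * M : ℕ) : ℝ))) {z : EucPlane}
    (hz : ∀ u ∈ oddPoints M, ⟪u, z⟫ ≤ 1) {i j : ZMod 8} (hij : i ≠ j)
    (hi : 1 ≤ ⟪octPoint M i, z⟫) : ⟪octPoint M j, z⟫ < 1 := by
  by_contra! hj
  have hzR : ‖z‖ ≤ (Real.cos (Real.pi / ((8 * M : ℕ) : ℝ)))⁻¹ := by
    rw [← mem_closedBall_zero_iff]
    apply polarBody_normals_subset hM ∅
    intro u hu
    simp only [normals, Finset.coe_empty, Set.image_empty, Set.union_empty] at hu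
    exact hz u hu
  have hzR' : ‖z‖ ≤ 21 / 20 := hzR.trans (by
    rw [inv_le_comm₀ (by linarith) (by norm_num)]; linarith)
  have h1 : 2 ≤ ⟪octPoint M i + octPoint M j, z⟫ := by rw [inner_add_left]; linarith
  have h2 := real_inner_le_norm (octPoint M i + octPoint M j) z
  have h3 : ‖octPoint M i + octPoint M j‖ ^ 2 ≤ 2 + √2 := by
    rw [norm_add_sq_real, norm_octPoint, norm_octPoint]
    linarith [inner_octPoint_le hM hij]
  have h4 : √2 < 3 / 2 := by
    rw [Real.sqrt_lt' (by norm_num)]; norm_num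
  have h5 : (2 : ℝ) ≤ ‖octPoint M i + octPoint M j‖ * (21 / 20) :=
    (h1.trans h2).trans (mul_le_mul_of_nonneg_left hzR' (norm_nonneg _))
  nlinarith [norm_nonneg (octPoint M i + octPoint M j)]

/-- The half-plane beyond the cut in direction `i`. -/
def cutRegion (M : ℕ) (i : ZMod 8) : Set EucPlane := {z | 1 ≤ ⟪octPoint M i, z⟫}

theorem isClosed_cutRegion (M : ℕ) (i : ZMod 8) : IsClosed (cutRegion M i) :=
  isClosed_le continuous_const (by fun_prop)

/-- The polygon with no corner cut, or with all eight corners cut. -/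
def uniformPolygon (M : ℕ) (c : Bool) : Set EucPlane :=
  truncatedPolygon M (if c then Finset.univ else ∅)

theorem isClosed_truncatedPolygon (M : ℕ) (I : Finset (ZMod 8)) :
    IsClosed (truncatedPolygon M I) := isClosed_frontier

theorem truncatedPolygon_inter_cutRegion {M : ℕ} (hM : 0 < M)
    (hc : 20 / 21 ≤ Real.cos (Real.pi / ((8 * M : ℕ) : ℝ))) (I : Finset (ZMod 8)) (i : ZMod 8) :
    truncatedPolygon M I ∩ cutRegion M i =
      uniformPolygon M (decide (i ∈ I)) ∩ cutRegion M i := by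
  ext z
  simp only [Set.mem_inter_iff, cutRegion, Set.mem_ofPred_eq, and_congr_left_iff, uniformPolygon]
  intro hi
  rw [mem_truncatedPolygon hM, mem_truncatedPolygon hM, and_assoc, and_assoc]
  refine and_congr_right fun hz => ?_
  have hlt : ∀ j, j ≠ i → ⟪octPoint M j, z⟫ < 1 := fun j hj =>
    inner_octPoint_lt_one hM hc hz hj.symm hi
  by_cases hI : i ∈ I
  · have key : ∀ J : Finset (ZMod 8), i ∈ J →
        (((∀ j ∈ J, ⟪octPoint M j, z⟫ ≤ 1) ∧
        ((∃ u ∈ oddPoints M, ⟪u, z⟫ = 1) ∨ ∃ j ∈ J, ⟪octPoint M j, z⟫ = 1)) ↔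
          ⟪octPoint M i, z⟫ = 1) := by
      intro J hJ
      constructor
      · exact fun h => le_antisymm (h.1 i hJ) hi
      · refine fun h => ⟨fun j _ => ?_, Or.inr ⟨i, hJ, h⟩⟩
        rcases eq_or_ne j i with rfl | hj
        exacts [h.le, (hlt j hj).le]
    rw [key I hI, key _ (by simp [hI])]
  · have key : ∀ J : Finset (ZMod 8), i ∉ J →
        (((∀ j ∈ J, ⟪octPoint M j, z⟫ ≤ 1) ∧
        ((∃ u ∈ oddPoints M, ⟪u, z⟫ = 1) ∨ ∃ j ∈ J, ⟪octPoint M j, z⟫ = 1)) ↔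
          ∃ u ∈ oddPoints M, ⟪u, z⟫ = 1) := by
      intro J hJ
      have hJ' : ∀ j ∈ J, ⟪octPoint M j, z⟫ < 1 := fun j hj =>
        hlt j fun h => hJ (h ▸ hj)
      constructor
      · rintro ⟨-, h | ⟨j, hj, h⟩⟩
        exacts [h, absurd h (hJ' j hj).ne]
      · exact fun h => ⟨fun j hj => (hJ' j hj).le, Or.inl h⟩
    rw [key I hI, key _ (by simp [hI])]

theorem truncatedPolygon_diff_cutRegion {M : ℕ} (hM : 0 < M) (I : Finset (ZMod 8)) :
    truncatedPolygon M I \ ⋃ i, cutRegion M i =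
      uniformPolygon M false \ ⋃ i, cutRegion M i := by
  ext z
  simp only [Set.mem_sdiff, cutRegion, Set.mem_iUnion, Set.mem_ofPred_eq, not_exists, not_le,
    and_congr_left_iff, uniformPolygon, mem_truncatedPolygon hM]
  intro h
  have h1 : ∀ i ∈ I, ⟪octPoint M i, z⟫ ≤ 1 := fun i _ => (h i).le
  have h2 : ¬ ∃ i ∈ I, ⟪octPoint M i, z⟫ = 1 := by
    rintro ⟨i, -, hi⟩
    exact (h i).ne hi
  simp only [Bool.false_eq_true, if_false, Finset.notMem_empty, false_and,
    exists_false, false_imp_iff, implies_true]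
  exact ⟨fun h => ⟨⟨h.1.1, trivial⟩, Or.inl (h.2.resolve_right h2)⟩,
      fun h => ⟨⟨h.1.1, h1⟩, Or.inl (h.2.resolve_right id)⟩⟩

/-- Arclength on the part of a uniform polygon lying in the `i`-th cut region, together with an
eighth of arclength on the part lying outside all cut regions. -/
noncomputable def sectorMeasure (M : ℕ) (c : Bool) (i : ZMod 8) : Measure EucPlane :=
  (Measure.hausdorffMeasure 1 : Measure EucPlane).restrict
      (uniformPolygon M c ∩ cutRegion M i) +
    (8⁻¹ : ℝ≥0∞) • (Measure.hausdorffMeasure 1 : Measure EucPlane).restrict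
      (uniformPolygon M false \ ⋃ i, cutRegion M i)

theorem restrict_truncatedPolygon {M : ℕ} (hM : 0 < M)
    (hc : 20 / 21 ≤ Real.cos (Real.pi / ((8 * M : ℕ) : ℝ))) (I : Finset (ZMod 8)) :
    (Measure.hausdorffMeasure 1 : Measure EucPlane).restrict (truncatedPolygon M I) =
      ∑ i, sectorMeasure M (decide (i ∈ I)) i := by
  have hmeas : MeasurableSet (⋃ i, cutRegion M i) :=
    MeasurableSet.iUnion fun i => (isClosed_cutRegion M i).measurableSet
  have h8 : ∀ μ : Measure EucPlane, ∑ _i : ZMod 8, (8⁻¹ : ℝ≥0∞) • μ = μ := by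
    intro μ
    rw [Finset.sum_const, Finset.card_univ, ZMod.card, ← Nat.cast_smul_eq_nsmul ℝ≥0∞, smul_smul]
    push_cast
    rw [ENNReal.mul_inv_cancel (by norm_num) (by norm_num), one_smul]
  rw [← Measure.restrict_inter_add_sdiff _ hmeas, truncatedPolygon_diff_cutRegion hM]
  simp only [sectorMeasure, Finset.sum_add_distrib, h8]
  congr 1
  rw [Set.inter_iUnion, Measure.restrict_iUnion, Measure.sum_fintype]
  · simp only [truncatedPolygon_inter_cutRegion hM hc]
  · intro i j hij
    refine Set.disjoint_left.2 fun z hz hz' => ?_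
    have := inner_octPoint_lt_one hM hc ((mem_truncatedPolygon hM).1 hz.1).1.1 hij hz.2
    exact absurd hz'.2 this.not_ge
  · exact fun i => ((isClosed_truncatedPolygon M I).inter (isClosed_cutRegion M i)).measurableSet

theorem hausdorffMeasure_truncatedPolygon_lt_top {M : ℕ} (hM : 0 < M) (I : Finset (ZMod 8)) :
    (Measure.hausdorffMeasure 1 : Measure EucPlane) (truncatedPolygon M I) < ⊤ :=
  hausdorffMeasure_frontier_polarBody_lt_top (finite_normals hM I) norm_of_mem_normals
    (polarBody_normals_subset hM I)

theorem isFiniteMeasure_sectorMeasure {M : ℕ} (hM : 0 < M) (c : Bool) (i : ZMod 8) :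
    IsFiniteMeasure (sectorMeasure M c i) := by
  have h1 : IsFiniteMeasure ((Measure.hausdorffMeasure 1 : Measure EucPlane).restrict
      (uniformPolygon M c ∩ cutRegion M i)) :=
    isFiniteMeasure_restrict.2 ((measure_mono Set.inter_subset_left).trans_lt
      (hausdorffMeasure_truncatedPolygon_lt_top hM _)).ne
  have h2 : IsFiniteMeasure ((Measure.hausdorffMeasure 1 : Measure EucPlane).restrict
      (uniformPolygon M false \ ⋃ i, cutRegion M i)) :=
    isFiniteMeasure_restrict.2 ((measure_mono Set.sdiff_subset).trans_lt
      (hausdorffMeasure_truncatedPolygon_lt_top hM _)).ne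
  have h3 := Measure.smul_finite ((Measure.hausdorffMeasure 1 : Measure EucPlane).restrict
      (uniformPolygon M false \ ⋃ i, cutRegion M i)) (c := 8⁻¹) (by simp)
  rw [sectorMeasure]
  infer_instance

theorem forall_oddPoints_planeRotation {M : ℕ} (hM : 0 < M) (z : EucPlane) (p : ℝ → Prop) :
    (∀ u ∈ oddPoints M, p ⟪u, planeRotation (Real.pi / 4) z⟫) ↔ ∀ u ∈ oddPoints M, p ⟪u, z⟫ := by
  constructor
  · rintro h _ ⟨k, hk, rfl⟩
    rw [← inner_rootPoint_planeRotation hM]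
    exact h _ ⟨_, hk.add_even (even_two_mul _), rfl⟩
  · rintro h _ ⟨k, hk, rfl⟩
    have := inner_rootPoint_planeRotation hM (k - 2 * M) z
    rw [sub_add_cancel] at this
    rw [this]
    exact h _ ⟨_, hk.sub_even (even_two_mul _), rfl⟩

theorem forall_octPoint_planeRotation {M : ℕ} (hM : 0 < M) (z : EucPlane) (p : ℝ → Prop) :
    (∀ i, p ⟪octPoint M i, planeRotation (Real.pi / 4) z⟫) ↔ ∀ i, p ⟪octPoint M i, z⟫ := by
  rw [← (Equiv.addRight (1 : ZMod 8)).forall_congr_right]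
  simp [inner_octPoint_planeRotation hM]

theorem planeRotation_mem_uniformPolygon {M : ℕ} (hM : 0 < M) (c : Bool) (z : EucPlane) :
    planeRotation (Real.pi / 4) z ∈ uniformPolygon M c ↔ z ∈ uniformPolygon M c := by
  have h1 := forall_oddPoints_planeRotation hM z (· ≤ 1)
  have h2 := not_congr (forall_oddPoints_planeRotation hM z (· ≠ 1))
  have h3 := forall_octPoint_planeRotation hM z (· ≤ 1)
  have h4 := not_congr (forall_octPoint_planeRotation hM z (· ≠ 1))
  push Not at h2 h4
  cases c <;> simp [uniformPolygon, mem_truncatedPolygon hM, h1, h2, h3, h4]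

theorem measurePreserving_planeRotation_sectorMeasure {M : ℕ} (hM : 0 < M) (c : Bool)
    (i : ZMod 8) : MeasurePreserving (planeRotation (Real.pi / 4)) (sectorMeasure M c i)
      (sectorMeasure M c (i + 1)) := by
  have hemb := (planeRotation (Real.pi / 4)).toHomeomorph.measurableEmbedding
  have hmp := (planeRotation (Real.pi / 4)).measurePreserving_hausdorffMeasure 1
  have e1 : planeRotation (Real.pi / 4) ⁻¹' (uniformPolygon M c ∩ cutRegion M (i + 1)) =
      uniformPolygon M c ∩ cutRegion M i := by
    ext z
    simp [planeRotation_mem_uniformPolygon hM, cutRegion, inner_octPoint_planeRotation hM]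
  have e2 : planeRotation (Real.pi / 4) ⁻¹' (uniformPolygon M false \ ⋃ i, cutRegion M i) =
      uniformPolygon M false \ ⋃ i, cutRegion M i := by
    ext z
    have := forall_octPoint_planeRotation hM z (· < 1)
    simp [planeRotation_mem_uniformPolygon hM, cutRegion, this]
  have m1 := hmp.restrict_preimage_emb hemb (uniformPolygon M c ∩ cutRegion M (i + 1))
  have m2 := hmp.restrict_preimage_emb hemb (uniformPolygon M false \ ⋃ i, cutRegion M i)
  rw [e1] at m1
  rw [e2] at m2
  refine ⟨hmp.measurable, ?_⟩
  rw [sectorMeasure, sectorMeasure, Measure.map_add _ _ hmp.measurable, Measure.map_smul, m1.map_eq,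
    m2.map_eq]

/-- The mass of pairs of points at distance at most `r`, for two sector measures. -/
noncomputable def sectorDistrib (M : ℕ) (r : ℝ) (a b : Bool) (i j : ZMod 8) : ℝ≥0∞ :=
  ((sectorMeasure M a i).prod (sectorMeasure M b j))
    {z : EucPlane × EucPlane | dist z.1 z.2 ≤ r}

theorem sectorDistrib_add_one {M : ℕ} (hM : 0 < M) (r : ℝ) (a b : Bool) (i j : ZMod 8) :
    sectorDistrib M r a b (i + 1) (j + 1) = sectorDistrib M r a b i j := by
  have := isFiniteMeasure_sectorMeasure hM
  have hset : MeasurableSet {z : EucPlane × EucPlane | dist z.1 z.2 ≤ r} :=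
    (isClosed_le continuous_dist continuous_const).measurableSet
  have := ((measurePreserving_planeRotation_sectorMeasure hM a i).prod
    (measurePreserving_planeRotation_sectorMeasure hM b j)).measure_preimage hset.nullMeasurableSet
  rw [sectorDistrib, ← this, sectorDistrib]
  congr 1
  ext z
  simp [IsometryEquiv.dist_eq]

theorem sectorDistrib_eq {M : ℕ} (hM : 0 < M) (r : ℝ) (a b : Bool) (i j : ZMod 8) :
    sectorDistrib M r a b i j = sectorDistrib M r a b 0 (j - i) := by
  have key : ∀ n : ℕ, sectorDistrib M r a b n (j - i + n) = sectorDistrib M r a b 0 (j - i) := by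
    intro n
    induction n with
    | zero => simp
    | succ n ih =>
      push_cast
      rw [← add_assoc, sectorDistrib_add_one hM, ih]
  have := key i.val
  simpa using this

theorem sectorMeasure_univ_eq {M : ℕ} (hM : 0 < M) (c : Bool) (i : ZMod 8) :
    sectorMeasure M c i Set.univ = sectorMeasure M c 0 Set.univ := by
  have key : ∀ n : ℕ, sectorMeasure M c n Set.univ = sectorMeasure M c 0 Set.univ := by
    intro n
    induction n with
    | zero => simp
    | succ n ih =>
      rw [← ih]
      push_cast
      rw [← (measurePreserving_planeRotation_sectorMeasure hM c n).measure_preimage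
        MeasurableSet.univ.nullMeasurableSet, Set.preimage_univ]
  simpa using key i.val

theorem hausdorffMeasure_truncatedPolygon {M : ℕ} (hM : 0 < M)
    (hc : 20 / 21 ≤ Real.cos (Real.pi / ((8 * M : ℕ) : ℝ))) (I : Finset (ZMod 8)) :
    (Measure.hausdorffMeasure 1 : Measure EucPlane) (truncatedPolygon M I) =
      ∑ i, sectorMeasure M (decide (i ∈ I)) 0 Set.univ := by
  rw [← Measure.restrict_apply_univ, restrict_truncatedPolygon hM hc, Measure.finsetSum_apply]
  exact Finset.sum_congr rfl fun i _ => sectorMeasure_univ_eq hM _ i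

theorem curveGlobalDistrib_truncatedPolygon {M : ℕ} (hM : 0 < M)
    (hc : 20 / 21 ≤ Real.cos (Real.pi / ((8 * M : ℕ) : ℝ))) (I : Finset (ZMod 8)) (r : ℝ) :
    curveGlobalDistrib (truncatedPolygon M I) r =
      (∑ i, sectorMeasure M (decide (i ∈ I)) 0 Set.univ)⁻¹ *
        ((∑ i, sectorMeasure M (decide (i ∈ I)) 0 Set.univ)⁻¹ *
          ∑ k, ∑ i, sectorDistrib M r (decide (i ∈ I)) (decide (i + k ∈ I)) 0 k) := by
  have := isFiniteMeasure_sectorMeasure hM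
  have hfin : IsFiniteMeasure (∑ i, sectorMeasure M (decide (i ∈ I)) i) := by
    rw [← restrict_truncatedPolygon hM hc]
    exact isFiniteMeasure_restrict.2 (hausdorffMeasure_truncatedPolygon_lt_top hM I).ne
  rw [curveGlobalDistrib, curveMeasure, hausdorffMeasure_truncatedPolygon hM hc,
    restrict_truncatedPolygon hM hc, Measure.prod_smul_right, Measure.prod_smul_left,
    Measure.smul_apply, Measure.smul_apply, smul_eq_mul, smul_eq_mul]
  congr 2
  rw [← Measure.sum_fintype, Measure.prod_sum, Measure.sum_fintype, Measure.finsetSum_apply,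
    Fintype.sum_prod_type]
  conv_rhs => rw [Finset.sum_comm]
  refine Finset.sum_congr rfl fun i _ => ?_
  rw [← Equiv.sum_comp (Equiv.addLeft i)]
  refine Finset.sum_congr rfl fun k _ => ?_
  change sectorDistrib M r _ _ i (i + k) = _
  rw [sectorDistrib_eq hM, add_sub_cancel_left]
  rfl

/-- The sets `{0, 1, 3, 4}` and `{0, 1, 2, 5}` are homometric in `ℤ / 8`. -/
theorem sum_mem_homometric (f : Bool → Bool → ℝ≥0∞) (k : ZMod 8) :
    ∑ i : ZMod 8, f (decide (i ∈ ({0, 1, 3, 4} : Finset (ZMod 8))))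
        (decide (i + k ∈ ({0, 1, 3, 4} : Finset (ZMod 8)))) =
      ∑ i : ZMod 8, f (decide (i ∈ ({0, 1, 2, 5} : Finset (ZMod 8))))
        (decide (i + k ∈ ({0, 1, 2, 5} : Finset (ZMod 8)))) := by
  have key : ∀ k : ZMod 8, (Finset.univ : Finset (ZMod 8)).val.map (fun i =>
        (decide (i ∈ ({0, 1, 3, 4} : Finset (ZMod 8))),
          decide (i + k ∈ ({0, 1, 3, 4} : Finset (ZMod 8))))) =
      (Finset.univ : Finset (ZMod 8)).val.map (fun i =>
        (decide (i ∈ ({0, 1, 2, 5} : Finset (ZMod 8))),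
          decide (i + k ∈ ({0, 1, 2, 5} : Finset (ZMod 8))))) := by
    decide
  have h := congrArg (fun m => (m.map fun p : Bool × Bool => f p.1 p.2).sum) (key k)
  simp only [Multiset.map_map, Function.comp_def] at h
  exact h

theorem curveGlobalDistrib_homometric {M : ℕ} (hM : 0 < M)
    (hc : 20 / 21 ≤ Real.cos (Real.pi / ((8 * M : ℕ) : ℝ))) (r : ℝ) :
    curveGlobalDistrib (truncatedPolygon M {0, 1, 3, 4}) r =
      curveGlobalDistrib (truncatedPolygon M {0, 1, 2, 5}) r := by
  rw [curveGlobalDistrib_truncatedPolygon hM hc, curveGlobalDistrib_truncatedPolygon hM hc,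
    sum_mem_homometric (fun a _ => sectorMeasure M a 0 Set.univ) 0,
    Finset.sum_congr rfl fun k _ =>
      sum_mem_homometric (fun a b => sectorDistrib M r a b 0 k) k]

/-- No distance-preserving map sends `{0, 1, 3, 4}` into `{0, 1, 2, 5}` in `ℤ / 8`. -/
theorem not_exists_isometry_homometric :
    ¬ ∃ f : ZMod 8 → ZMod 8, (∀ i ∈ ({0, 1, 3, 4} : Finset (ZMod 8)),
        f i ∈ ({0, 1, 2, 5} : Finset (ZMod 8))) ∧
      ∀ i ∈ ({0, 1, 3, 4} : Finset (ZMod 8)), ∀ j ∈ ({0, 1, 3, 4} : Finset (ZMod 8)),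
        f i - f j = i - j ∨ f i - f j = -(i - j) := by
  rintro ⟨f, hf, hd⟩
  have key : ∀ a ∈ ({0, 1, 2, 5} : Finset (ZMod 8)), ∀ b ∈ ({0, 1, 2, 5} : Finset (ZMod 8)),
      ∀ c ∈ ({0, 1, 2, 5} : Finset (ZMod 8)), ∀ d ∈ ({0, 1, 2, 5} : Finset (ZMod 8)),
      ¬ ((a - d = 0 - 4 ∨ a - d = -(0 - 4)) ∧ (a - b = 0 - 1 ∨ a - b = -(0 - 1)) ∧
        (c - d = 3 - 4 ∨ c - d = -(3 - 4))) := by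
    decide
  exact key _ (hf 0 (by decide)) _ (hf 1 (by decide)) _ (hf 3 (by decide)) _ (hf 4 (by decide))
    ⟨hd _ (by decide) _ (by decide), hd _ (by decide) _ (by decide),
      hd _ (by decide) _ (by decide)⟩

theorem smul_rootPoint_mem_truncatedPolygon {M : ℕ} (hM : 3 ≤ M) (I : Finset (ZMod 8)) {k : ℤ}
    (hk : Even k) (hkM : ¬ (2 * M : ℤ) ∣ k) :
    (Real.cos (Real.pi / ((8 * M : ℕ) : ℝ)))⁻¹ • rootPoint M k ∈ truncatedPolygon M I := by
  have hM0 : 0 < M := by omega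
  have hc := cos_pi_div_pos hM0
  have hle : ∀ l : ℤ, ¬ (16 * M : ℤ) ∣ l - k →
      ⟪rootPoint M l, (Real.cos (Real.pi / ((8 * M : ℕ) : ℝ)))⁻¹ • rootPoint M k⟫ ≤ 1 := by
    intro l hl
    rw [real_inner_smul_right, inner_rootPoint, inv_mul_le_iff₀ hc, mul_one]
    apply cos_int_mul_pi_div_le (by omega)
    convert hl using 1
    push_cast
    ring_nf
  rw [mem_truncatedPolygon hM0]
  refine ⟨⟨?_, fun i _ => hle _ fun h => hkM ?_⟩, Or.inl ⟨_, ⟨k + 1, hk.add_one, rfl⟩, ?_⟩⟩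
  · rintro _ ⟨l, hl, rfl⟩
    refine hle l fun h => ?_
    have : (2 : ℤ) ∣ l - k := dvd_trans ⟨8 * M, by ring⟩ h
    have h2 := hl.sub_even hk
    rw [← Int.not_even_iff_odd] at h2
    exact h2 (even_iff_two_dvd.2 this)
  · have h1 : (2 * M : ℤ) ∣ 2 * M * i.val - k := dvd_trans ⟨8, by ring⟩ h
    exact (dvd_sub_right (dvd_mul_right _ _)).1 h1
  · rw [real_inner_smul_right, inner_rootPoint]
    rw [add_sub_cancel_left, Int.cast_one, mul_one, inv_mul_cancel₀ hc.ne']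

theorem rootPoint_add_half {M : ℕ} (hM : 0 < M) (k : ℤ) :
    rootPoint M (k + 8 * M) = -rootPoint M k := by
  have h : ⟪rootPoint M k, rootPoint M (k + 8 * M)⟫ = -1 := by
    rw [inner_rootPoint]
    have h8 : (M : ℝ) ≠ 0 := by positivity
    have : Real.pi * (k - (k + 8 * M) : ℤ) / ((8 * M : ℕ) : ℝ) = -Real.pi := by
      push_cast
      field_simp
      ring
    rw [this, Real.cos_neg, Real.cos_pi]
  rw [inner_eq_neg_one_iff_of_norm_eq_one (norm_rootPoint _ _) (norm_rootPoint _ _)] at h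
  rw [h, neg_neg]

/-- An isometry sending two antipodal points of a centred sphere into the closed ball bounded by
that sphere fixes the centre. -/
theorem isometry_map_zero {E : Type*} [NormedAddCommGroup E] [InnerProductSpace ℝ E] {T : E → E}
    (hT : Isometry T) {R : ℝ} {v : E} (hv : ‖v‖ = R) (h1 : ‖T v‖ ≤ R) (h2 : ‖T (-v)‖ ≤ R) :
    T 0 = 0 := by
  have hR : 0 ≤ R := hv ▸ norm_nonneg v
  have d1 : ‖T v - T (-v)‖ = 2 * R := by
    rw [← dist_eq_norm, hT.dist_eq, dist_eq_norm, sub_neg_eq_add, ← two_smul ℝ, norm_smul, hv]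
    simp
  have d2 : ‖T 0 - T v‖ = R := by
    rw [← dist_eq_norm, hT.dist_eq, dist_zero_left, hv]
  have d3 : ‖T 0 - T (-v)‖ = R := by
    rw [← dist_eq_norm, hT.dist_eq, dist_zero_left, norm_neg, hv]
  have p1 := parallelogram_law_with_norm ℝ (T v) (T (-v))
  have hs : T v + T (-v) = 0 := by
    rw [← norm_eq_zero]
    rw [d1] at p1
    nlinarith [norm_nonneg (T v), norm_nonneg (T (-v)), norm_nonneg (T v + T (-v))]
  have hs' : T (-v) = -T v := (neg_eq_of_add_eq_zero_right hs).symm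
  rw [hs', sub_neg_eq_add] at d3
  rw [hs', sub_neg_eq_add, ← two_smul ℝ, norm_smul] at d1
  have hTv : ‖T v‖ = R := by simpa using d1
  have p2 := parallelogram_law_with_norm ℝ (T 0) (T v)
  rw [d2, d3, hTv] at p2
  rw [← norm_eq_zero]
  nlinarith [norm_nonneg (T 0)]

theorem isometry_inner_eq {E : Type*} [NormedAddCommGroup E] [InnerProductSpace ℝ E] {T : E → E}
    (hT : Isometry T) (h0 : T 0 = 0) (x y : E) : ⟪T x, T y⟫ = ⟪x, y⟫ := by
  have hn : ∀ x, ‖T x‖ = ‖x‖ := fun x => by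
    rw [← dist_zero_right, ← h0, hT.dist_eq, dist_zero_right]
  rw [real_inner_eq_norm_mul_self_add_norm_mul_self_sub_norm_sub_mul_self_div_two,
    real_inner_eq_norm_mul_self_add_norm_mul_self_sub_norm_sub_mul_self_div_two, hn, hn,
    ← dist_eq_norm, hT.dist_eq, dist_eq_norm]

theorem inner_octPoint_ne {M : ℕ} (hM : 3 ≤ M) {I : Finset (ZMod 8)} (i : ZMod 8) {y : EucPlane}
    (hy : y ∈ normals M I) : ⟪octPoint M i, y⟫ ≠ ⟪rootPoint M 2, rootPoint M 0⟫ := by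
  have h16 : (2 * M : ℤ) ∣ 16 * M := ⟨8, by ring⟩
  have hlow : ∀ l : ℤ, (2 * M : ℤ) ∣ l → ¬ (2 * M : ℤ) ∣ l - 2 ∧ ¬ (2 * M : ℤ) ∣ l + 2 := by
    intro l hl
    constructor <;> intro h
    · have := Int.le_of_dvd (by norm_num) ((dvd_sub_right hl).1 h)
      omega
    · have := Int.le_of_dvd (by norm_num) ((dvd_add_right hl).1 h)
      omega
  rw [Ne]
  rcases hy with ⟨k, hk, rfl⟩ | ⟨j, -, rfl⟩
  · rw [octPoint, inner_rootPoint_eq_iff (by omega), sub_zero]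
    obtain ⟨m, rfl⟩ := hk
    have he : ∀ n : ℤ, ¬ (16 * M : ℤ) ∣ 2 * n + 1 := by
      intro n h
      have : (2 : ℤ) ∣ 2 * n + 1 := dvd_trans ⟨8 * M, by ring⟩ h
      omega
    have h1 := he (M * i.val - m - 2)
    have h2 := he (M * i.val - m)
    rintro (h | h)
    · exact h1 (by convert h using 1; ring)
    · exact h2 (by convert h using 1; ring)
  · rw [octPoint, octPoint, inner_rootPoint_eq_iff (by omega), sub_zero]
    have h := hlow (2 * M * i.val - 2 * M * j.val)
      (dvd_sub (dvd_mul_right _ _) (dvd_mul_right _ _))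
    rintro (h' | h')
    exacts [h.1 (h16.trans h'), h.2 (h16.trans h')]

theorem not_isometric_truncatedPolygon {M : ℕ} (hM : 3 ≤ M) :
    ¬ ∃ T : EucPlane ≃ᵢ EucPlane,
      T '' truncatedPolygon M {0, 1, 3, 4} = truncatedPolygon M {0, 1, 2, 5} := by
  rintro ⟨T, hT⟩
  have hM0 : 0 < M := by omega
  have hc := cos_pi_div_pos hM0
  set R := (Real.cos (Real.pi / ((8 * M : ℕ) : ℝ)))⁻¹ with hR
  have hmaps : ∀ x ∈ truncatedPolygon M {0, 1, 3, 4}, T x ∈ truncatedPolygon M {0, 1, 2, 5} :=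
    fun x hx => hT ▸ Set.mem_image_of_mem T hx
  have hbd : ∀ x ∈ truncatedPolygon M {0, 1, 3, 4}, ‖T x‖ ≤ R := fun x hx => by
    rw [← mem_closedBall_zero_iff]
    exact polarBody_normals_subset hM0 _
      ((mem_frontier_polarBody (finite_normals hM0 _)).1 (hmaps x hx)).1
  have hd1 : ¬ (2 * M : ℤ) ∣ 2 := fun h => by
    have := Int.le_of_dvd (by norm_num) h
    omega
  have hd2 : ¬ (2 * M : ℤ) ∣ 2 + 8 * M := fun h =>
    hd1 ((dvd_add_left ⟨4, by ring⟩).1 h)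
  have hv1 := smul_rootPoint_mem_truncatedPolygon hM {0, 1, 3, 4} even_two hd1
  have hv2 := smul_rootPoint_mem_truncatedPolygon hM {0, 1, 3, 4}
    (even_two.add ⟨4 * M, by ring⟩) hd2
  rw [rootPoint_add_half hM0, smul_neg] at hv2
  have hT0 : T 0 = 0 := isometry_map_zero T.isometry
    (by rw [norm_smul, norm_rootPoint, mul_one, Real.norm_of_nonneg (inv_nonneg.2 hc.le)])
    (hbd _ hv1) (hbd _ hv2)
  have hinner := isometry_inner_eq T.isometry hT0
  have hnorm : ∀ x, ‖T x‖ = ‖x‖ := fun x => by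
    rw [← dist_zero_right, ← hT0, T.isometry.dist_eq, dist_zero_right]
  have hmem : ∀ x, T x ∈ normals M {0, 1, 2, 5} ↔ x ∈ normals M {0, 1, 3, 4} := by
    intro x
    rw [← mem_frontier_polarBody_and_norm_eq_one (finite_normals hM0 _) norm_of_mem_normals,
      ← mem_frontier_polarBody_and_norm_eq_one (finite_normals hM0 _) norm_of_mem_normals, hnorm]
    refine and_congr_left fun _ => ?_
    change T x ∈ truncatedPolygon M _ ↔ x ∈ truncatedPolygon M _
    rw [← hT, T.injective.mem_set_image]
  have hoct : ∀ i ∈ ({0, 1, 3, 4} : Finset (ZMod 8)),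
      ∃ j ∈ ({0, 1, 2, 5} : Finset (ZMod 8)), octPoint M j = T (octPoint M i) := by
    intro i hi
    rcases (hmem (octPoint M i)).2 (Or.inr ⟨i, hi, rfl⟩) with ⟨k, hk, h⟩ | ⟨j, hj, h⟩
    · exfalso
      have hk2 : rootPoint M (k - 2) ∈ normals M {0, 1, 2, 5} :=
        Or.inl ⟨_, hk.sub_even even_two, rfl⟩
      obtain ⟨y, hy⟩ := T.surjective (rootPoint M (k - 2))
      rw [← hy, hmem] at hk2
      apply inner_octPoint_ne hM i hk2
      rw [← hinner, hy, h, inner_rootPoint_eq_iff hM0]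
      left
      simp
    · exact ⟨j, hj, h⟩
  choose! f hf using hoct
  refine not_exists_isometry_homometric ⟨f, fun i hi => (hf i hi).1, fun i hi j hj => ?_⟩
  rw [← inner_octPoint_eq_iff hM0, (hf i hi).2, (hf j hj).2, hinner]

theorem exists_cos_pi_div_ge {c : ℝ} (hc : c < 1) :
    ∃ M : ℕ, 3 ≤ M ∧ c ≤ Real.cos (Real.pi / ((8 * M : ℕ) : ℝ)) := by
  have h1 : Filter.Tendsto (fun M : ℕ => ((8 * M : ℕ) : ℝ)) Filter.atTop Filter.atTop :=
    tendsto_natCast_atTop_atTop.comp (Filter.tendsto_id.const_mul_atTop' (by norm_num))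
  have h2 : Filter.Tendsto (fun M : ℕ => Real.cos (Real.pi / ((8 * M : ℕ) : ℝ))) Filter.atTop
      (nhds (Real.cos 0)) :=
    (Real.continuous_cos.tendsto 0).comp (h1.const_div_atTop Real.pi)
  rw [Real.cos_zero] at h2
  exact ((Filter.eventually_ge_atTop 3).and
    ((h2.eventually (lt_mem_nhds hc)).mono fun _ h => h.le)).exists

/-- **Corollary.**  For every `ε > 0` there exist simple closed planar curves `X₁`,
`X₂` (convex polygonal ones), each within Hausdorff distance `ε` of the unit circle,
which are not related by any Euclidean isometry of `ℝ²` and yet have identical global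
distance distributions. -/
theorem histogram_counterexamples_near_circle (ε : ℝ) (hε : 0 < ε) :
    ∃ A B : Set EucPlane,
      IsSimpleClosedPolygon A ∧ IsSimpleClosedPolygon B ∧
      IsConvexCurve A ∧ IsConvexCurve B ∧
      Metric.hausdorffDist (Metric.sphere (0 : EucPlane) 1) A < ε ∧
      Metric.hausdorffDist (Metric.sphere (0 : EucPlane) 1) B < ε ∧
      (¬ ∃ T : EucPlane ≃ᵢ EucPlane, T '' A = B) ∧
      ∀ r : ℝ, 0 ≤ r → curveGlobalDistrib A r = curveGlobalDistrib B r := by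
  have hlt : max (20 / 21) (1 + ε / 2)⁻¹ < (1 : ℝ) :=
    max_lt (by norm_num) (inv_lt_one_of_one_lt₀ (by linarith))
  obtain ⟨M, hM, hcM⟩ := exists_cos_pi_div_ge hlt
  have hM0 : 0 < M := by omega
  have hc := (le_max_left _ _).trans hcM
  have hc' := (le_max_right _ _).trans hcM
  have hpos := cos_pi_div_pos hM0
  have hR : (Real.cos (Real.pi / ((8 * M : ℕ) : ℝ)))⁻¹ ≤ 1 + ε / 2 :=
    inv_le_of_inv_le₀ (by linarith) hc'
  have hdist : ∀ I, hausdorffDist (sphere (0 : EucPlane) 1) (truncatedPolygon M I) < ε := by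
    intro I
    have := hausdorffDist_sphere_frontier_polarBody_le (finite_normals hM0 I) norm_of_mem_normals
      ((one_le_inv₀ hpos).2 (Real.cos_le_one _)) (polarBody_normals_subset hM0 I)
    rw [truncatedPolygon]
    linarith
  have hpoly : ∀ I, IsSimpleClosedPolygon (truncatedPolygon M I) := fun I =>
    isSimpleClosedPolygon_frontier_polarBody (finite_normals hM0 I) norm_of_mem_normals
      (polarBody_normals_subset hM0 I)
  have hconv : ∀ I, IsConvexCurve (truncatedPolygon M I) := fun I =>
    isConvexCurve_frontier_polarBody (polarBody_normals_subset hM0 I)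
  exact ⟨truncatedPolygon M {0, 1, 3, 4}, truncatedPolygon M {0, 1, 2, 5}, hpoly _, hpoly _,
    hconv _, hconv _, hdist _, hdist _, not_isometric_truncatedPolygon hM,
    fun r _ => curveGlobalDistrib_homometric hM0 hc r⟩
end
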